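/- arXiv:1108.0499 — 2 statements merged into one kernel-verified Lean document; each statement's English description precedes it below -/
import Mathlib

section
/- (Main theorem.) Let n ≥ 1, 1 ≤ p < ∞, 0 < T < ∞, let i ≥ 0 be an integer, let α satisfy 2i < α < 2i+2, and let (φ′,ψ′) be a Littlewood–Paley family on ℝⁿ. There exist constants c, C > 0 (depending only on n, p, T, α, i, φ′, ψ′) such that for every Schwartz function f on ℝⁿ, the heat extension u(X,t) = (Γ(·,t)*f)(X) satisfies c·B_{α−2/p, p}(f) ≤ ‖u‖_{B^{α,α/2}_p(ℝⁿ_T)} ≤ C·B_{α−2/p, p}(f). -/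
noncomputable section

open MeasureTheory Real Complex
open scoped ENNReal NNReal Real BigOperators

/-- Euclidean space `ℝⁿ`. -/
abbrev Rn (n : ℕ) : Type := EuclideanSpace ℝ (Fin n)

/-- The space `ℝ^{n+1} = ℝⁿ × ℝ`, points written `(X, t)`. -/
abbrev Rn1 (n : ℕ) : Type := EuclideanSpace ℝ (Fin n) × ℝ

/-- Fourier transform on `ℝ^{n+1}`:
`𝓕f(ξ,τ) = ∫ e^{−2πi(X·ξ + tτ)} f(X,t) dX dt`. -/
def FT1 {n : ℕ} (f : Rn1 n → ℂ) (q : Rn1 n) : ℂ :=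
  ∫ p : Rn1 n,
    Complex.exp (-(2 * (π : ℂ) * Complex.I) *
      (((∑ k, p.1 k * q.1 k) + p.2 * q.2 : ℝ) : ℂ)) * f p

/-- Inverse Fourier transform on `ℝ^{n+1}`. -/
def IFT1 {n : ℕ} (f : Rn1 n → ℂ) (x : Rn1 n) : ℂ :=
  ∫ q : Rn1 n,
    Complex.exp ((2 * (π : ℂ) * Complex.I) *
      (((∑ k, q.1 k * x.1 k) + q.2 * x.2 : ℝ) : ℂ)) * f q

/-- The Fourier multiplier operator `f ↦ 𝓕⁻¹(m · 𝓕 f)` on `ℝ^{n+1}`. -/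
def MOp {n : ℕ} (m : Rn1 n → ℂ) (f : Rn1 n → ℂ) : Rn1 n → ℂ :=
  IFT1 (fun q => m q * FT1 f q)

/-- The symbol `m_α(ξ,τ) = (1 + 4π²|ξ|² + iτ)^{α/2}` (principal branch). -/
def mSym {n : ℕ} (α : ℝ) (q : Rn1 n) : ℂ :=
  (1 + 4 * (π : ℂ) ^ 2 * (‖q.1‖ : ℂ) ^ 2 + Complex.I * (q.2 : ℂ)) ^ ((α : ℂ) / 2)

/-- Partial derivative `∂_{X_k}`. -/
def dX {n : ℕ} (k : Fin n) (f : Rn1 n → ℂ) : Rn1 n → ℂ :=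
  fun x => fderiv ℝ f x (EuclideanSpace.single k 1, 0)

/-- Partial derivative `∂_t`. -/
def dT {n : ℕ} (f : Rn1 n → ℂ) : Rn1 n → ℂ :=
  fun x => fderiv ℝ f x (0, 1)

/-- Iterated spatial derivative `D_X^β` for a multi-index `β`. -/
def dXmulti {n : ℕ} (β : Fin n → ℕ) (f : Rn1 n → ℂ) : Rn1 n → ℂ :=
  (List.finRange n).foldr (fun k g => (dX k)^[β k] g) f

/-- The half time-derivative `D_t^{1/2} f = 𝓕⁻¹(|τ|^{1/2}·𝓕f)`. -/
def halfDt {n : ℕ} (f : Rn1 n → ℂ) : Rn1 n → ℂ :=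
  MOp (fun q => ((|q.2| ^ ((1 : ℝ) / 2) : ℝ) : ℂ)) f

/-- The `Lᵖ(ℝ^{n+1})` norm (as a value in `ℝ≥0∞`), `p` a real exponent. -/
def pNorm {n : ℕ} (p : ℝ) (f : Rn1 n → ℂ) : ℝ≥0∞ :=
  eLpNorm f (ENNReal.ofReal p) volume

/-- Multi-indices `β ∈ ℕⁿ` with `|β| = N`. -/
def multiIdx (n N : ℕ) : Finset (Fin n → ℕ) :=
  (Fintype.piFinset fun _ : Fin n => Finset.range (N + 1)).filter fun β => (∑ k, β k) = N

/-- Convolution on `ℝ^{n+1}`. -/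
def conv1 {n : ℕ} (g f : Rn1 n → ℂ) : Rn1 n → ℂ :=
  fun x => ∫ y : Rn1 n, g (x - y) * f y

/-- A parabolic Littlewood–Paley family on `ℝ^{n+1}`. -/
structure ParabolicLP (n : ℕ) where
  φ : SchwartzMap (Rn1 n) ℂ
  ψ : SchwartzMap (Rn1 n) ℂ
  ft_pos : ∀ q : Rn1 n,
    1 / 2 < ‖q.1‖ + |q.2| ^ ((1 : ℝ) / 2) → ‖q.1‖ + |q.2| ^ ((1 : ℝ) / 2) < 2 →
      0 < (FT1 (⇑φ) q).re ∧ (FT1 (⇑φ) q).im = 0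
  ft_supp : ∀ q : Rn1 n,
    ¬(1 / 2 < ‖q.1‖ + |q.2| ^ ((1 : ℝ) / 2) ∧ ‖q.1‖ + |q.2| ^ ((1 : ℝ) / 2) < 2) →
      FT1 (⇑φ) q = 0
  ft_sum : ∀ q : Rn1 n, q ≠ 0 →
    ∑' i : ℤ, FT1 (⇑φ) (((2 : ℝ) ^ (-i)) • q.1, ((2 : ℝ) ^ (-(2 * i))) * q.2) = 1
  ft_psi : ∀ q : Rn1 n,
    FT1 (⇑ψ) q =
      1 - ∑' i : ℕ,
        FT1 (⇑φ) (((2 : ℝ) ^ (-((i : ℤ) + 1))) • q.1, ((2 : ℝ) ^ (-(2 * ((i : ℤ) + 1)))) * q.2)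

/-- The dilate `φ_i`, whose Fourier transform is `𝓕φ(2^{−i}ξ, 2^{−2i}τ)`. -/
def lpPhi {n : ℕ} (P : ParabolicLP n) (i : ℕ) : Rn1 n → ℂ :=
  fun x => (((2 : ℝ) ^ (i * (n + 2)) : ℝ) : ℂ) *
    P.φ (((2 : ℝ) ^ i) • x.1, ((2 : ℝ) ^ (2 * i)) * x.2)

/-- Parabolic Besov norm `N_{s,p}(f)` on `ℝ^{n+1}`, `1 ≤ p < ∞`. -/
def pBesov {n : ℕ} (P : ParabolicLP n) (s p : ℝ) (f : Rn1 n → ℂ) : ℝ≥0∞ :=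
  eLpNorm (conv1 (⇑P.ψ) f) (ENNReal.ofReal p) volume +
  (∑' i : ℕ,
    (ENNReal.ofReal ((2 : ℝ) ^ (s * ((i : ℝ) + 1))) *
      eLpNorm (conv1 (lpPhi P (i + 1)) f) (ENNReal.ofReal p) volume) ^ p) ^ (1 / p)

/-- Parabolic Besov norm `N_{s,∞}(f)` on `ℝ^{n+1}`. -/
def pBesovInf {n : ℕ} (P : ParabolicLP n) (s : ℝ) (f : Rn1 n → ℂ) : ℝ≥0∞ :=
  max (eLpNorm (conv1 (⇑P.ψ) f) ⊤ volume)
    (⨆ i : ℕ, ENNReal.ofReal ((2 : ℝ) ^ (s * ((i : ℝ) + 1))) *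
      eLpNorm (conv1 (lpPhi P (i + 1)) f) ⊤ volume)

/-- The time interval `(0, T)` for `0 < T ≤ ∞`. -/
def tSet (T : ℝ≥0∞) : Set ℝ := {t : ℝ | 0 < t ∧ ENNReal.ofReal t < T}

/-- Lebesgue measure restricted to the strip `ℝⁿ × (0,T)`. -/
def stripMeasure (n : ℕ) (T : ℝ≥0∞) : Measure (Rn1 n) :=
  volume.restrict {x : Rn1 n | x.2 ∈ tSet T}

/-- The parabolic Sobolev norm `‖g‖_{W^{2i,i}_p(ℝⁿ_T)}`. -/
def wNorm {n : ℕ} (i : ℕ) (p : ℝ) (T : ℝ≥0∞) (g : Rn1 n → ℂ) : ℝ≥0∞ :=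
  ∑ l ∈ Finset.range (i + 1),
    ∑ β ∈ (Fintype.piFinset fun _ : Fin n => Finset.range (2 * i + 1)).filter
        (fun β => (∑ k, β k) + 2 * l ≤ 2 * i),
      eLpNorm (dXmulti β (dT^[l] g)) (ENNReal.ofReal p) (stripMeasure n T)

/-- Time-regularity seminorm `[g]_{t,β,p,T}`. -/
def semT {n : ℕ} (b p : ℝ) (T : ℝ≥0∞) (g : Rn1 n → ℂ) : ℝ≥0∞ :=
  (∫⁻ X : Rn n, ∫⁻ t in tSet T, ∫⁻ s in tSet T,
      ENNReal.ofReal (‖g (X, t) - g (X, s)‖ ^ p / |t - s| ^ (1 + p * b / 2))) ^ (1 / p)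

/-- Space-regularity seminorm `[g]_{x,β,p,T}`. -/
def semX {n : ℕ} (b p : ℝ) (T : ℝ≥0∞) (g : Rn1 n → ℂ) : ℝ≥0∞ :=
  (∫⁻ t in tSet T, ∫⁻ X : Rn n, ∫⁻ Y : Rn n,
      ENNReal.ofReal (‖g (X + Y, t) - 2 * g (X, t) + g (X - Y, t)‖ ^ p /
        ‖Y‖ ^ ((n : ℝ) + p * b))) ^ (1 / p)

/-- The parabolic Besov norm `‖g‖_{B^{α,α/2}_p(ℝⁿ_T)}`, formed with index `i` where
`2i < α < 2i+2`. -/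
def pbNorm {n : ℕ} (i : ℕ) (α p : ℝ) (T : ℝ≥0∞) (g : Rn1 n → ℂ) : ℝ≥0∞ :=
  wNorm i p T g +
  ∑ l ∈ Finset.range (i + 1),
    ∑ β ∈ (Fintype.piFinset fun _ : Fin n => Finset.range (2 * i + 1)).filter
        (fun β => (∑ k, β k) + 2 * l = 2 * i),
      (semT (α - 2 * i) p T (dXmulti β (dT^[l] g)) +
        semX (α - 2 * i) p T (dXmulti β (dT^[l] g)))

/-- Fourier transform on `ℝⁿ`. -/
def FTn {n : ℕ} (f : Rn n → ℂ) (ξ : Rn n) : ℂ :=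
  ∫ x : Rn n, Complex.exp (-(2 * (π : ℂ) * Complex.I) * (((∑ k, x k * ξ k : ℝ)) : ℂ)) * f x

/-- Inverse Fourier transform on `ℝⁿ`. -/
def IFTn {n : ℕ} (f : Rn n → ℂ) (x : Rn n) : ℂ :=
  ∫ ξ : Rn n, Complex.exp ((2 * (π : ℂ) * Complex.I) * (((∑ k, ξ k * x k : ℝ)) : ℂ)) * f ξ

/-- Convolution on `ℝⁿ`. -/
def convn {n : ℕ} (g f : Rn n → ℂ) : Rn n → ℂ := fun x => ∫ y : Rn n, g (x - y) * f y

/-- A Littlewood–Paley family on `ℝⁿ`. -/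
structure LPFamily (n : ℕ) where
  φ : SchwartzMap (Rn n) ℂ
  ψ : SchwartzMap (Rn n) ℂ
  ft_pos : ∀ ξ : Rn n, 1 / 2 < ‖ξ‖ → ‖ξ‖ < 2 →
    0 < (FTn (⇑φ) ξ).re ∧ (FTn (⇑φ) ξ).im = 0
  ft_supp : ∀ ξ : Rn n, ¬(1 / 2 < ‖ξ‖ ∧ ‖ξ‖ < 2) → FTn (⇑φ) ξ = 0
  ft_sum : ∀ ξ : Rn n, ξ ≠ 0 → ∑' i : ℤ, FTn (⇑φ) (((2 : ℝ) ^ (-i)) • ξ) = 1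
  ft_psi : ∀ ξ : Rn n,
    FTn (⇑ψ) ξ = 1 - ∑' i : ℕ, FTn (⇑φ) (((2 : ℝ) ^ (-((i : ℤ) + 1))) • ξ)

/-- The dilate `φ′_i(x) = 2^{in} φ′(2^i x)`. -/
def lpPhin {n : ℕ} (P : LPFamily n) (i : ℕ) : Rn n → ℂ :=
  fun x => (((2 : ℝ) ^ (i * n) : ℝ) : ℂ) * P.φ (((2 : ℝ) ^ i) • x)

/-- Besov norm `B_{s,p}(f)` on `ℝⁿ`, `1 ≤ p < ∞`. -/
def besovN {n : ℕ} (P : LPFamily n) (s p : ℝ) (f : Rn n → ℂ) : ℝ≥0∞ :=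
  eLpNorm (convn (⇑P.ψ) f) (ENNReal.ofReal p) volume +
  (∑' i : ℕ,
    (ENNReal.ofReal ((2 : ℝ) ^ (s * ((i : ℝ) + 1))) *
      eLpNorm (convn (lpPhin P (i + 1)) f) (ENNReal.ofReal p) volume) ^ p) ^ (1 / p)

/-- The heat kernel `Γ(X,t)` on `ℝⁿ` (zero for `t ≤ 0`). -/
def heatKer (n : ℕ) (X : Rn n) (t : ℝ) : ℝ :=
  if 0 < t then (4 * π * t) ^ (-(n : ℝ) / 2) * Real.exp (-‖X‖ ^ 2 / (4 * t)) else 0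

/-- The heat extension `u(X,t) = ∫ Γ(X−Y,t) f(Y) dY`. -/
def heatExt {n : ℕ} (f : Rn n → ℂ) : Rn1 n → ℂ :=
  fun x => ∫ Y : Rn n, (heatKer n (x.1 - Y) x.2 : ℂ) * f Y

namespace HeatBesov

open FourierTransform
open scoped RealInnerProductSpace ContDiff SchwartzMap

section FourierMultipliers

/-- Jensen's inequality for an unnormalised weight `w`. -/
lemma rpow_lintegral_mul_le {X : Type*} [MeasurableSpace X] (μ : Measure X) {p : ℝ} (hp : 1 ≤ p)
    {w a : X → ℝ≥0∞} (hw : AEMeasurable w μ) (ha : AEMeasurable a μ) :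
    (∫⁻ x, w x * a x ∂μ) ^ p ≤ (∫⁻ x, w x ∂μ) ^ (p - 1) * ∫⁻ x, w x * a x ^ p ∂μ := by
  rcases hp.eq_or_lt with rfl | hp1
  · simp
  have hp0 : 0 < p := by linarith
  set q := p.conjExponent
  have hpq : p.HolderConjugate q := Real.HolderConjugate.conjExponent hp1
  have hq0 : 0 < q := hpq.symm.pos
  have hsum : 1 / q + 1 / p = 1 := by
    have := hpq.inv_add_inv_eq_one
    simp only [one_div]; linarith
  have hsplit : ∀ x, w x * a x = w x ^ (1 / q) * (w x ^ (1 / p) * a x) := fun x => by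
    rw [← mul_assoc, ← ENNReal.rpow_add_of_nonneg _ _ (by positivity) (by positivity), hsum,
      ENNReal.rpow_one]
  calc (∫⁻ x, w x * a x ∂μ) ^ p
      = (∫⁻ x, ((fun x => w x ^ (1 / q)) * (fun x => w x ^ (1 / p) * a x)) x ∂μ) ^ p := by
        simp only [Pi.mul_apply, ← hsplit]
    _ ≤ ((∫⁻ x, (w x ^ (1 / q)) ^ q ∂μ) ^ (1 / q) *
          (∫⁻ x, (w x ^ (1 / p) * a x) ^ p ∂μ) ^ (1 / p)) ^ p := by
        gcongr
        exact ENNReal.lintegral_mul_le_Lp_mul_Lq μ hpq.symm (hw.pow_const _)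
          ((hw.pow_const _).mul ha)
    _ = (∫⁻ x, w x ∂μ) ^ (p - 1) * ∫⁻ x, w x * a x ^ p ∂μ := by
        rw [ENNReal.mul_rpow_of_nonneg _ _ hp0.le, ← ENNReal.rpow_mul, ← ENNReal.rpow_mul]
        congr 1
        · congr 1
          · congr 1; ext x; rw [← ENNReal.rpow_mul, one_div_mul_cancel hq0.ne', ENNReal.rpow_one]
          · have h1 : 1 / q = 1 - 1 / p := by linarith
            rw [h1]; field_simp
        · rw [one_div_mul_cancel hp0.ne', ENNReal.rpow_one]
          congr 1; ext x
          rw [ENNReal.mul_rpow_of_nonneg _ _ hp0.le, ← ENNReal.rpow_mul,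
            one_div_mul_cancel hp0.ne', ENNReal.rpow_one]

lemma eLpNorm_ofReal_eq {X E : Type*} [MeasurableSpace X] [NormedAddCommGroup E] {μ : Measure X}
    {p : ℝ} (hp : 1 ≤ p) (f : X → E) :
    eLpNorm f (ENNReal.ofReal p) μ = (∫⁻ x, ‖f x‖ₑ ^ p ∂μ) ^ (1 / p) := by
  have hp0 : 0 < p := by linarith
  rw [eLpNorm_eq_lintegral_rpow_enorm_toReal (by simpa using hp0) ENNReal.ofReal_ne_top,
    ENNReal.toReal_ofReal hp0.le]

lemma eLpNorm_ofReal_rpow {X E : Type*} [MeasurableSpace X] [NormedAddCommGroup E] {μ : Measure X}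
    {p : ℝ} (hp : 1 ≤ p) (f : X → E) :
    eLpNorm f (ENNReal.ofReal p) μ ^ p = ∫⁻ x, ‖f x‖ₑ ^ p ∂μ := by
  have hp0 : 0 < p := by linarith
  rw [eLpNorm_ofReal_eq hp, ← ENNReal.rpow_mul, one_div_mul_cancel hp0.ne', ENNReal.rpow_one]

variable {n : ℕ}

lemma continuous_fourierInv {g : Rn n → ℂ} (hg : Integrable g) : Continuous (𝓕⁻ g) :=
  VectorFourier.fourierIntegral_continuous Real.continuous_fourierChar
    (continuous_inner (𝕜 := ℝ) (E := Rn n)).neg hg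

lemma continuous_fourier {g : Rn n → ℂ} (hg : Integrable g) : Continuous (𝓕 g) :=
  VectorFourier.fourierIntegral_continuous Real.continuous_fourierChar
    (by simpa using (continuous_inner (𝕜 := ℝ) (E := Rn n))) hg

lemma norm_fourier_le (g : Rn n → ℂ) (ξ : Rn n) : ‖𝓕 g ξ‖ ≤ ∫ x, ‖g x‖ :=
  VectorFourier.norm_fourierIntegral_le_integral_norm _ _ _ _ _

lemma integrable_fourier_mul {K g : Rn n → ℂ} (hK : Integrable K) (hg : Integrable g) :
    Integrable (fun ξ => 𝓕 K ξ * g ξ) :=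
  hg.bdd_mul (continuous_fourier hK).aestronglyMeasurable
    (.of_forall fun ξ => norm_fourier_le K ξ)

/-- `𝓕⁻¹(𝓕K · g) = K * 𝓕⁻¹g`. -/
lemma fourierInv_fourier_mul {K g : Rn n → ℂ} (hK : Integrable K) (hg : Integrable g) (x : Rn n) :
    𝓕⁻ (fun ξ => 𝓕 K ξ * g ξ) x = ∫ y, K y * 𝓕⁻ g (x - y) := by
  have hG : Integrable (fun ξ => 𝐞 ⟪ξ, x⟫ • g ξ) := by
    have := (Real.fourierIntegral_convergent_iff (μ := volume) (f := g) (-x)).2 hg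
    simpa using this
  have := VectorFourier.integral_fourierIntegral_smul_eq_flip (e := 𝐞) (μ := volume) (ν := volume)
    (L := innerₗ (Rn n)) Real.continuous_fourierChar
    (by simpa using (continuous_inner (𝕜 := ℝ) (E := Rn n))) hK hG
  rw [Real.fourierInv_eq]
  refine Eq.trans ?_ (this.trans ?_)
  · refine integral_congr_ae (.of_forall fun ξ => ?_)
    change _ • (𝓕 K ξ * g ξ) = 𝓕 K ξ • _
    simp only [Circle.smul_def, smul_eq_mul]; ring
  · refine integral_congr_ae (.of_forall fun y => ?_)
    simp only [smul_eq_mul]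
    congr 1
    rw [Real.fourierInv_eq]
    refine integral_congr_ae (.of_forall fun ξ => ?_)
    simp only [LinearMap.flip_apply, innerₗ_apply_apply, inner_sub_right, smul_smul]
    rw [← AddChar.map_add_eq_mul, real_inner_comm]
    congr 2; ring

/-- `m` is an `Lᵖ` Fourier multiplier of norm at most `A`, tested on functions with integrable
Fourier transform. -/
def MulBound (p : ℝ) (m : Rn n → ℂ) (A : ℝ≥0∞) : Prop :=
  ∀ g : Rn n → ℂ, Integrable g → Integrable (fun ξ => m ξ * g ξ) ∧
    eLpNorm (𝓕⁻ (fun ξ => m ξ * g ξ)) (ENNReal.ofReal p) volume ≤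
      A * eLpNorm (𝓕⁻ g) (ENNReal.ofReal p) volume

variable {p : ℝ} {m m₁ m₂ : Rn n → ℂ} {A B A₁ A₂ : ℝ≥0∞}

/-- Young's inequality. -/
lemma MulBound.of_kernel (hp : 1 ≤ p) {K : Rn n → ℂ} (hK : Integrable K) :
    MulBound p (𝓕 K) (∫⁻ y, ‖K y‖ₑ) := by
  intro g hg
  refine ⟨integrable_fourier_mul hK hg, ?_⟩
  have hp0 : 0 < p := by linarith
  set h := 𝓕⁻ g
  have hh : Measurable h := (continuous_fourierInv hg).measurable
  rw [← ENNReal.rpow_le_rpow_iff hp0, ENNReal.mul_rpow_of_nonneg _ _ hp0.le,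
    eLpNorm_ofReal_rpow hp, eLpNorm_ofReal_rpow hp]
  have hKm : AEMeasurable (fun y => ‖K y‖ₑ) volume := hK.aestronglyMeasurable.enorm
  calc ∫⁻ x, ‖𝓕⁻ (fun ξ => 𝓕 K ξ * g ξ) x‖ₑ ^ p
      ≤ ∫⁻ x, (∫⁻ y, ‖K y‖ₑ * ‖h (x - y)‖ₑ) ^ p := by
        refine lintegral_mono fun x => ?_
        gcongr
        rw [fourierInv_fourier_mul hK hg]
        refine (enorm_integral_le_lintegral_enorm _).trans (le_of_eq ?_)
        simp [enorm_mul, h]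
    _ ≤ ∫⁻ x, (∫⁻ y, ‖K y‖ₑ) ^ (p - 1) * ∫⁻ y, ‖K y‖ₑ * ‖h (x - y)‖ₑ ^ p := by
        refine lintegral_mono fun x => ?_
        exact rpow_lintegral_mul_le _ hp hKm (by fun_prop)
    _ = (∫⁻ y, ‖K y‖ₑ) ^ (p - 1) * ∫⁻ y, ∫⁻ x, ‖K y‖ₑ * ‖h (x - y)‖ₑ ^ p := by
        have hjoint : AEMeasurable (Function.uncurry fun (x y : Rn n) =>
            ‖K y‖ₑ * ‖h (x - y)‖ₑ ^ p) (volume.prod volume) := by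
          refine AEMeasurable.mul ?_ ?_
          · exact hKm.comp_snd
          · exact (hh.comp (measurable_fst.sub measurable_snd)).enorm.pow_const p |>.aemeasurable
        rw [lintegral_const_mul'', lintegral_lintegral_swap hjoint]
        exact hjoint.lintegral_prod_right'
    _ = (∫⁻ y, ‖K y‖ₑ) ^ (p - 1) * ((∫⁻ y, ‖K y‖ₑ) * ∫⁻ x, ‖h x‖ₑ ^ p) := by
        congr 1
        rw [← lintegral_mul_const'' _ hKm]
        refine lintegral_congr fun y => ?_
        rw [lintegral_const_mul _ (by fun_prop),
          lintegral_sub_right_eq_self (fun x => ‖h x‖ₑ ^ p) y]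
    _ = (∫⁻ y, ‖K y‖ₑ) ^ p * ∫⁻ x, ‖h x‖ₑ ^ p := by
        rw [← mul_assoc]
        congr 1
        conv_lhs => rw [← ENNReal.rpow_one (∫⁻ y, ‖K y‖ₑ), ← ENNReal.rpow_mul, one_mul]
        rw [← ENNReal.rpow_add_of_nonneg _ _ (by linarith) zero_le_one, sub_add_cancel]

lemma MulBound.mono (h : MulBound p m A) (hAB : A ≤ B) : MulBound p m B := fun g hg =>
  ⟨(h g hg).1, (h g hg).2.trans (by gcongr)⟩

lemma MulBound.mul (h₁ : MulBound p m₁ A₁) (h₂ : MulBound p m₂ A₂) :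
    MulBound p (fun ξ => m₁ ξ * m₂ ξ) (A₁ * A₂) := fun g hg => by
  have i₂ := h₂ g hg
  have i₁ := h₁ _ i₂.1
  simp only [mul_assoc]
  exact ⟨i₁.1, i₁.2.trans (by gcongr; exact i₂.2)⟩

lemma fourierInv_add {g₁ g₂ : Rn n → ℂ} (h₁ : Integrable g₁) (h₂ : Integrable g₂) :
    𝓕⁻ (fun ξ => g₁ ξ + g₂ ξ) = 𝓕⁻ g₁ + 𝓕⁻ g₂ :=
  VectorFourier.fourierIntegral_add Real.continuous_fourierChar
    (continuous_inner (𝕜 := ℝ) (E := Rn n)).neg h₁ h₂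

lemma fourierInv_const_mul (c : ℂ) (g : Rn n → ℂ) :
    𝓕⁻ (fun ξ => c * g ξ) = c • 𝓕⁻ g :=
  VectorFourier.fourierIntegral_const_smul _ _ _ g c

lemma fourierInv_sub {g₁ g₂ : Rn n → ℂ} (h₁ : Integrable g₁) (h₂ : Integrable g₂) :
    𝓕⁻ (fun ξ => g₁ ξ - g₂ ξ) = 𝓕⁻ g₁ - 𝓕⁻ g₂ := by
  have := fourierInv_add h₁ (h₂.const_mul (-1))
  rw [fourierInv_const_mul] at this
  simpa [sub_eq_add_neg] using this

lemma MulBound.const_mul (c : ℂ) (h : MulBound p m A) :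
    MulBound p (fun ξ => c * m ξ) (‖c‖ₑ * A) := fun g hg => by
  have i := h g hg
  simp only [mul_assoc]
  refine ⟨i.1.const_mul c, ?_⟩
  rw [fourierInv_const_mul, eLpNorm_const_smul]
  gcongr
  exact i.2

lemma MulBound.sub (hp : 1 ≤ p) (h₁ : MulBound p m₁ A₁) (h₂ : MulBound p m₂ A₂) :
    MulBound p (fun ξ => m₁ ξ - m₂ ξ) (A₁ + A₂) := fun g hg => by
  have i₁ := h₁ g hg
  have i₂ := h₂ g hg
  simp only [sub_mul]
  refine ⟨i₁.1.sub i₂.1, ?_⟩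
  rw [fourierInv_sub i₁.1 i₂.1, add_mul]
  refine (eLpNorm_sub_le (continuous_fourierInv i₁.1).aestronglyMeasurable
    (continuous_fourierInv i₂.1).aestronglyMeasurable (by simpa using hp)).trans ?_
  gcongr
  exacts [i₁.2, i₂.2]

lemma MulBound.one : MulBound p (fun _ : Rn n => 1) 1 := fun g hg => by
  simpa using hg

lemma fourierInv_char_mul (y : Rn n) (g : Rn n → ℂ) (x : Rn n) :
    𝓕⁻ (fun ξ => (𝐞 ⟪ξ, y⟫ : ℂ) * g ξ) x = 𝓕⁻ g (x + y) := by
  simp only [Real.fourierInv_eq, inner_add_right, AddChar.map_add_eq_mul, Circle.smul_def,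
    smul_eq_mul, Circle.coe_mul, mul_assoc]

lemma integrable_char_mul (y : Rn n) {g : Rn n → ℂ} (hg : Integrable g) :
    Integrable (fun ξ => (𝐞 ⟪ξ, y⟫ : ℂ) * g ξ) := by
  have := (Real.fourierIntegral_convergent_iff (μ := volume) (f := g) (-y)).2 hg
  simpa [Circle.smul_def] using this

lemma MulBound.char (y : Rn n) : MulBound p (fun ξ => (𝐞 ⟪ξ, y⟫ : ℂ)) 1 := fun g hg => by
  refine ⟨integrable_char_mul y hg, ?_⟩
  rw [one_mul, show 𝓕⁻ (fun ξ => (𝐞 ⟪ξ, y⟫ : ℂ) * g ξ) = 𝓕⁻ g ∘ (· + y) from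
    funext fun x => fourierInv_char_mul y g x]
  exact (eLpNorm_comp_measurePreserving (continuous_fourierInv hg).aestronglyMeasurable
    (measurePreserving_add_right volume y)).le

lemma fourierInv_comp_smul {r : ℝ} (hr : 0 < r) (g : Rn n → ℂ) (x : Rn n) :
    𝓕⁻ (fun ξ => g (r • ξ)) x = ((r ^ n)⁻¹ : ℝ) • 𝓕⁻ g (r⁻¹ • x) := by
  simp only [Real.fourierInv_eq]
  have := Measure.integral_comp_smul (μ := (volume : Measure (Rn n)))
    (fun ξ => 𝐞 ⟪ξ, r⁻¹ • x⟫ • g ξ) r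
  rw [finrank_euclideanSpace_fin, abs_of_pos (by positivity)] at this
  rw [← this]
  refine integral_congr_ae (.of_forall fun ξ => ?_)
  simp only [inner_smul_left, inner_smul_right]
  congr 3
  simp [hr.ne']

lemma fourier_comp_smul {r : ℝ} (hr : 0 < r) (g : Rn n → ℂ) (x : Rn n) :
    𝓕 (fun ξ => g (r • ξ)) x = ((r ^ n)⁻¹ : ℝ) • 𝓕 g (r⁻¹ • x) := by
  have := fourierInv_comp_smul hr g (-x)
  rw [Real.fourierInv_eq_fourier_neg, Real.fourierInv_eq_fourier_neg] at this
  simpa using this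

/-- Multiplier norms are dilation invariant. -/
lemma MulBound.comp_smul {r : ℝ} (hr : 0 < r) (h : MulBound p m A) :
    MulBound p (fun ξ => m (r • ξ)) A := fun g hg => by
  have hg' : Integrable (fun ξ => g (r⁻¹ • ξ)) := hg.comp_smul (by positivity)
  have i := h _ hg'
  have e1 : (fun ξ => m (r • ξ) * g ξ) = fun ξ => (fun η => m η * g (r⁻¹ • η)) (r • ξ) := by
    ext ξ; simp [smul_smul, hr.ne']
  have e2 : g = fun ξ => (fun η => g (r⁻¹ • η)) (r • ξ) := by
    ext ξ; simp [smul_smul, hr.ne']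
  have key : ∀ v : Rn n → ℂ, Integrable v →
      eLpNorm (𝓕⁻ (fun ξ => v (r • ξ))) (ENNReal.ofReal p) volume =
      ‖((r ^ n)⁻¹ : ℝ)‖ₑ * eLpNorm (𝓕⁻ v) (ENNReal.ofReal p)
        (Measure.map (fun x : Rn n => r⁻¹ • x) volume) := by
    intro v hv
    rw [show 𝓕⁻ (fun ξ => v (r • ξ)) = ((r ^ n)⁻¹ : ℝ) • (𝓕⁻ v ∘ fun x => r⁻¹ • x) from
      funext fun x => fourierInv_comp_smul hr v x, eLpNorm_const_smul, eLpNorm_map_measure]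
    · exact (continuous_fourierInv hv).aestronglyMeasurable
    · fun_prop
  refine ⟨e1 ▸ i.1.comp_smul hr.ne', ?_⟩
  conv_rhs => rw [e2]
  rw [e1, key _ i.1, key _ hg', Measure.map_addHaar_smul _ (by positivity),
    eLpNorm_smul_measure_of_ne_top (by simp), eLpNorm_smul_measure_of_ne_top (by simp)]
  simp only [smul_eq_mul]
  calc _ ≤ ‖((r ^ n)⁻¹ : ℝ)‖ₑ * (_ * (A * eLpNorm (𝓕⁻ fun ξ => g (r⁻¹ • ξ))
        (ENNReal.ofReal p) volume)) := by gcongr; exact i.2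
    _ = _ := by ring

end FourierMultipliers

section CompactFamilies

lemma norm_iteratedFDeriv_slice_le {E G F : Type*} [NormedAddCommGroup E] [NormedSpace ℝ E]
    [NormedAddCommGroup G] [NormedSpace ℝ G] [NormedAddCommGroup F] [NormedSpace ℝ F]
    {f : E × G → F} {θ : E} {ξ : G} {N : ℕ} (hf : ContDiffAt ℝ N f (θ, ξ)) :
    ‖iteratedFDeriv ℝ N (fun η => f (θ, η)) ξ‖ ≤ ‖iteratedFDeriv ℝ N f (θ, ξ)‖ := by
  set F' : E × G → F := fun z => f (z + (θ, 0)) with hF'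
  have hF'd : ContDiffAt ℝ N F' (0, ξ) := by
    have : ContDiffAt ℝ N f ((0, ξ) + (θ, 0)) := by simpa using hf
    exact ContDiffAt.comp (f := fun z : E × G => z + (θ, 0)) (0, ξ) this (by fun_prop)
  obtain ⟨u, uo, hu, hcd⟩ := hF'd.contDiffWithinAt (s := Set.univ) |>.contDiffOn' le_rfl (by simp)
  rw [Set.insert_eq_of_mem (Set.mem_univ _), Set.univ_inter] at hcd
  set L := ContinuousLinearMap.inr ℝ E G
  have hLo : IsOpen (L ⁻¹' u) := uo.preimage L.continuous
  have key := L.iteratedFDerivWithin_comp_right hcd uo.uniqueDiffOn hLo.uniqueDiffOn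
    (x := ξ) (by simpa [L] using hu) (i := N) le_rfl
  rw [iteratedFDerivWithin_of_isOpen _ hLo (by simpa [L] using hu),
    iteratedFDerivWithin_of_isOpen _ uo (by simpa [L] using hu)] at key
  have e1 : F' ∘ L = fun η => f (θ, η) := by ext η; simp [F', L]
  rw [e1] at key
  rw [key]
  refine (ContinuousMultilinearMap.norm_compContinuousLinearMap_le _ _).trans ?_
  have e2 : iteratedFDeriv ℝ N F' (L ξ) = iteratedFDeriv ℝ N f (θ, ξ) := by
    have := iteratedFDerivWithin_comp_add_right (𝕜 := ℝ) (f := f) (s := Set.univ) N (θ, (0 : G))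
      (L ξ)
    simpa [iteratedFDerivWithin_univ, L, F'] using this
  rw [e2]
  refine mul_le_of_le_one_right (norm_nonneg _) (Finset.prod_le_one (fun _ _ => norm_nonneg _)
    fun _ _ => ContinuousLinearMap.opNorm_le_bound _ zero_le_one fun x => ?_)
  simp [L]

variable {n : ℕ} {p : ℝ}

/-- A smooth family of symbols with common compact support, over a compact parameter set, is
uniformly bounded as a family of multipliers. -/
lemma MulBound.exists_of_compact {E : Type*} [NormedAddCommGroup E] [NormedSpace ℝ E] (hp : 1 ≤ p)
    {Θ : Set E} (hΘ : IsCompact Θ) (m : E × Rn n → ℂ)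
    (hm : ∀ θ ∈ Θ, ∀ ξ, ContDiffAt ℝ ∞ m (θ, ξ)) (R : ℝ)
    (hR : ∀ θ ∈ Θ, ∀ ξ, R < ‖ξ‖ → m (θ, ξ) = 0) :
    ∃ C : ℝ≥0, ∀ θ ∈ Θ, MulBound p (fun ξ => m (θ, ξ)) C := by
  -- a continuous seminorm computing the `L¹` norm of the kernel
  let J : 𝓢(Rn n, ℂ) →L[ℝ] Lp ℂ 1 (volume : Measure (Rn n)) :=
    (SchwartzMap.toLpCLM ℝ ℂ 1 volume).comp (fourierInvCLM ℝ 𝓢(Rn n, ℂ))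
  let q : Seminorm ℝ 𝓢(Rn n, ℂ) := (normSeminorm ℝ _).comp J.toLinearMap
  have hq : Continuous q := continuous_norm.comp J.continuous
  obtain ⟨s, C, -, hqC⟩ := Seminorm.bound_of_continuous (schwartz_withSeminorms ℝ (Rn n) ℂ) q hq
  have hcd : ∀ θ ∈ Θ, ContDiff ℝ ∞ (fun ξ => m (θ, ξ)) := fun θ hθ =>
    contDiff_iff_contDiffAt.2 fun ξ => ContDiffAt.comp (g := m) (f := fun ξ => (θ, ξ)) ξ
      (hm θ hθ ξ) (by fun_prop)
  have hcs : ∀ θ ∈ Θ, HasCompactSupport (fun ξ => m (θ, ξ)) := fun θ hθ =>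
    HasCompactSupport.of_support_subset_isCompact (isCompact_closedBall 0 R) fun ξ hξ => by
      by_contra h
      exact hξ (hR θ hθ ξ (by simpa using h))
  have hbd : ∀ k : ℕ × ℕ, ∃ M : ℝ, 0 ≤ M ∧ ∀ θ ∈ Θ, ∀ ξ,
      ‖ξ‖ ^ k.1 * ‖iteratedFDeriv ℝ k.2 (fun η => m (θ, η)) ξ‖ ≤ M := by
    intro k
    have hK : IsCompact (Θ ×ˢ Metric.closedBall (0 : Rn n) R) :=
      hΘ.prod (isCompact_closedBall 0 R)
    have hc : ContinuousOn (fun z : E × Rn n => ‖z.2‖ ^ k.1 * ‖iteratedFDeriv ℝ k.2 m z‖)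
        (Θ ×ˢ Metric.closedBall (0 : Rn n) R) := fun z hz => by
      have h1 := (hm z.1 hz.1 z.2).continuousAt_iteratedFDeriv (k := k.2)
        (by exact_mod_cast le_top)
      exact ((continuous_snd.norm.pow k.1).continuousAt.mul h1.norm).continuousWithinAt
    obtain ⟨M, hM⟩ := hK.exists_bound_of_continuousOn hc
    refine ⟨max M 0, le_max_right _ _, fun θ hθ ξ => ?_⟩
    by_cases hξ : ξ ∈ Metric.closedBall (0 : Rn n) R
    · have h2 := norm_iteratedFDeriv_slice_le (N := k.2)
        ((hm θ hθ ξ).of_le (by exact_mod_cast le_top))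
      have h3 := hM (θ, ξ) ⟨hθ, hξ⟩
      rw [Real.norm_of_nonneg (by positivity)] at h3
      exact (mul_le_mul_of_nonneg_left h2 (by positivity)).trans (h3.trans (le_max_left _ _))
    · have hts : tsupport (fun η => m (θ, η)) ⊆ Metric.closedBall 0 R :=
        closure_minimal (fun η hη => by
          by_contra h
          exact hη (hR θ hθ η (by simpa using h))) Metric.isClosed_closedBall
      have h4 : iteratedFDeriv ℝ k.2 (fun η => m (θ, η)) ξ = 0 := by
        by_contra h
        exact hξ (hts (support_iteratedFDeriv_subset k.2 h))
      simp [h4]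
  choose M hM0 hM using hbd
  set S : ℝ := ∑ k ∈ s, M k
  have hS0 : 0 ≤ S := Finset.sum_nonneg fun k _ => hM0 k
  refine ⟨C * S.toNNReal, fun θ hθ => ?_⟩
  set fS : 𝓢(Rn n, ℂ) := (hcs θ hθ).toSchwartzMap (hcd θ hθ)
  have hfS : (fS : Rn n → ℂ) = fun ξ => m (θ, ξ) := rfl
  have hsup : s.sup (schwartzSeminormFamily ℝ (Rn n) ℂ) fS ≤ S :=
    Seminorm.finset_sup_apply_le hS0 fun k hk =>
      (SchwartzMap.seminorm_le_bound ℝ k.1 k.2 fS (hM0 k) (hM k θ hθ)).trans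
        (Finset.single_le_sum (fun k _ => hM0 k) hk)
  have h5 : q fS ≤ C * S := (hqC fS).trans (by
    change (C : ℝ) * _ ≤ _
    gcongr)
  set K : 𝓢(Rn n, ℂ) := 𝓕⁻ fS
  have h6 : q fS = ∫ x, ‖K x‖ := SchwartzMap.norm_toLp_one (f := K)
  have h7 : 𝓕 (K : Rn n → ℂ) = fun ξ => m (θ, ξ) := by
    rw [← hfS, ← SchwartzMap.fourier_coe]
    congr 1
    exact FourierTransform.fourier_fourierInv_eq fS
  rw [← h7]
  refine (MulBound.of_kernel hp K.integrable).mono ?_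
  rw [← ofReal_integral_norm_eq_lintegral_enorm K.integrable, ← h6]
  rw [ENNReal.coe_mul, ← ENNReal.ofReal_coe_nnreal, ← ENNReal.ofReal, ← ENNReal.ofReal_mul C.coe_nonneg]
  exact ENNReal.ofReal_le_ofReal h5

end CompactFamilies

section HeatSymbols

variable {n : ℕ} {p : ℝ}

/-- The symbol of `-Δ`. -/
def qs (ξ : Rn n) : ℝ := 4 * π ^ 2 * ‖ξ‖ ^ 2

/-- The symbol of the heat semigroup. -/
def hs (t : ℝ) (ξ : Rn n) : ℂ := (Real.exp (-(t * qs ξ)) : ℝ)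

lemma qs_nonneg (ξ : Rn n) : 0 ≤ qs ξ := by unfold qs; positivity

lemma continuous_qs : Continuous (qs : Rn n → ℝ) := by unfold qs; fun_prop

lemma contDiff_qs : ContDiff ℝ ∞ (qs : Rn n → ℝ) := by
  unfold qs
  exact contDiff_const.mul (contDiff_norm_sq ℝ)

lemma qs_smul (r : ℝ) (ξ : Rn n) : qs (r • ξ) = r ^ 2 * qs ξ := by
  simp only [qs, norm_smul, mul_pow, Real.norm_eq_abs, sq_abs]; ring

lemma qs_pos {ξ : Rn n} (h : ξ ≠ 0) : 0 < qs ξ := by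
  have := norm_pos_iff.2 h
  unfold qs; positivity

lemma norm_hs_le {t : ℝ} (ht : 0 ≤ t) (ξ : Rn n) : ‖hs t ξ‖ ≤ 1 := by
  rw [hs, Complex.norm_real, Real.norm_of_nonneg (Real.exp_pos _).le, Real.exp_le_one_iff]
  have := qs_nonneg ξ
  nlinarith [mul_nonneg ht this]

lemma continuous_hs : Continuous fun z : ℝ × Rn n => hs z.1 z.2 := by
  unfold hs
  have := continuous_qs (n := n)
  fun_prop

lemma hs_add (s t : ℝ) (ξ : Rn n) : hs (s + t) ξ = hs s ξ * hs t ξ := by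
  rw [hs, hs, hs, ← Complex.ofReal_mul, ← Real.exp_add]
  congr 2; ring

lemma hs_smul (t r : ℝ) (ξ : Rn n) : hs t (r • ξ) = hs (t * r ^ 2) ξ := by
  simp only [hs, qs_smul, mul_assoc]

/-- The solution operator of the heat equation on the Fourier side. -/
def W (g : Rn n → ℂ) (x : Rn1 n) : ℂ := 𝓕⁻ (fun ξ => hs |x.2| ξ * g ξ) x.1

lemma W_of_nonneg (g : Rn n → ℂ) (X : Rn n) {t : ℝ} (ht : 0 ≤ t) :
    W g (X, t) = 𝓕⁻ (fun ξ => hs t ξ * g ξ) X := by simp only [W, abs_of_nonneg ht]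

lemma continuous_hs_right (t : ℝ) : Continuous (hs t : Rn n → ℂ) :=
  continuous_hs.comp (by fun_prop : Continuous fun ξ : Rn n => (t, ξ))

lemma integrable_hs_mul {t : ℝ} (ht : 0 ≤ t) {g : Rn n → ℂ} (hg : Integrable g) :
    Integrable (fun ξ => hs t ξ * g ξ) :=
  hg.bdd_mul (continuous_hs_right t).aestronglyMeasurable (.of_forall fun ξ => norm_hs_le ht ξ)

lemma continuous_W {g : Rn n → ℂ} (hg : Integrable g) : Continuous (W g) := by
  have e : W g = fun x : Rn1 n => ∫ ξ, Complex.exp (↑(2 * π * ⟪ξ, x.1⟫) * Complex.I) *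
      (hs |x.2| ξ * g ξ) := by ext x; simp only [W, Real.fourierInv_eq', smul_eq_mul]
  have hph : Continuous fun z : Rn n × Rn1 n =>
      Complex.exp (↑(2 * π * ⟪z.1, z.2.1⟫) * Complex.I) := by fun_prop
  rw [e]
  refine continuous_of_dominated (bound := fun ξ => ‖g ξ‖) (fun x => ?_)
    (fun x => .of_forall fun ξ => ?_) hg.norm (.of_forall fun ξ => ?_)
  · exact AEStronglyMeasurable.mul
      (hph.comp (by fun_prop : Continuous fun ξ : Rn n => (ξ, x))).aestronglyMeasurable
      ((continuous_hs_right _).aestronglyMeasurable.mul hg.aestronglyMeasurable)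
  · rw [norm_mul, Complex.norm_exp_ofReal_mul_I, one_mul, norm_mul]
    exact mul_le_of_le_one_left (norm_nonneg _) (norm_hs_le (abs_nonneg _) ξ)
  · have : Continuous fun x : Rn1 n => hs |x.2| ξ :=
      continuous_hs.comp (by fun_prop : Continuous fun x : Rn1 n => (|x.2|, ξ))
    exact (hph.comp (by fun_prop : Continuous fun x : Rn1 n => (ξ, x))).mul
      (this.mul continuous_const)

lemma fourier_heatKer {t : ℝ} (ht : 0 < t) :
    Integrable (fun y => (heatKer n y t : ℂ)) ∧ 𝓕 (fun y => (heatKer n y t : ℂ)) = hs t := by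
  set b : ℂ := ((1 / (4 * t) : ℝ) : ℂ)
  have hb : 0 < b.re := by simp only [b, Complex.ofReal_re]; positivity
  set c : ℂ := (((4 * π * t) ^ (-(n : ℝ) / 2) : ℝ) : ℂ)
  have e : (fun y : Rn n => (heatKer n y t : ℂ)) =
      fun y => c * Complex.exp (-b * (‖y‖ : ℂ) ^ 2) := by
    ext y
    simp only [heatKer, ht, if_true, c, b]
    push_cast
    congr 2
    field_simp
  have hI : Integrable (fun y : Rn n => Complex.exp (-b * (‖y‖ : ℂ) ^ 2)) := by
    simpa using GaussianFourier.integrable_cexp_neg_mul_sq_norm_add (V := Rn n) hb 0 0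
  rw [e]
  refine ⟨hI.const_mul c, ?_⟩
  have := VectorFourier.fourierIntegral_const_smul 𝐞 (volume : Measure (Rn n)) (innerₗ (Rn n))
    (fun y : Rn n => Complex.exp (-b * (‖y‖ : ℂ) ^ 2)) c
  refine this.trans ?_
  ext w
  have h2 := fourier_gaussian_innerProductSpace (V := Rn n) hb w
  change c • 𝓕 (fun y : Rn n => Complex.exp (-b * (‖y‖ : ℂ) ^ 2)) w = _
  rw [h2, finrank_euclideanSpace_fin]
  have h3 : ((π : ℂ) / b) ^ ((n : ℂ) / 2) = (((4 * π * t) ^ ((n : ℝ) / 2) : ℝ) : ℂ) := by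
    rw [Complex.ofReal_cpow (by positivity)]
    simp only [b]; push_cast
    congr 1
    field_simp
  rw [h3, smul_eq_mul, ← mul_assoc, ← Complex.ofReal_mul, ← Real.rpow_add (by positivity),
    show -(n : ℝ) / 2 + n / 2 = 0 by ring, Real.rpow_zero, hs, qs]
  simp only [b]; push_cast
  rw [one_mul]
  congr 1
  field_simp

lemma fourierInv_fourier_schwartz (f : 𝓢(Rn n, ℂ)) : 𝓕⁻ (𝓕 (f : Rn n → ℂ)) = f :=
  f.continuous.fourierInv_fourier_eq f.integrable (𝓕 f).integrable

lemma integrable_fourier_schwartz (f : 𝓢(Rn n, ℂ)) : Integrable (𝓕 (f : Rn n → ℂ)) :=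
  (𝓕 f).integrable

/-- `K * f = 𝓕⁻¹(𝓕K · 𝓕f)`. -/
lemma convn_eq {K : Rn n → ℂ} (hK : Integrable K) (f : 𝓢(Rn n, ℂ)) :
    convn K f = 𝓕⁻ (fun ξ => 𝓕 K ξ * 𝓕 (f : Rn n → ℂ) ξ) := by
  ext x
  rw [fourierInv_fourier_mul hK (integrable_fourier_schwartz f), fourierInv_fourier_schwartz,
    convn, ← integral_sub_left_eq_self _ volume x]
  simp

lemma heatExt_eq (f : 𝓢(Rn n, ℂ)) (X : Rn n) {t : ℝ} (ht : 0 < t) :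
    heatExt f (X, t) = W (𝓕 (f : Rn n → ℂ)) (X, t) := by
  have h := fourier_heatKer (n := n) ht
  rw [W_of_nonneg _ _ ht.le, ← h.2, ← convn_eq h.1]
  rfl

/-- Functions all of whose moments are integrable. -/
def Rapid (g : Rn n → ℂ) : Prop :=
  AEStronglyMeasurable g volume ∧ ∀ k : ℕ, Integrable (fun ξ => ‖ξ‖ ^ k * ‖g ξ‖)

lemma Rapid.integrable {g : Rn n → ℂ} (h : Rapid g) : Integrable g := by
  rw [← integrable_norm_iff h.1]
  simpa using h.2 0

lemma Rapid.mul {g c : Rn n → ℂ} (h : Rapid g) (hc : Continuous c) {C : ℝ} {j : ℕ}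
    (hb : ∀ ξ, ‖c ξ‖ ≤ C * ‖ξ‖ ^ j) : Rapid (fun ξ => c ξ * g ξ) := by
  refine ⟨hc.aestronglyMeasurable.mul h.1, fun k => ?_⟩
  refine ((h.2 (k + j)).const_mul C).mono'
    (AEStronglyMeasurable.mul (by fun_prop) (hc.aestronglyMeasurable.mul h.1).norm)
    (.of_forall fun ξ => ?_)
  rw [norm_mul, norm_norm, norm_pow, norm_norm, norm_mul]
  calc ‖ξ‖ ^ k * (‖c ξ‖ * ‖g ξ‖) ≤ ‖ξ‖ ^ k * ((C * ‖ξ‖ ^ j) * ‖g ξ‖) := by gcongr; exact hb ξ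
    _ = _ := by ring

lemma rapid_fourier (f : 𝓢(Rn n, ℂ)) : Rapid (𝓕 (f : Rn n → ℂ)) :=
  ⟨(integrable_fourier_schwartz f).1, fun k => (𝓕 f).integrable_pow_mul volume k⟩

/-- The symbol of `∂_k`. -/
def ds (k : Fin n) (ξ : Rn n) : ℂ := 2 * π * Complex.I * (ξ k : ℂ)

lemma norm_ds_le (k : Fin n) (ξ : Rn n) : ‖ds k ξ‖ ≤ 2 * π * ‖ξ‖ ^ 1 := by
  simp only [ds, norm_mul, Complex.norm_real, Complex.norm_I, Complex.norm_ofNat, mul_one, pow_one,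
    Real.norm_of_nonneg Real.pi_pos.le]
  gcongr
  exact PiLp.norm_apply_le ξ k

lemma Rapid.ds_mul {g : Rn n → ℂ} (h : Rapid g) (k : Fin n) : Rapid (fun ξ => ds k ξ * g ξ) :=
  h.mul (by unfold ds; fun_prop) (norm_ds_le k)

lemma Rapid.qs_mul {g : Rn n → ℂ} (h : Rapid g) : Rapid (fun ξ => -(qs ξ : ℂ) * g ξ) := by
  refine h.mul (C := 4 * π ^ 2) (j := 2) ?_ fun ξ => ?_
  · have := continuous_qs (n := n)
    fun_prop
  · rw [norm_neg, Complex.norm_real, Real.norm_of_nonneg (qs_nonneg ξ), qs]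

/-- The derivative in `(X,t)` of the phase of the heat semigroup. -/
def phaseD (ξ : Rn n) : Rn1 n →L[ℝ] ℂ :=
  (2 * π * Complex.I) • (Complex.ofRealCLM.comp ((innerSL ℝ ξ).comp
    (ContinuousLinearMap.fst ℝ (Rn n) ℝ))) -
  (qs ξ : ℂ) • (Complex.ofRealCLM.comp (ContinuousLinearMap.snd ℝ (Rn n) ℝ))

lemma phaseD_apply (ξ : Rn n) (x : Rn1 n) :
    phaseD ξ x = 2 * π * Complex.I * (⟪ξ, x.1⟫ : ℝ) - (qs ξ : ℂ) * (x.2 : ℂ) := by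
  simp [phaseD]

lemma continuous_phaseD : Continuous (phaseD : Rn n → _) := by
  unfold phaseD
  refine Continuous.sub ?_ ?_
  · refine Continuous.const_smul ?_ (2 * (π : ℂ) * Complex.I)
    exact (ContinuousLinearMap.compL ℝ (Rn1 n) ℝ ℂ Complex.ofRealCLM).continuous.comp
      (((ContinuousLinearMap.compL ℝ (Rn1 n) (Rn n) ℝ).flip
        (ContinuousLinearMap.fst ℝ (Rn n) ℝ)).continuous.comp (innerSL ℝ).continuous)
  · exact (Complex.continuous_ofReal.comp continuous_qs).smul continuous_const

lemma norm_phaseD_le (ξ : Rn n) : ‖phaseD ξ‖ ≤ 2 * π * ‖ξ‖ + 4 * π ^ 2 * ‖ξ‖ ^ 2 := by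
  refine ContinuousLinearMap.opNorm_le_bound _ (by positivity) fun x => ?_
  rw [phaseD_apply, add_mul]
  refine (norm_sub_le _ _).trans (add_le_add ?_ ?_)
  · simp only [norm_mul, Complex.norm_real, Complex.norm_I, Complex.norm_ofNat,
      Real.norm_of_nonneg Real.pi_pos.le, mul_assoc, one_mul]
    gcongr
    refine (norm_inner_le_norm (𝕜 := ℝ) ξ x.1).trans ?_
    gcongr
    exact norm_fst_le x
  · rw [norm_mul, Complex.norm_real, Complex.norm_real, Real.norm_of_nonneg (qs_nonneg ξ), qs]
    gcongr
    exact norm_snd_le x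

lemma W_eq_integral_exp (g : Rn n → ℂ) {x : Rn1 n} (hx : 0 < x.2) :
    W g x = ∫ ξ, Complex.exp (phaseD ξ x) * g ξ := by
  rw [W, Real.fourierInv_eq', abs_of_pos hx]
  refine integral_congr_ae (.of_forall fun ξ => ?_)
  simp only [phaseD_apply, smul_eq_mul, hs, Complex.ofReal_exp, ← mul_assoc, ← Complex.exp_add]
  congr 2
  push_cast
  ring

lemma norm_exp_phaseD_le (ξ : Rn n) {x : Rn1 n} (hx : 0 ≤ x.2) :
    ‖Complex.exp (phaseD ξ x)‖ ≤ 1 := by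
  rw [Complex.norm_exp, Real.exp_le_one_iff, phaseD_apply]
  have := mul_nonneg (qs_nonneg ξ) hx
  simpa using this

lemma isOpen_upper : IsOpen {x : Rn1 n | 0 < x.2} := isOpen_lt continuous_const continuous_snd

lemma fderiv_W {g : Rn n → ℂ} (hg : Rapid g) {x : Rn1 n} (hx : 0 < x.2) (v : Rn1 n) :
    fderiv ℝ (W g) x v = W (fun ξ => phaseD ξ v * g ξ) x := by
  have hmeas : ∀ x : Rn1 n, Continuous fun ξ => Complex.exp (phaseD ξ x) := fun x =>
    Complex.continuous_exp.comp (continuous_phaseD.clm_apply continuous_const)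
  set F : Rn1 n → Rn n → ℂ := fun x ξ => Complex.exp (phaseD ξ x) * g ξ
  set F' : Rn1 n → Rn n → (Rn1 n →L[ℝ] ℂ) := fun x ξ => (Complex.exp (phaseD ξ x) * g ξ) • phaseD ξ
  have hF'm : AEStronglyMeasurable (F' x) volume :=
    ((hmeas x).aestronglyMeasurable.mul hg.1).smul continuous_phaseD.aestronglyMeasurable
  have hbi : Integrable fun ξ : Rn n => (2 * π * ‖ξ‖ + 4 * π ^ 2 * ‖ξ‖ ^ 2) * ‖g ξ‖ := by
    have := ((hg.2 1).const_mul (2 * π)).add ((hg.2 2).const_mul (4 * π ^ 2))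
    refine this.congr (.of_forall fun ξ => ?_)
    simp only [Pi.add_apply, pow_one]; ring
  have hb : ∀ ξ, ∀ y ∈ {x : Rn1 n | 0 < x.2}, ‖F' y ξ‖ ≤
      (2 * π * ‖ξ‖ + 4 * π ^ 2 * ‖ξ‖ ^ 2) * ‖g ξ‖ := fun ξ y hy => by
    rw [norm_smul, norm_mul, mul_comm]
    gcongr
    · exact norm_phaseD_le ξ
    · exact mul_le_of_le_one_left (norm_nonneg _) (norm_exp_phaseD_le ξ (le_of_lt hy))
  have hFi : Integrable (F x) := hg.integrable.bdd_mul (hmeas x).aestronglyMeasurable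
    (.of_forall fun ξ => norm_exp_phaseD_le ξ hx.le)
  have key : HasFDerivAt (fun x => ∫ ξ, F x ξ) (∫ ξ, F' x ξ) x := by
    refine hasFDerivAt_integral_of_dominated_of_fderiv_le (isOpen_upper.mem_nhds hx)
      (.of_forall fun y => (hmeas y).aestronglyMeasurable.mul hg.1) hFi hF'm
      (.of_forall hb) hbi (.of_forall fun ξ y _ => ?_)
    have h1 : HasFDerivAt (fun y => Complex.exp (phaseD ξ y))
        (Complex.exp (phaseD ξ y) • phaseD ξ) y := (phaseD ξ).hasFDerivAt.cexp
    refine (h1.mul_const (g ξ)).congr_fderiv ?_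
    refine ContinuousLinearMap.ext fun z => ?_
    simp only [F', _root_.smul_apply, smul_eq_mul]
    ring
  have hev : W g =ᶠ[nhds x] fun x => ∫ ξ, F x ξ := by
    filter_upwards [isOpen_upper.mem_nhds hx] with y hy
    exact W_eq_integral_exp g hy
  have hF'i : Integrable (F' x) := hbi.mono' hF'm (.of_forall fun ξ => hb ξ x hx)
  rw [hev.fderiv_eq, key.fderiv, ContinuousLinearMap.integral_apply hF'i, W_eq_integral_exp _ hx]
  refine integral_congr_ae (.of_forall fun ξ => ?_)
  simp only [F', _root_.smul_apply, smul_eq_mul]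
  ring

lemma dX_eqOn {u : Rn1 n → ℂ} {g : Rn n → ℂ} (hg : Rapid g) (k : Fin n)
    (h : Set.EqOn u (W g) {x | 0 < x.2}) :
    Set.EqOn (dX k u) (W (fun ξ => ds k ξ * g ξ)) {x | 0 < x.2} := fun x hx => by
  have : u =ᶠ[nhds x] W g := h.eventuallyEq_of_mem (isOpen_upper.mem_nhds hx)
  rw [dX, this.fderiv_eq, fderiv_W hg hx]
  congr 1
  ext ξ
  rw [phaseD_apply, ds, EuclideanSpace.inner_single_right]
  simp

lemma dT_eqOn {u : Rn1 n → ℂ} {g : Rn n → ℂ} (hg : Rapid g)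
    (h : Set.EqOn u (W g) {x | 0 < x.2}) :
    Set.EqOn (dT u) (W (fun ξ => -(qs ξ : ℂ) * g ξ)) {x | 0 < x.2} := fun x hx => by
  have : u =ᶠ[nhds x] W g := h.eventuallyEq_of_mem (isOpen_upper.mem_nhds hx)
  rw [dT, this.fderiv_eq, fderiv_W hg hx]
  congr 1
  ext ξ
  rw [phaseD_apply]
  simp

lemma dT_iterate_eqOn {u : Rn1 n → ℂ} {g : Rn n → ℂ} (hg : Rapid g)
    (h : Set.EqOn u (W g) {x | 0 < x.2}) (l : ℕ) :
    Rapid (fun ξ => (-(qs ξ : ℂ)) ^ l * g ξ) ∧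
    Set.EqOn (dT^[l] u) (W (fun ξ => (-(qs ξ : ℂ)) ^ l * g ξ)) {x | 0 < x.2} := by
  induction l with
  | zero => simpa using ⟨hg, h⟩
  | succ l ih =>
    rw [Function.iterate_succ_apply']
    have e : (fun ξ : Rn n => (-(qs ξ : ℂ)) ^ (l + 1) * g ξ) =
        fun ξ => -(qs ξ : ℂ) * ((-(qs ξ : ℂ)) ^ l * g ξ) := by ext ξ; ring
    rw [e]
    exact ⟨ih.1.qs_mul, dT_eqOn ih.1 ih.2⟩

lemma dX_iterate_eqOn {u : Rn1 n → ℂ} {g : Rn n → ℂ} (hg : Rapid g)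
    (h : Set.EqOn u (W g) {x | 0 < x.2}) (k : Fin n) (l : ℕ) :
    Rapid (fun ξ => ds k ξ ^ l * g ξ) ∧
    Set.EqOn ((dX k)^[l] u) (W (fun ξ => ds k ξ ^ l * g ξ)) {x | 0 < x.2} := by
  induction l with
  | zero => simpa using ⟨hg, h⟩
  | succ l ih =>
    rw [Function.iterate_succ_apply']
    have e : (fun ξ : Rn n => ds k ξ ^ (l + 1) * g ξ) =
        fun ξ => ds k ξ * (ds k ξ ^ l * g ξ) := by ext ξ; ring
    rw [e]
    exact ⟨ih.1.ds_mul k, dX_eqOn ih.1 k ih.2⟩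

lemma dXmulti_eqOn {u : Rn1 n → ℂ} {g : Rn n → ℂ} (hg : Rapid g)
    (h : Set.EqOn u (W g) {x | 0 < x.2}) (β : Fin n → ℕ) :
    Rapid (fun ξ => (∏ k, ds k ξ ^ β k) * g ξ) ∧
    Set.EqOn (dXmulti β u) (W (fun ξ => (∏ k, ds k ξ ^ β k) * g ξ)) {x | 0 < x.2} := by
  simp only [Fin.prod_univ_def, dXmulti]
  induction List.finRange n with
  | nil => simpa using ⟨hg, h⟩
  | cons k L ih =>
    simp only [List.map_cons, List.prod_cons, List.foldr_cons, mul_assoc]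
    exact dX_iterate_eqOn ih.1 ih.2 k (β k)

/-- The symbol of `D_X^β D_t^l` acting on solutions of the heat equation. -/
def Ms (β : Fin n → ℕ) (l : ℕ) (ξ : Rn n) : ℂ := (∏ k, ds k ξ ^ β k) * (-(qs ξ : ℂ)) ^ l

lemma rapid_Ms (β : Fin n → ℕ) (l : ℕ) (f : 𝓢(Rn n, ℂ)) :
    Rapid (fun ξ => Ms β l ξ * 𝓕 (f : Rn n → ℂ) ξ) := by
  have h1 := dT_iterate_eqOn (rapid_fourier f) (Set.eqOn_refl _ _) l
  simpa only [Ms, mul_assoc] using (dXmulti_eqOn h1.1 h1.2 β).1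

/-- Space-time derivatives of the heat extension on the Fourier side. -/
lemma deriv_heatExt (β : Fin n → ℕ) (l : ℕ) (f : 𝓢(Rn n, ℂ)) :
    Set.EqOn (dXmulti β (dT^[l] (heatExt f)))
      (W (fun ξ => Ms β l ξ * 𝓕 (f : Rn n → ℂ) ξ)) {x | 0 < x.2} := by
  have h0 : Set.EqOn (heatExt f) (W (𝓕 (f : Rn n → ℂ))) {x | 0 < x.2} :=
    fun x hx => heatExt_eq f x.1 hx
  have h1 := dT_iterate_eqOn (rapid_fourier f) h0 l
  simpa only [Ms, mul_assoc] using (dXmulti_eqOn h1.1 h1.2 β).2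

lemma contDiff_ds (k : Fin n) : ContDiff ℝ ∞ (ds k : Rn n → ℂ) := by
  unfold ds
  refine contDiff_const.mul (Complex.ofRealCLM.contDiff.comp ?_)
  exact (EuclideanSpace.proj (𝕜 := ℝ) k).contDiff

lemma contDiff_Ms (β : Fin n → ℕ) (l : ℕ) : ContDiff ℝ ∞ (Ms β l : Rn n → ℂ) := by
  unfold Ms
  refine (contDiff_prod fun k _ => (contDiff_ds k).pow (β k)).mul (ContDiff.pow ?_ l)
  exact (Complex.ofRealCLM.contDiff.comp contDiff_qs).neg

lemma Ms_smul (β : Fin n → ℕ) (l : ℕ) (r : ℝ) (ξ : Rn n) :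
    Ms β l (r • ξ) = (r : ℂ) ^ ((∑ k, β k) + 2 * l) * Ms β l ξ := by
  have h1 : ∀ k, ds k (r • ξ) = r * ds k ξ := fun k => by
    simp only [ds, PiLp.smul_apply, smul_eq_mul]; push_cast; ring
  simp only [Ms, h1, mul_pow, Finset.prod_mul_distrib, qs_smul, Finset.prod_pow_eq_pow_sum]
  push_cast
  rw [pow_add, pow_mul, neg_mul_eq_mul_neg, mul_pow]
  ring

lemma Ms_zero (l : ℕ) (ξ : Rn n) : Ms 0 l ξ = (-(qs ξ : ℂ)) ^ l := by simp [Ms]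

end HeatSymbols

section LittlewoodPaley

variable {n : ℕ} {p : ℝ}

lemma FTn_eq (f : Rn n → ℂ) : FTn f = 𝓕 f := by
  ext ξ
  rw [FTn, Real.fourier_eq']
  refine integral_congr_ae (.of_forall fun x => ?_)
  simp only [smul_eq_mul, PiLp.inner_apply, RCLike.inner_apply, conj_trivial]
  congr 2
  push_cast
  rw [show (∑ k, (ξ k : ℂ) * (x k : ℂ)) = ∑ k, (x k : ℂ) * (ξ k : ℂ) from
    Finset.sum_congr rfl fun k _ => mul_comm _ _]
  ring

/-- The symbols of the Littlewood–Paley projections. -/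
def lpSym (P : LPFamily n) : ℕ → Rn n → ℂ
  | 0 => 𝓕 (P.ψ : Rn n → ℂ)
  | j + 1 => fun ξ => 𝓕 (P.φ : Rn n → ℂ) (((2 : ℝ) ^ (j + 1))⁻¹ • ξ)

variable (P : LPFamily n)

lemma integrable_lpPhin (j : ℕ) : Integrable (lpPhin P j) := by
  unfold lpPhin
  exact (P.φ.integrable.comp_smul (by positivity)).const_mul _

lemma fourier_lpPhin (j : ℕ) : 𝓕 (lpPhin P (j + 1)) = lpSym P (j + 1) := by
  ext ξ
  have h1 := VectorFourier.fourierIntegral_const_smul 𝐞 (volume : Measure (Rn n)) (innerₗ (Rn n))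
    (fun y : Rn n => P.φ (((2 : ℝ) ^ (j + 1)) • y)) (((2 : ℝ) ^ ((j + 1) * n) : ℝ) : ℂ)
  have h2 := fourier_comp_smul (n := n) (r := (2 : ℝ) ^ (j + 1)) (by positivity) P.φ ξ
  refine (congrFun h1 ξ).trans ?_
  change (((2 : ℝ) ^ ((j + 1) * n) : ℝ) : ℂ) •
    𝓕 (fun y : Rn n => P.φ (((2 : ℝ) ^ (j + 1)) • y)) ξ = _
  rw [h2, lpSym, pow_mul, Complex.real_smul, smul_eq_mul, ← mul_assoc, ← Complex.ofReal_mul,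
    mul_inv_cancel₀ (by positivity), Complex.ofReal_one, one_mul]

/-- The `Lᵖ` norms of the Littlewood–Paley pieces. -/
def lpNorm (p : ℝ) (f : Rn n → ℂ) (j : ℕ) : ℝ≥0∞ :=
  eLpNorm (𝓕⁻ (fun ξ => lpSym P j ξ * 𝓕 f ξ)) (ENNReal.ofReal p) volume

lemma besovN_eq (s : ℝ) (f : 𝓢(Rn n, ℂ)) :
    besovN P s p f = lpNorm P p f 0 +
      (∑' j : ℕ, (ENNReal.ofReal ((2 : ℝ) ^ (s * ((j : ℝ) + 1))) * lpNorm P p f (j + 1)) ^ p)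
        ^ (1 / p) := by
  simp only [besovN, lpNorm, convn_eq P.ψ.integrable f, convn_eq (integrable_lpPhin P _) f,
    fourier_lpPhin]
  rfl

lemma phi_eq_zero {ξ : Rn n} (h : ¬(1 / 2 < ‖ξ‖ ∧ ‖ξ‖ < 2)) : 𝓕 (P.φ : Rn n → ℂ) ξ = 0 := by
  have := P.ft_supp ξ h
  rwa [FTn_eq] at this

lemma zpow_neg_natCast_add_one (j : ℕ) :
    (2 : ℝ) ^ (-((j : ℤ) + 1)) = ((2 : ℝ) ^ (j + 1))⁻¹ := by
  rw [zpow_neg]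
  norm_cast

lemma psi_eq (ξ : Rn n) : lpSym P 0 ξ = 1 - ∑' j : ℕ, lpSym P (j + 1) ξ := by
  have := P.ft_psi ξ
  simp only [FTn_eq, zpow_neg_natCast_add_one] at this
  exact this

lemma lpSym_zero_eq_zero {ξ : Rn n} (h : 2 ≤ ‖ξ‖) : lpSym P 0 ξ = 0 := by
  have hξ : ξ ≠ 0 := by rintro rfl; norm_num at h
  have h1 := P.ft_sum ξ hξ
  rw [psi_eq, ← h1, FTn_eq, sub_eq_zero]
  refine Eq.symm (Eq.trans (b := ∑' j : ℕ, 𝓕 (P.φ : Rn n → ℂ) (((2 : ℝ) ^ (-((j : ℤ) + 1))) • ξ))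
    (by simp only [zpow_neg_natCast_add_one]; rfl) ?_)
  refine Function.Injective.tsum_eq (g := fun j : ℕ => (j : ℤ) + 1)
    (f := fun i : ℤ => 𝓕 (P.φ : Rn n → ℂ) (((2 : ℝ) ^ (-i)) • ξ))
    (fun a b hab => by simpa using hab) fun i hi => ?_
  by_contra hcon
  have hi0 : i ≤ 0 := by
    by_contra! hpos
    exact hcon ⟨(i - 1).toNat, by simp; omega⟩
  refine hi (phi_eq_zero P fun hh => ?_)
  have h2 : (1 : ℝ) ≤ (2 : ℝ) ^ (-i) := one_le_zpow₀ (by norm_num) (by omega)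
  rw [norm_smul, Real.norm_of_nonneg (by positivity)] at hh
  nlinarith [hh.2]

lemma exists_norm_phi_le : ∃ C : ℝ, 0 ≤ C ∧ ∀ ξ : Rn n, ‖𝓕 (P.φ : Rn n → ℂ) ξ‖ ≤ C * ‖ξ‖ := by
  refine ⟨2 * ∫ x, ‖P.φ x‖, by positivity, fun ξ => ?_⟩
  by_cases h : 1 / 2 < ‖ξ‖
  · have := norm_fourier_le P.φ ξ
    have h0 : 0 ≤ ∫ x, ‖P.φ x‖ := by positivity
    nlinarith
  · rw [phi_eq_zero P (fun hh => h hh.1), norm_zero]; positivity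

lemma summable_half_pow_succ : Summable fun j : ℕ => (1 / 2 : ℝ) ^ (j + 1) :=
  (summable_nat_add_iff 1).2 (summable_geometric_of_lt_one (by norm_num) (by norm_num))

lemma summable_lpSym (ξ : Rn n) : Summable fun j => lpSym P (j + 1) ξ := by
  obtain ⟨C, hC0, hC⟩ := exists_norm_phi_le P
  refine Summable.of_norm_bounded (g := fun j : ℕ => (C * ‖ξ‖) * (1 / 2 : ℝ) ^ (j + 1))
    (summable_half_pow_succ.mul_left _) fun j => ?_
  have h1 := hC (((2 : ℝ) ^ (j + 1))⁻¹ • ξ)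
  rw [norm_smul, Real.norm_of_nonneg (by positivity)] at h1
  change ‖𝓕 (P.φ : Rn n → ℂ) (((2 : ℝ) ^ (j + 1))⁻¹ • ξ)‖ ≤ (C * ‖ξ‖) * (1 / 2 : ℝ) ^ (j + 1)
  rw [one_div, inv_pow, mul_right_comm, mul_assoc C]
  simpa [mul_comm, mul_left_comm, mul_assoc] using h1

lemma hasSum_lpSym (ξ : Rn n) : HasSum (fun j => lpSym P j ξ) 1 := by
  have := HasSum.zero_add (f := fun j => lpSym P j ξ) (summable_lpSym P ξ).hasSum
  rwa [psi_eq, sub_add_cancel] at this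

lemma contDiff_fourier_schwartz (f : 𝓢(Rn n, ℂ)) : ContDiff ℝ ∞ (𝓕 (f : Rn n → ℂ)) :=
  (𝓕 f).smooth ⊤

lemma continuous_lpSym (j : ℕ) : Continuous (lpSym P j) := by
  cases j with
  | zero => exact (contDiff_fourier_schwartz P.ψ).continuous
  | succ j => exact (contDiff_fourier_schwartz P.φ).continuous.comp (by fun_prop)

lemma exists_norm_lpSym_le (j : ℕ) : ∃ C : ℝ, ∀ ξ, ‖lpSym P j ξ‖ ≤ C := by
  cases j with
  | zero => exact ⟨_, norm_fourier_le P.ψ⟩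
  | succ j => exact ⟨_, fun ξ => norm_fourier_le P.φ _⟩

lemma integrable_lpSym_mul (j : ℕ) {g : Rn n → ℂ} (hg : Integrable g) :
    Integrable (fun ξ => lpSym P j ξ * g ξ) := by
  obtain ⟨C, hC⟩ := exists_norm_lpSym_le P j
  exact hg.bdd_mul (continuous_lpSym P j).aestronglyMeasurable (.of_forall hC)

/-- The Littlewood–Paley decomposition, pointwise. -/
lemma hasSum_fourierInv_lpSym {g : Rn n → ℂ} (hg : Rapid g) (x : Rn n) :
    HasSum (fun j => 𝓕⁻ (fun ξ => lpSym P j ξ * g ξ) x) (𝓕⁻ g x) := by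
  obtain ⟨C, hC0, hC⟩ := exists_norm_phi_le P
  set F : ℕ → Rn n → ℂ := fun j ξ => 𝐞 ⟪ξ, x⟫ • (lpSym P j ξ * g ξ) with hF
  have hFi : ∀ j, Integrable (F j) := fun j => by
    have := (Real.fourierIntegral_convergent_iff (μ := volume)
      (f := fun ξ => lpSym P j ξ * g ξ) (-x)).2 (integrable_lpSym_mul P j hg.integrable)
    simpa using this
  have hFn : ∀ j ξ, ‖F j ξ‖ = ‖lpSym P j ξ‖ * ‖g ξ‖ := fun j ξ => by
    simp only [hF, Circle.norm_smul, norm_mul]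
  have hsum : Summable fun j => ∫ ξ, ‖F j ξ‖ := by
    rw [← summable_nat_add_iff 1]
    refine Summable.of_nonneg_of_le (f := fun j : ℕ => (C * ∫ ξ, ‖ξ‖ ^ 1 * ‖g ξ‖) *
      (1 / 2 : ℝ) ^ (j + 1)) (fun j => by positivity) (fun j => ?_) ?_
    · rw [mul_assoc, mul_comm (∫ ξ, _), ← integral_const_mul, ← integral_const_mul]
      refine integral_mono (hFi _).norm (((hg.2 1).const_mul _).const_mul _) fun ξ => ?_
      change ‖F (j + 1) ξ‖ ≤ _
      rw [hFn]
      have h1 := hC (((2 : ℝ) ^ (j + 1))⁻¹ • ξ)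
      rw [norm_smul, Real.norm_of_nonneg (by positivity)] at h1
      calc _ ≤ (C * (((2 : ℝ) ^ (j + 1))⁻¹ * ‖ξ‖)) * ‖g ξ‖ := by gcongr; exact h1
        _ = _ := by simp only [one_div, inv_pow, pow_one]; ring
    · exact summable_half_pow_succ.mul_left _
  have key := hasSum_integral_of_summable_integral_norm hFi hsum
  have hlim : 𝓕⁻ g x = ∫ ξ, ∑' j, F j ξ := by
    rw [Real.fourierInv_eq]
    refine integral_congr_ae (.of_forall fun ξ => ?_)
    change 𝐞 ⟪ξ, x⟫ • g ξ = ∑' j, F j ξ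
    have h2 := ((hasSum_lpSym P ξ).mul_right (g ξ)).const_smul (𝐞 ⟪ξ, x⟫)
    rw [one_mul] at h2
    exact h2.tsum_eq.symm
  rw [hlim]
  simpa only [Real.fourierInv_eq] using key

/-- Minkowski's inequality for the Littlewood–Paley decomposition. -/
lemma eLpNorm_fourierInv_le_tsum (hp : 1 ≤ p) {g : Rn n → ℂ} (hg : Rapid g) :
    eLpNorm (𝓕⁻ g) (ENNReal.ofReal p) volume ≤
      ∑' j, eLpNorm (𝓕⁻ (fun ξ => lpSym P j ξ * g ξ)) (ENNReal.ofReal p) volume := by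
  have hm : ∀ j, AEStronglyMeasurable (𝓕⁻ (fun ξ => lpSym P j ξ * g ξ)) volume := fun j =>
    (continuous_fourierInv (integrable_lpSym_mul P j hg.integrable)).aestronglyMeasurable
  refine (Lp.eLpNorm_lim_le_liminf_eLpNorm
    (f := fun N => ∑ j ∈ Finset.range N, 𝓕⁻ (fun ξ => lpSym P j ξ * g ξ))
    (fun N => Finset.aestronglyMeasurable_sum _ fun j _ => hm j) _
    (.of_forall fun x => ?_)).trans ?_
  · simpa using (hasSum_fourierInv_lpSym P hg x).tendsto_sum_nat
  · refine Filter.liminf_le_of_le (by isBoundedDefault) fun b hb => ?_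
    obtain ⟨N, hN⟩ := hb.exists
    exact hN.trans ((eLpNorm_sum_le (fun j _ => hm j) (by simpa using hp)).trans
      (ENNReal.sum_le_tsum _))

/-- Estimate of a multiplier from estimates of its localised pieces. -/
lemma eLpNorm_le_tsum_mul_lpNorm (hp : 1 ≤ p) (f : 𝓢(Rn n, ℂ)) {M : Rn n → ℂ}
    (hM : Rapid (fun ξ => M ξ * 𝓕 (f : Rn n → ℂ) ξ)) {m : ℕ → Rn n → ℂ} {D : ℕ → ℝ≥0∞}
    (hm : ∀ j, MulBound p (m j) (D j)) (h : ∀ j ξ, m j ξ * lpSym P j ξ = M ξ * lpSym P j ξ) :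
    eLpNorm (𝓕⁻ (fun ξ => M ξ * 𝓕 (f : Rn n → ℂ) ξ)) (ENNReal.ofReal p) volume ≤
      ∑' j, D j * lpNorm P p f j := by
  refine (eLpNorm_fourierInv_le_tsum P hp hM).trans (ENNReal.tsum_le_tsum fun j => ?_)
  have h1 := (hm j _ (integrable_lpSym_mul P j (integrable_fourier_schwartz f))).2
  refine le_of_eq_of_le ?_ h1
  congr 2
  ext ξ
  rw [← mul_assoc, ← mul_assoc, h, mul_comm (lpSym P j ξ)]

/-- A smooth cutoff equal to `1` on the ball of radius `2`. -/
def cutBall (ξ : Rn n) : ℂ := ((⟨2, 3, by norm_num, by norm_num⟩ : ContDiffBump (0 : Rn n)) ξ : ℝ)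

/-- A smooth cutoff equal to `1` on the annulus `1/2 ≤ ‖ξ‖ ≤ 2` and vanishing near `0`. -/
def cutAnn (ξ : Rn n) : ℂ := cutBall ξ *
  (1 - ((⟨1 / 4, 1 / 2, by norm_num, by norm_num⟩ : ContDiffBump (0 : Rn n)) ξ : ℝ))

lemma contDiff_cutBall : ContDiff ℝ ∞ (cutBall : Rn n → ℂ) :=
  Complex.ofRealCLM.contDiff.comp (ContDiffBump.contDiff _)

lemma contDiff_cutAnn : ContDiff ℝ ∞ (cutAnn : Rn n → ℂ) :=
  contDiff_cutBall.mul (contDiff_const.sub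
    (Complex.ofRealCLM.contDiff.comp (ContDiffBump.contDiff _)))

lemma cutBall_one {ξ : Rn n} (h : ‖ξ‖ ≤ 2) : cutBall ξ = 1 := by
  rw [cutBall, ContDiffBump.one_of_mem_closedBall _ (by simpa using h), Complex.ofReal_one]

lemma cutBall_zero {ξ : Rn n} (h : 3 < ‖ξ‖) : cutBall ξ = 0 := by
  rw [cutBall, ContDiffBump.zero_of_le_dist _ (by simpa using h.le), Complex.ofReal_zero]

lemma cutAnn_one {ξ : Rn n} (h1 : 1 / 2 ≤ ‖ξ‖) (h2 : ‖ξ‖ ≤ 2) : cutAnn ξ = 1 := by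
  rw [cutAnn, cutBall_one h2, ContDiffBump.zero_of_le_dist _ (by simpa using h1)]
  simp

lemma cutAnn_zero_of_lt {ξ : Rn n} (h : 3 < ‖ξ‖) : cutAnn ξ = 0 := by
  rw [cutAnn, cutBall_zero h, zero_mul]

lemma cutAnn_zero_of_le {ξ : Rn n} (h : ‖ξ‖ ≤ 1 / 4) : cutAnn ξ = 0 := by
  rw [cutAnn, ContDiffBump.one_of_mem_closedBall _ (by simpa using h)]
  simp

/-- Cutoffs adapted to the Littlewood–Paley pieces. -/
def cut : ℕ → Rn n → ℂ
  | 0 => cutBall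
  | j + 1 => fun ξ => cutAnn (((2 : ℝ) ^ (j + 1))⁻¹ • ξ)

lemma cut_mul_lpSym (j : ℕ) (ξ : Rn n) : cut j ξ * lpSym P j ξ = lpSym P j ξ := by
  cases j with
  | zero =>
    by_cases h : 2 ≤ ‖ξ‖
    · rw [lpSym_zero_eq_zero P h, mul_zero]
    · rw [cut, cutBall_one (le_of_not_ge h), one_mul]
  | succ j =>
    simp only [cut, lpSym]
    by_cases h : 1 / 2 < ‖((2 : ℝ) ^ (j + 1))⁻¹ • ξ‖ ∧ ‖((2 : ℝ) ^ (j + 1))⁻¹ • ξ‖ < 2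
    · rw [cutAnn_one h.1.le h.2.le, one_mul]
    · rw [phi_eq_zero P h, mul_zero]

end LittlewoodPaley

section LocalisedHeat

variable {n : ℕ} {p : ℝ}

/-- Families of multipliers localised to a fixed annulus are uniformly bounded. -/
lemma MulBound.exists_of_annulus {E : Type*} [NormedAddCommGroup E] [NormedSpace ℝ E]
    (hp : 1 ≤ p) {Θ : Set E} (hΘ : IsCompact Θ) {χ : Rn n → ℂ} (hχ : ContDiff ℝ ∞ χ) {r R : ℝ}
    (hr : 0 < r) (hχr : ∀ ξ, ‖ξ‖ ≤ r → χ ξ = 0) (hχR : ∀ ξ, R < ‖ξ‖ → χ ξ = 0)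
    (m : E × Rn n → ℂ) (hm : ∀ θ ∈ Θ, ∀ ξ ≠ 0, ContDiffAt ℝ ∞ m (θ, ξ)) :
    ∃ C : ℝ≥0, ∀ θ ∈ Θ, MulBound p (fun ξ => χ ξ * m (θ, ξ)) C := by
  refine MulBound.exists_of_compact hp hΘ (fun z => χ z.2 * m z) (fun θ hθ ξ => ?_) R
    fun θ _ ξ hξ => by simp only [hχR ξ hξ, zero_mul]
  by_cases h : ‖ξ‖ < r
  · refine (contDiffAt_const (c := (0 : ℂ))).congr_of_eventuallyEq ?_
    have : ∀ᶠ z : E × Rn n in nhds (θ, ξ), ‖z.2‖ < r :=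
      (continuous_snd.norm.continuousAt (x := (θ, ξ))).eventually (gt_mem_nhds h)
    filter_upwards [this] with z hz
    simp only [hχr _ hz.le, zero_mul]
  · have hξ : ξ ≠ 0 := by rintro rfl; exact h (by simpa using hr)
    exact ((hχ.comp contDiff_snd).contDiffAt).mul (hm θ hθ ξ hξ)

lemma contDiff_dslope_exp : ContDiff ℝ ∞ (dslope Complex.exp 0) := by
  have : Differentiable ℂ (dslope Complex.exp 0) := by
    rw [← differentiableOn_univ, Complex.differentiableOn_dslope Filter.univ_mem]
    exact Complex.differentiable_exp.differentiableOn
  exact this.contDiff.restrict_scalars ℝ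

lemma mul_dslope_exp (z : ℂ) : z * dslope Complex.exp 0 z = Complex.exp z - 1 := by
  simpa using sub_smul_dslope Complex.exp 0 z

lemma contDiff_hs_uncurry : ContDiff ℝ ∞ (fun z : ℝ × Rn n => hs z.1 z.2) := by
  unfold hs
  exact Complex.ofRealCLM.contDiff.comp
    (Real.contDiff_exp.comp (contDiff_fst.mul (contDiff_qs.comp contDiff_snd)).neg)

/-- The decay profile of the localised heat semigroup. -/
def kap (τ : ℝ) : ℝ≥0∞ := ENNReal.ofReal ((1 + τ ^ 2)⁻¹)

/-- The minimum of `1` and `x`. -/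
def mn (x : ℝ) : ℝ≥0∞ := ENNReal.ofReal (min 1 x)

lemma kap_le_one (τ : ℝ) : kap τ ≤ 1 := by
  rw [kap, ENNReal.ofReal_le_one]
  exact inv_le_one_of_one_le₀ (by nlinarith [sq_nonneg τ])

lemma ofReal_mul_kap {τ : ℝ} : ENNReal.ofReal (1 + τ ^ 2) * kap τ = 1 := by
  rw [kap, ← ENNReal.ofReal_mul (by positivity), mul_inv_cancel₀ (by positivity),
    ENNReal.ofReal_one]

/-- Uniform bounds for compact families localised to a ball. -/
lemma exists_mulBound_heat_of_le (hp : 1 ≤ p) {χ : Rn n → ℂ} (hχ : ContDiff ℝ ∞ χ) {R : ℝ}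
    (hχR : ∀ ξ, R < ‖ξ‖ → χ ξ = 0) (β : Fin n → ℕ) (l : ℕ) (T : ℝ) :
    ∃ C : ℝ≥0, ∀ t ∈ Set.Icc 0 T, MulBound p (fun ξ => χ ξ * (Ms β l ξ * hs t ξ)) (C * kap t) := by
  obtain ⟨C, hC⟩ := MulBound.exists_of_compact hp (isCompact_Icc (a := (0 : ℝ)) (b := T))
    (fun z : ℝ × Rn n => χ z.2 * (Ms β l z.2 * hs z.1 z.2))
    (fun θ _ ξ => ((hχ.comp contDiff_snd).mul
      (((contDiff_Ms β l).comp contDiff_snd).mul contDiff_hs_uncurry)).contDiffAt) R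
    fun θ _ ξ hξ => by simp only [hχR ξ hξ, zero_mul]
  refine ⟨C * Real.toNNReal (1 + T ^ 2), fun t ht => (hC t ht).mono ?_⟩
  rw [ENNReal.coe_mul, mul_assoc]
  refine le_mul_of_one_le_right zero_le (ofReal_mul_kap (τ := t).symm.le.trans ?_)
  refine mul_le_mul_left (ENNReal.ofReal_le_ofReal ?_) _
  have := ht.1; have := ht.2
  nlinarith

/-- Decay in `τ` of the heat semigroup localised to an annulus. -/
lemma exists_mulBound_heat (hp : 1 ≤ p) {χ : Rn n → ℂ} (hχ : ContDiff ℝ ∞ χ) {r R : ℝ}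
    (hr : 0 < r) (hχr : ∀ ξ, ‖ξ‖ ≤ r → χ ξ = 0) (hχR : ∀ ξ, R < ‖ξ‖ → χ ξ = 0)
    (β : Fin n → ℕ) (l : ℕ) :
    ∃ C : ℝ≥0, ∀ τ, 0 ≤ τ → MulBound p (fun ξ => χ ξ * (Ms β l ξ * hs τ ξ)) (C * kap τ) := by
  obtain ⟨C₁, hC₁⟩ := exists_mulBound_heat_of_le hp hχ hχR β l 1
  have hG := expNegInvGlue.contDiff_polynomial_eval_inv_mul (n := ⊤) (Polynomial.X ^ 2)
  obtain ⟨C₂, hC₂⟩ := MulBound.exists_of_annulus hp (isCompact_Icc (a := (0 : ℝ)) (b := 1)) hχ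
    hr hχr hχR (fun z : ℝ × Rn n => Ms β l z.2 * ((((qs z.2) ^ 2)⁻¹ *
      (Polynomial.eval (z.1 / qs z.2)⁻¹ (Polynomial.X ^ 2) * expNegInvGlue (z.1 / qs z.2)) : ℝ) :
        ℂ)) (fun θ _ ξ hξ => by
      have hq : ContDiffAt ℝ ∞ (fun z : ℝ × Rn n => qs z.2) (θ, ξ) :=
        (contDiff_qs.comp contDiff_snd).contDiffAt
      have hq0 : qs ξ ≠ 0 := (qs_pos hξ).ne'
      refine ((contDiff_Ms β l).comp contDiff_snd).contDiffAt.mul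
        (Complex.ofRealCLM.contDiff.contDiffAt.comp (θ, ξ) ?_)
      refine ((hq.pow 2).inv (pow_ne_zero 2 hq0)).mul ?_
      exact hG.contDiffAt.comp (θ, ξ) (contDiffAt_fst.div hq hq0))
  refine ⟨C₁ + 2 * C₂, fun τ hτ => ?_⟩
  rcases le_total τ 1 with h1 | h1
  · refine (hC₁ τ ⟨hτ, h1⟩).mono (mul_le_mul_left ?_ _)
    exact ENNReal.coe_le_coe.2 (le_add_of_nonneg_right zero_le)
  · have hτ0 : 0 < τ := by linarith
    have h2 := (hC₂ τ⁻¹ ⟨by positivity, inv_le_one_of_one_le₀ h1⟩).const_mul (((τ ^ 2)⁻¹ : ℝ) : ℂ)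
    have h3 : (fun ξ : Rn n => χ ξ * (Ms β l ξ * hs τ ξ)) = fun ξ => (((τ ^ 2)⁻¹ : ℝ) : ℂ) *
        (χ ξ * (Ms β l ξ * ((((qs ξ) ^ 2)⁻¹ * (Polynomial.eval (τ⁻¹ / qs ξ)⁻¹ (Polynomial.X ^ 2) *
          expNegInvGlue (τ⁻¹ / qs ξ)) : ℝ) : ℂ))) := by
      ext ξ
      by_cases hξ : ξ = 0
      · subst hξ
        rw [hχr 0 (by simpa using hr.le)]
        simp
      · have hq0 := qs_pos hξ
        rw [expNegInvGlue, if_neg (by rw [not_le]; positivity), hs]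
        rw [show (τ⁻¹ / qs ξ)⁻¹ = τ * qs ξ by field_simp]
        rw [Polynomial.eval_pow, Polynomial.eval_X]
        have : Real.exp (-(τ * qs ξ)) = (τ ^ 2)⁻¹ * ((qs ξ ^ 2)⁻¹ * ((τ * qs ξ) ^ 2 *
          Real.exp (-(τ * qs ξ)))) := by field_simp
        conv_lhs => rw [this]
        push_cast
        ring
    rw [h3]
    refine h2.mono ?_
    have h4 : ‖(((τ ^ 2)⁻¹ : ℝ) : ℂ)‖ₑ ≤ 2 * kap τ := by
      rw [← ofReal_norm, Complex.norm_real, Real.norm_of_nonneg (by positivity), kap,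
        ← ENNReal.ofReal_ofNat, ← ENNReal.ofReal_mul (by norm_num)]
      refine ENNReal.ofReal_le_ofReal ?_
      rw [← div_eq_mul_inv, inv_eq_one_div, div_le_div_iff₀ (by positivity) (by positivity)]
      nlinarith
    calc ‖(((τ ^ 2)⁻¹ : ℝ) : ℂ)‖ₑ * C₂ ≤ 2 * kap τ * C₂ := by gcongr
      _ = (2 * C₂ : ℝ≥0) * kap τ := by push_cast; ring
      _ ≤ _ := by gcongr; exact le_add_self

lemma exists_mulBound_one_sub_heat (hp : 1 ≤ p) {χ : Rn n → ℂ} (hχ : ContDiff ℝ ∞ χ) {R : ℝ}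
    (hχR : ∀ ξ, R < ‖ξ‖ → χ ξ = 0) (T : ℝ) :
    ∃ C : ℝ≥0, ∀ t ∈ Set.Icc 0 T,
      MulBound p (fun ξ => χ ξ * (hs t ξ - 1)) (C * ENNReal.ofReal t) := by
  obtain ⟨C, hC⟩ := MulBound.exists_of_compact hp (isCompact_Icc (a := (0 : ℝ)) (b := T))
    (fun z : ℝ × Rn n => χ z.2 * (-(qs z.2 : ℂ) * dslope Complex.exp 0 (-(z.1 * qs z.2) : ℝ)))
    (fun θ _ ξ => by
      have hq : ContDiff ℝ ∞ (fun z : ℝ × Rn n => qs z.2) := contDiff_qs.comp contDiff_snd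
      refine ((hχ.comp contDiff_snd).mul ((Complex.ofRealCLM.contDiff.comp hq).neg.mul
        (contDiff_dslope_exp.comp (Complex.ofRealCLM.contDiff.comp
          (contDiff_fst.mul hq).neg)))).contDiffAt) R
    fun θ _ ξ hξ => by simp only [hχR ξ hξ, zero_mul]
  refine ⟨C, fun t ht => ?_⟩
  have h1 := (hC t ht).const_mul (t : ℂ)
  rw [← ofReal_norm, Complex.norm_real, Real.norm_of_nonneg ht.1, mul_comm] at h1
  convert h1 using 2 with ξ
  have := mul_dslope_exp (-(t * qs ξ) : ℝ)
  rw [hs, Complex.ofReal_exp, ← this]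
  push_cast
  ring

lemma exists_mulBound_char_sub_one (hp : 1 ≤ p) {χ : Rn n → ℂ} (hχ : ContDiff ℝ ∞ χ) {R : ℝ}
    (hχR : ∀ ξ, R < ‖ξ‖ → χ ξ = 0) :
    ∃ C : ℝ≥0, ∀ y : Rn n, MulBound p (fun ξ => χ ξ * ((𝐞 ⟪ξ, y⟫ : ℂ) - 1)) (C * mn ‖y‖) := by
  obtain ⟨C₀, hC₀⟩ := MulBound.exists_of_compact hp (isCompact_singleton (x := (0 : ℝ)))
    (fun z : ℝ × Rn n => χ z.2) (fun θ _ ξ => (hχ.comp contDiff_snd).contDiffAt) R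
    fun θ _ ξ hξ => hχR ξ hξ
  obtain ⟨C, hC⟩ := MulBound.exists_of_compact hp
    ((isCompact_Icc (a := (0 : ℝ)) (b := 1)).prod (isCompact_closedBall (0 : Rn n) 1))
    (fun z : (ℝ × Rn n) × Rn n => χ z.2 * (((2 * π * ⟪z.2, z.1.2⟫ : ℝ) : ℂ) * I *
      dslope Complex.exp 0 (((2 * π * (z.1.1 * ⟪z.2, z.1.2⟫) : ℝ) : ℂ) * I)))
    (fun θ _ ξ => by
      have hi : ContDiff ℝ ∞ (fun z : (ℝ × Rn n) × Rn n => ⟪z.2, z.1.2⟫) :=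
        contDiff_snd.inner ℝ (contDiff_snd.comp contDiff_fst)
      refine ((hχ.comp contDiff_snd).mul (((Complex.ofRealCLM.contDiff.comp
        (contDiff_const.mul hi)).mul contDiff_const).mul (contDiff_dslope_exp.comp
        ((Complex.ofRealCLM.contDiff.comp (contDiff_const.mul ((contDiff_fst.comp
          contDiff_fst).mul hi))).mul contDiff_const)))).contDiffAt) R
    fun θ _ ξ hξ => by simp only [hχR ξ hξ, zero_mul]
  refine ⟨2 * C₀ + C, fun y => ?_⟩
  rcases le_total ‖y‖ 1 with h1 | h1
  · have h2 := (hC (‖y‖, ‖y‖⁻¹ • y) ⟨⟨norm_nonneg y, h1⟩, by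
      rw [mem_closedBall_zero_iff, norm_smul, norm_inv, norm_norm]
      exact inv_mul_le_one⟩).const_mul (‖y‖ : ℂ)
    rw [← ofReal_norm, Complex.norm_real, norm_norm, mul_comm (ENNReal.ofReal ‖y‖)] at h2
    refine MulBound.mono (A := C * ENNReal.ofReal ‖y‖) ?_ ?_
    · convert h2 using 2 with ξ
      have hin : ‖y‖ * ⟪ξ, ‖y‖⁻¹ • y⟫ = ⟪ξ, y⟫ := by
        rw [← inner_smul_right, smul_smul]
        by_cases hy : y = 0
        · simp [hy]
        · rw [mul_inv_cancel₀ (norm_ne_zero_iff.2 hy), one_smul]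
      have := mul_dslope_exp (((2 * π * ⟪ξ, y⟫ : ℝ) : ℂ) * I)
      rw [Real.fourierChar_apply, ← this]
      simp only [hin]
      rw [← hin]
      push_cast
      ring
    · rw [mn, min_eq_right h1]
      gcongr
      exact le_add_self
  · have h2 : MulBound p (fun ξ => χ ξ * ((𝐞 ⟪ξ, y⟫ : ℂ) - 1)) (C₀ * (1 + 1)) :=
      (hC₀ 0 rfl).mul ((MulBound.char y).sub hp MulBound.one)
    refine h2.mono ?_
    rw [mn, min_eq_left h1, ENNReal.ofReal_one, mul_one, ENNReal.coe_add, ENNReal.coe_mul,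
      one_add_one_eq_two, mul_comm]
    exact le_self_add

end LocalisedHeat

section FrequencyPieces

variable {n : ℕ} {p : ℝ}

lemma cut_succ_eq (j : ℕ) (ξ : Rn n) : cut (j + 1) ξ = cutAnn (((2 : ℝ) ^ (j + 1))⁻¹ • ξ) := rfl

lemma hs_inv_smul (t : ℝ) (j : ℕ) (ξ : Rn n) :
    hs (t * 4 ^ j) (((2 : ℝ) ^ j)⁻¹ • ξ) = hs t ξ := by
  rw [hs_smul]
  congr 1
  rw [show (4 : ℝ) = 2 ^ 2 by norm_num, ← pow_mul, inv_pow, ← pow_mul, mul_comm 2 j,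
    mul_assoc, mul_inv_cancel₀ (by positivity), mul_one]

lemma exists_mulBound_cut_heat (hp : 1 ≤ p) (β : Fin n → ℕ) (l : ℕ) (T : ℝ) :
    ∃ C : ℝ≥0, ∀ j, ∀ t ∈ Set.Icc 0 T, MulBound p (fun ξ => cut j ξ * (Ms β l ξ * hs t ξ))
      (C * 2 ^ (j * ((∑ k, β k) + 2 * l)) * kap (t * 4 ^ j)) := by
  obtain ⟨C₀, h₀⟩ := exists_mulBound_heat_of_le hp contDiff_cutBall (fun _ => cutBall_zero) β l T
  obtain ⟨C₁, h₁⟩ := exists_mulBound_heat hp contDiff_cutAnn (r := 1 / 4) (by norm_num)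
    (fun _ => cutAnn_zero_of_le) (fun _ => cutAnn_zero_of_lt) β l
  refine ⟨C₀ + C₁, fun j t ht => ?_⟩
  cases j with
  | zero =>
    refine (h₀ t ht).mono ?_
    simp only [zero_mul, pow_zero, mul_one, ENNReal.coe_add]
    gcongr
    exact le_self_add
  | succ j =>
    have h2 := ((h₁ (t * 4 ^ (j + 1)) (mul_nonneg ht.1 (by positivity))).comp_smul
      (r := ((2 : ℝ) ^ (j + 1))⁻¹) (by positivity)).const_mul
        (2 ^ ((j + 1) * ((∑ k, β k) + 2 * l)))
    refine MulBound.mono (A := 2 ^ ((j + 1) * ((∑ k, β k) + 2 * l)) *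
      (C₁ * kap (t * 4 ^ (j + 1)))) ?_ ?_
    · convert h2 using 2 with ξ
      · rw [cut_succ_eq, hs_inv_smul, Ms_smul]
        push_cast
        rw [inv_pow, pow_mul]
        field_simp
      · simp [enorm_pow, ← ofReal_norm (2 : ℂ)]
    · rw [mul_left_comm, ← mul_assoc, ENNReal.coe_add]
      gcongr
      exact le_add_self

lemma exists_mulBound_cut (hp : 1 ≤ p) :
    ∃ C : ℝ≥0, ∀ j, MulBound p (cut j : Rn n → ℂ) C := by
  obtain ⟨C, hC⟩ := exists_mulBound_cut_heat (n := n) hp 0 0 0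
  refine ⟨C, fun j => ?_⟩
  have := hC j 0 ⟨le_rfl, le_rfl⟩
  refine MulBound.mono (A := C * 2 ^ (j * ((∑ k, (0 : Fin n → ℕ) k) + 2 * 0)) * kap (0 * 4 ^ j))
    ?_ ?_
  · convert this using 2 with ξ
    simp [Ms_zero, hs]
  · simp [kap]

lemma ofReal_le_mul_mn {T x : ℝ} (hT : 0 ≤ T) (hx0 : 0 ≤ x) (hx : x ≤ T) :
    ENNReal.ofReal x ≤ ENNReal.ofReal (1 + T) * mn x := by
  rw [mn, ← ENNReal.ofReal_mul (by positivity)]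
  refine ENNReal.ofReal_le_ofReal ?_
  rcases le_total x 1 with h | h
  · rw [min_eq_right h]; nlinarith
  · rw [min_eq_left h]; linarith

lemma exists_mulBound_cut_one_sub_heat (hp : 1 ≤ p) {T : ℝ} (hT : 0 ≤ T) :
    ∃ C : ℝ≥0, ∀ j, ∀ t ∈ Set.Icc 0 T, MulBound p (fun ξ : Rn n => cut j ξ * (hs t ξ - 1))
      (C * mn (t * 4 ^ j)) := by
  obtain ⟨C₀, h₀⟩ := exists_mulBound_one_sub_heat (n := n) hp contDiff_cutBall
    (fun _ => cutBall_zero) T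
  obtain ⟨C₁, h₁⟩ := exists_mulBound_one_sub_heat (n := n) hp contDiff_cutAnn
    (fun _ => cutAnn_zero_of_lt) 1
  obtain ⟨C₂, h₂⟩ := exists_mulBound_cut_heat (n := n) hp 0 0 T
  obtain ⟨C₃, h₃⟩ := exists_mulBound_cut (n := n) hp
  refine ⟨C₀ * Real.toNNReal (1 + T) + (C₁ + (C₂ + C₃)), fun j t ht => ?_⟩
  rw [ENNReal.coe_add, add_mul]
  cases j with
  | zero =>
    refine (h₀ t ht).mono (le_add_right ?_)
    rw [pow_zero, mul_one, ENNReal.coe_mul, mul_assoc]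
    gcongr
    exact ofReal_le_mul_mn hT ht.1 ht.2
  | succ j =>
    rcases le_total (t * 4 ^ (j + 1)) 1 with h | h
    · have h2 := (h₁ _ ⟨mul_nonneg ht.1 (by positivity), h⟩).comp_smul
        (r := ((2 : ℝ) ^ (j + 1))⁻¹) (by positivity)
      refine MulBound.mono (A := C₁ * ENNReal.ofReal (t * 4 ^ (j + 1))) ?_ ?_
      · convert h2 using 2 with ξ
        rw [cut_succ_eq, hs_inv_smul]
      · rw [mn, min_eq_right h, ENNReal.coe_add C₁, add_mul]
        exact le_add_left le_self_add
    · have h2 := (h₂ (j + 1) t ht).sub hp (h₃ (j + 1))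
      refine MulBound.mono (A := C₂ * 2 ^ ((j + 1) * ((∑ k, (0 : Fin n → ℕ) k) + 2 * 0)) *
        kap (t * 4 ^ (j + 1)) + C₃) ?_ ?_
      · convert h2 using 2 with ξ
        rw [Ms_zero]
        ring
      · rw [mn, min_eq_left h, ENNReal.ofReal_one, mul_one]
        simp only [Pi.zero_apply, Finset.sum_const_zero, mul_zero, add_zero, pow_zero, mul_one]
        refine le_add_left ?_
        push_cast
        refine le_add_left ?_
        gcongr
        exact mul_le_of_le_one_right zero_le (kap_le_one _)

lemma exists_mulBound_cut_char_sub_one (hp : 1 ≤ p) :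
    ∃ C : ℝ≥0, ∀ j, ∀ y : Rn n, MulBound p (fun ξ : Rn n => cut j ξ * ((𝐞 ⟪ξ, y⟫ : ℂ) - 1))
      (C * mn (2 ^ j * ‖y‖)) := by
  obtain ⟨C₀, h₀⟩ := exists_mulBound_char_sub_one (n := n) hp contDiff_cutBall
    (fun _ => cutBall_zero)
  obtain ⟨C₁, h₁⟩ := exists_mulBound_char_sub_one (n := n) hp contDiff_cutAnn
    (fun _ => cutAnn_zero_of_lt)
  refine ⟨C₀ + C₁, fun j y => ?_⟩
  rw [ENNReal.coe_add, add_mul]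
  cases j with
  | zero =>
    refine (h₀ y).mono (le_add_right ?_)
    rw [pow_zero, one_mul]
  | succ j =>
    have h2 := (h₁ ((2 : ℝ) ^ (j + 1) • y)).comp_smul (r := ((2 : ℝ) ^ (j + 1))⁻¹) (by positivity)
    refine MulBound.mono (A := C₁ * mn ‖(2 : ℝ) ^ (j + 1) • y‖) ?_ ?_
    · convert h2 using 2 with ξ
      rw [cut_succ_eq, real_inner_smul_left, real_inner_smul_right, inv_mul_cancel_left₀
        (by positivity)]
    · rw [norm_smul, Real.norm_of_nonneg (by positivity)]
      exact le_add_self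

variable (P : LPFamily n)

lemma rapid_hs_mul {g : Rn n → ℂ} (hg : Rapid g) {t : ℝ} (ht : 0 ≤ t) :
    Rapid (fun ξ => hs t ξ * g ξ) :=
  hg.mul (C := 1) (j := 0) (continuous_hs_right t) fun ξ => by simpa using norm_hs_le ht ξ

/-- Bounds for a derivative of the heat extension at a fixed time. -/
lemma exists_eLpNorm_W_le (hp : 1 ≤ p) (β : Fin n → ℕ) (l : ℕ) (T : ℝ) :
    ∃ C : ℝ≥0, ∀ f : 𝓢(Rn n, ℂ), ∀ t ∈ Set.Icc 0 T,
      eLpNorm (fun X => W (fun ξ => Ms β l ξ * 𝓕 (f : Rn n → ℂ) ξ) (X, t)) (ENNReal.ofReal p)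
        volume ≤ ∑' j, C * 2 ^ (j * ((∑ k, β k) + 2 * l)) * kap (t * 4 ^ j) * lpNorm P p f j := by
  obtain ⟨C, hC⟩ := exists_mulBound_cut_heat hp β l T
  refine ⟨C, fun f t ht => ?_⟩
  have := eLpNorm_le_tsum_mul_lpNorm P hp f (M := fun ξ => Ms β l ξ * hs t ξ) ?_
    (fun j => hC j t ht) fun j ξ => ?_
  · refine le_of_eq_of_le ?_ this
    congr 1
    ext X
    rw [W_of_nonneg _ _ ht.1]
    refine congrFun (congrArg _ (funext fun ξ => ?_)) X
    ring
  · convert rapid_hs_mul (rapid_Ms β l f) ht.1 using 2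
    ring
  · rw [mul_right_comm, cut_mul_lpSym, mul_comm]

/-- Bounds for time differences of the heat extension. -/
lemma exists_eLpNorm_W_sub_le (hp : 1 ≤ p) (β : Fin n → ℕ) (l : ℕ) {T : ℝ} (hT : 0 ≤ T) :
    ∃ C : ℝ≥0, ∀ f : 𝓢(Rn n, ℂ), ∀ s ∈ Set.Icc 0 T, ∀ t ∈ Set.Icc 0 T,
      eLpNorm (fun X => W (fun ξ => Ms β l ξ * 𝓕 (f : Rn n → ℂ) ξ) (X, t) -
        W (fun ξ => Ms β l ξ * 𝓕 (f : Rn n → ℂ) ξ) (X, s)) (ENNReal.ofReal p) volume ≤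
      ∑' j, C * 2 ^ (j * ((∑ k, β k) + 2 * l)) * (kap (t * 4 ^ j) + kap (s * 4 ^ j)) *
        mn (|t - s| * 4 ^ j) * lpNorm P p f j := by
  obtain ⟨C₁, h₁⟩ := exists_mulBound_cut_heat hp β l T
  obtain ⟨C₂, h₂⟩ := exists_mulBound_cut_one_sub_heat (n := n) hp hT
  refine ⟨C₁ * C₂, fun f => ?_⟩
  have main : ∀ s ∈ Set.Icc 0 T, ∀ t ∈ Set.Icc 0 T, s ≤ t →
      eLpNorm (fun X => W (fun ξ => Ms β l ξ * 𝓕 (f : Rn n → ℂ) ξ) (X, t) -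
        W (fun ξ => Ms β l ξ * 𝓕 (f : Rn n → ℂ) ξ) (X, s)) (ENNReal.ofReal p) volume ≤
      ∑' j, (C₁ * C₂ : ℝ≥0) * 2 ^ (j * ((∑ k, β k) + 2 * l)) * (kap (t * 4 ^ j) + kap (s * 4 ^ j)) *
        mn (|t - s| * 4 ^ j) * lpNorm P p f j := by
    intro s hs' t ht hst
    have := eLpNorm_le_tsum_mul_lpNorm P hp f (M := fun ξ => Ms β l ξ * (hs t ξ - hs s ξ)) ?_
      (fun j => (h₁ j s hs').mul (h₂ j (t - s) ⟨by linarith, by linarith [hs'.1, ht.2]⟩))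
      fun j ξ => ?_
    · refine le_trans (le_of_eq_of_le ?_ this) (ENNReal.tsum_le_tsum fun j => ?_)
      · congr 1
        ext X
        rw [W_of_nonneg _ _ ht.1, W_of_nonneg _ _ hs'.1]
        refine (congrFun (fourierInv_sub
          (integrable_hs_mul ht.1 (rapid_Ms β l f).integrable)
          (integrable_hs_mul hs'.1 (rapid_Ms β l f).integrable)) X).symm.trans ?_
        refine congrFun (congrArg _ (funext fun ξ => ?_)) X
        ring
      · rw [abs_of_nonneg (by linarith)]
        refine mul_le_mul_left ?_ _
        calc _ = ((C₁ * C₂ : ℝ≥0) : ℝ≥0∞) * 2 ^ (j * ((∑ k, β k) + 2 * l)) * kap (s * 4 ^ j) *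
              mn ((t - s) * 4 ^ j) := by push_cast; ring
          _ ≤ _ := by gcongr; exact le_add_self
    · convert (rapid_Ms β l f).mul (C := 2) (j := 0) (c := fun ξ => hs t ξ - hs s ξ)
        ((continuous_hs_right t).sub (continuous_hs_right s)) (fun ξ => ?_) using 2
      · ring
      · have h1 := norm_hs_le ht.1 ξ
        have h2 := norm_hs_le hs'.1 ξ
        have := norm_sub_le (hs t ξ) (hs s ξ)
        rw [pow_zero]
        linarith
    · have h3 := cut_mul_lpSym P j ξ
      have h4 : hs t ξ = hs s ξ * hs (t - s) ξ := by rw [← hs_add]; congr 1; ring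
      rw [h4]
      linear_combination (Ms β l ξ * hs s ξ * (hs (t - s) ξ - 1) * (cut j ξ + 1)) * h3
  intro s hs' t ht
  rcases le_total s t with h | h
  · exact main s hs' t ht h
  · have := main t ht s hs' h
    rw [← eLpNorm_neg] at this
    refine le_trans (le_of_eq ?_) (this.trans (le_of_eq ?_))
    · congr 1
      ext X
      simp
    · simp only [abs_sub_comm s t, add_comm (kap (s * _))]

lemma fourierInv_second_diff {g : Rn n → ℂ} (hg : Integrable g) (Y X : Rn n) :
    𝓕⁻ g (X + Y) - 2 * 𝓕⁻ g X + 𝓕⁻ g (X - Y) =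
      𝓕⁻ (fun ξ => ((𝐞 ⟪ξ, Y⟫ : ℂ) - 2 + (𝐞 ⟪ξ, -Y⟫ : ℂ)) * g ξ) X := by
  have h1 := congrFun (fourierInv_sub (integrable_char_mul Y hg) (hg.const_mul 2)) X
  have h2 := congrFun (fourierInv_add ((integrable_char_mul Y hg).sub (hg.const_mul 2))
    (integrable_char_mul (-Y) hg)) X
  have h3 := congrFun (fourierInv_const_mul 2 g) X
  simp only [Pi.sub_apply, Pi.add_apply, Pi.smul_apply, smul_eq_mul] at h1 h2 h3
  rw [sub_eq_add_neg X Y, ← fourierInv_char_mul Y g X, ← fourierInv_char_mul (-Y) g X, ← h3, ← h1]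
  refine h2.symm.trans (congrFun (congrArg _ (funext fun ξ => ?_)) X)
  ring

/-- Bounds for second spatial differences of the heat extension. -/
lemma exists_eLpNorm_W_second_diff_le (hp : 1 ≤ p) (β : Fin n → ℕ) (l : ℕ) (T : ℝ) :
    ∃ C : ℝ≥0, ∀ f : 𝓢(Rn n, ℂ), ∀ t ∈ Set.Icc 0 T, ∀ Y : Rn n,
      eLpNorm (fun X => W (fun ξ => Ms β l ξ * 𝓕 (f : Rn n → ℂ) ξ) (X + Y, t) -
        2 * W (fun ξ => Ms β l ξ * 𝓕 (f : Rn n → ℂ) ξ) (X, t) +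
        W (fun ξ => Ms β l ξ * 𝓕 (f : Rn n → ℂ) ξ) (X - Y, t)) (ENNReal.ofReal p) volume ≤
      ∑' j, C * 2 ^ (j * ((∑ k, β k) + 2 * l)) * kap (t * 4 ^ j) *
        mn (2 ^ j * ‖Y‖) ^ 2 * lpNorm P p f j := by
  obtain ⟨C₁, h₁⟩ := exists_mulBound_cut_heat hp β l T
  obtain ⟨C₂, h₂⟩ := exists_mulBound_cut_char_sub_one (n := n) hp
  refine ⟨C₁ * C₂ ^ 2, fun f t ht Y => ?_⟩
  have hinv : ∀ ξ : Rn n, (𝐞 ⟪ξ, Y⟫ : ℂ) * (𝐞 ⟪ξ, -Y⟫ : ℂ) = 1 := fun ξ => by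
    rw [inner_neg_right, AddChar.map_neg_eq_inv, ← Circle.coe_mul, mul_inv_cancel, Circle.coe_one]
  have := eLpNorm_le_tsum_mul_lpNorm P hp f (M := fun ξ => Ms β l ξ * hs t ξ *
      ((𝐞 ⟪ξ, Y⟫ : ℂ) - 2 + (𝐞 ⟪ξ, -Y⟫ : ℂ))) ?_
      (fun j => (h₁ j t ht).mul (((h₂ j Y).mul (h₂ j (-Y))).const_mul (-1))) fun j ξ => ?_
  · refine le_trans (le_of_eq_of_le ?_ this) (ENNReal.tsum_le_tsum fun j => le_of_eq ?_)
    · congr 1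
      ext X
      rw [W_of_nonneg _ _ ht.1, W_of_nonneg _ _ ht.1, W_of_nonneg _ _ ht.1]
      refine (fourierInv_second_diff
        (integrable_hs_mul ht.1 (rapid_Ms β l f).integrable) Y X).trans ?_
      refine congrFun (congrArg _ (funext fun ξ => ?_)) X
      ring
    · simp only [enorm_neg, enorm_one, norm_neg]
      push_cast
      ring
  · convert (rapid_hs_mul (rapid_Ms β l f) ht.1).mul (C := 4) (j := 0)
      (c := fun ξ => (𝐞 ⟪ξ, Y⟫ : ℂ) - 2 + (𝐞 ⟪ξ, -Y⟫ : ℂ)) (by fun_prop) (fun ξ => ?_) using 2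
    · ring
    · refine (norm_add_le _ _).trans ((add_le_add_left (norm_sub_le _ _) _).trans ?_)
      simp only [Circle.norm_coe, Complex.norm_ofNat, pow_zero]
      norm_num
  · have h3 := cut_mul_lpSym P j ξ
    have h5 := hinv ξ
    have h4 : (𝐞 ⟪ξ, Y⟫ : ℂ) - 2 + (𝐞 ⟪ξ, -Y⟫ : ℂ) =
      -(((𝐞 ⟪ξ, Y⟫ : ℂ) - 1) * ((𝐞 ⟪ξ, -Y⟫ : ℂ) - 1)) := by linear_combination h5
    rw [h4]
    linear_combination (-(Ms β l ξ * hs t ξ * ((𝐞 ⟪ξ, Y⟫ : ℂ) - 1) * ((𝐞 ⟪ξ, -Y⟫ : ℂ) - 1)) *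
      (cut j ξ ^ 2 + cut j ξ + 1)) * h3

end FrequencyPieces

section SchurTest

variable {n : ℕ} {p : ℝ}

/-- A weight that decays geometrically at `0` and at `∞` when `0 < c < a`. -/
def rho (a c x : ℝ) : ℝ≥0∞ := ENNReal.ofReal (min 1 x ^ a * x ^ (-c))

lemma measurable_rho (a c : ℝ) : Measurable (rho a c) := by
  unfold rho
  fun_prop

lemma measurable_kap : Measurable kap := by
  unfold kap
  fun_prop

lemma rho_le_of_le_one {a c δ : ℝ} (hδ : δ ≤ a - c) {x : ℝ} (hx : 0 < x) (h1 : x ≤ 1) :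
    rho a c x ≤ ENNReal.ofReal (x ^ δ) := by
  rw [rho, min_eq_right h1, ← Real.rpow_add hx, ← sub_eq_add_neg]
  exact ENNReal.ofReal_le_ofReal (Real.rpow_le_rpow_of_exponent_ge hx h1 hδ)

lemma rho_le_of_one_le {a c δ : ℝ} (hδ : δ ≤ c) {x : ℝ} (h1 : 1 ≤ x) :
    rho a c x ≤ ENNReal.ofReal (x⁻¹ ^ δ) := by
  have hx : 0 < x := by linarith
  rw [rho, min_eq_left h1, Real.one_rpow, one_mul, Real.inv_rpow hx.le, ← Real.rpow_neg hx.le]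
  exact ENNReal.ofReal_le_ofReal (Real.rpow_le_rpow_of_exponent_le h1 (by linarith))

/-- Geometric sums of the weight are bounded uniformly. -/
lemma exists_tsum_rho_le {a c R : ℝ} (hc : 0 < c) (hca : c < a) (hR : 1 < R) :
    ∃ C : ℝ≥0, ∀ x, 0 ≤ x → ∑' j : ℕ, rho a c (x * R ^ j) ≤ C := by
  set δ := min c (a - c) with hδ
  have hδ0 : 0 < δ := lt_min hc (by linarith)
  have hR0 : 0 < R := by linarith
  set r : ℝ := (R ^ δ)⁻¹ with hr
  have hRδ : 1 < R ^ δ := Real.one_lt_rpow hR hδ0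
  have hr0 : 0 < r := by positivity
  have hr1 : r < 1 := inv_lt_one_of_one_lt₀ hRδ
  have hsum : Summable fun k : ℤ => R ^ δ * r ^ k.natAbs := by
    refine Summable.mul_left _ (Summable.of_nat_of_neg ?_ ?_) <;>
      simpa using summable_geometric_of_lt_one hr0.le hr1
  refine ⟨Real.toNNReal (∑' k : ℤ, R ^ δ * r ^ k.natAbs), fun x hx => ?_⟩
  change _ ≤ ENNReal.ofReal _
  rw [ENNReal.ofReal_tsum_of_nonneg (fun k => by positivity) hsum]
  rcases hx.eq_or_lt with rfl | hx
  · simp [rho, Real.zero_rpow (neg_ne_zero.2 hc.ne')]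
  obtain ⟨m, hm1, hm2⟩ := exists_mem_Ico_zpow hx hR
  refine le_trans (ENNReal.tsum_le_tsum fun j => ?_)
    (ENNReal.tsum_comp_le_tsum_of_injective (f := fun j : ℕ => m + (j : ℤ))
      (fun i j h => by simpa using h) fun k : ℤ => ENNReal.ofReal (R ^ δ * r ^ k.natAbs))
  have hy1 : R ^ (m + (j : ℤ)) ≤ x * R ^ j := by
    rw [zpow_add₀ hR0.ne', zpow_natCast]; gcongr
  have hy2 : x * R ^ j ≤ R * R ^ (m + (j : ℤ)) := by
    rw [zpow_add₀ hR0.ne', zpow_natCast, ← mul_assoc, mul_comm R, ← zpow_add_one₀ hR0.ne']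
    gcongr
  have hxR : 0 < x * R ^ j := by positivity
  generalize m + (j : ℤ) = k at hy1 hy2 ⊢
  have hpow : ∀ N : ℕ, (R ^ N) ^ δ = (R ^ δ) ^ N := fun N => by
    rw [← Real.rpow_natCast, ← Real.rpow_mul hR0.le, mul_comm, Real.rpow_mul hR0.le,
      Real.rpow_natCast]
  rcases le_total (x * R ^ j) 1 with h | h
  · refine (rho_le_of_le_one (δ := δ) (min_le_right _ _) hxR h).trans (ENNReal.ofReal_le_ofReal ?_)
    have hk : k ≤ 0 := by
      by_contra! hk
      have := one_lt_zpow₀ hR hk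
      linarith
    obtain ⟨N, rfl⟩ := Int.eq_ofNat_of_zero_le (neg_nonneg.2 hk) |>.imp fun N hN =>
      (neg_eq_iff_eq_neg.1 hN)
    refine (Real.rpow_le_rpow hxR.le hy2 hδ0.le).trans (le_of_eq ?_)
    rw [Real.mul_rpow hR0.le (by positivity), zpow_neg, zpow_natCast, Real.inv_rpow (by positivity),
      hpow, hr]
    simp
  · refine (rho_le_of_one_le (δ := δ) (min_le_left _ _) h).trans (ENNReal.ofReal_le_ofReal ?_)
    rcases le_total 0 k with hk | hk
    · lift k to ℕ using hk
      rw [zpow_natCast] at hy1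
      rw [Int.natAbs_natCast, hr, inv_pow, ← hpow, Real.inv_rpow hxR.le]
      calc ((x * R ^ j) ^ δ)⁻¹ ≤ ((R ^ k) ^ δ)⁻¹ := by gcongr
        _ ≤ _ := le_mul_of_one_le_left (by positivity) hRδ.le
    · have hk' : k = 0 ∨ k = -1 := by
        by_contra! hcon
        have h3 : R * R ^ k < 1 := by
          rw [← zpow_one_add₀ hR0.ne']
          exact zpow_lt_one_of_neg₀ hR (by omega)
        linarith
      refine (Real.rpow_le_one (by positivity) (inv_le_one_of_one_le₀ h) hδ0.le).trans ?_
      rcases hk' with rfl | rfl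
      · simpa using hRδ.le
      · simp [hr, mul_inv_cancel₀ (by positivity : R ^ δ ≠ 0)]

/-- Scale-invariant integrals of the weight are bounded uniformly. -/
lemma exists_lintegral_rho_le {E : Type*} [NormedAddCommGroup E] [NormedSpace ℝ E] [Nontrivial E]
    [FiniteDimensional ℝ E] [MeasurableSpace E] [BorelSpace E] (μ : Measure E)
    [μ.IsAddHaarMeasure] {a c : ℝ} (hc : 0 < c) (hca : c < a) :
    ∃ C : ℝ≥0, ∀ r, 0 < r → ∫⁻ y, rho a c (r * ‖y‖) *
      ENNReal.ofReal (‖y‖ ^ (-(Module.finrank ℝ E : ℝ))) ∂μ ≤ C := by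
  set d := Module.finrank ℝ E with hd
  have hd0 : 0 < d := Module.finrank_pos
  set g : ℝ → ℝ := fun x => min 1 x ^ a * x ^ (-c) * x ^ (-(d : ℝ)) with hg
  have hg0 : ∀ x, 0 ≤ x → 0 ≤ g x := fun x hx => by
    have : 0 ≤ min 1 x := le_min zero_le_one hx
    positivity
  have hred : ∀ x : ℝ, 0 < x → x ^ (d - 1) • g x = min 1 x ^ a * x ^ (-c - 1) := fun x hx => by
    simp only [hg, smul_eq_mul]
    rw [← Real.rpow_natCast, mul_assoc, mul_left_comm, ← Real.rpow_add hx, ← Real.rpow_add hx]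
    congr 2
    rw [Nat.cast_sub (by omega)]
    push_cast
    ring
  have hint : Integrable (fun y : E => g ‖y‖) μ := by
    rw [integrable_fun_norm_addHaar, ← hd, ← Set.Ioc_union_Ioi_eq_Ioi zero_le_one]
    refine IntegrableOn.union ?_ ?_
    · have h1 : IntegrableOn (fun x : ℝ => x ^ (a - c - 1)) (Set.Ioc 0 1) := by
        rw [← intervalIntegrable_iff_integrableOn_Ioc_of_le zero_le_one]
        exact intervalIntegral.intervalIntegrable_rpow' (by linarith)
      refine h1.congr_fun (fun x hx => ?_) measurableSet_Ioc
      dsimp only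
      rw [hred x hx.1, min_eq_right hx.2, ← Real.rpow_add hx.1]
      congr 1
      ring
    · refine (integrableOn_Ioi_rpow_of_lt (a := -c - 1) (by linarith) one_pos).congr_fun
        (fun x hx => ?_) measurableSet_Ioi
      have hx' : (1 : ℝ) < x := hx
      dsimp only
      rw [hred x (by linarith), min_eq_left hx'.le, Real.one_rpow, one_mul]
  refine ⟨(∫⁻ y, ENNReal.ofReal (g ‖y‖) ∂μ).toNNReal, fun r hr => ?_⟩
  rw [ENNReal.coe_toNNReal hint.lintegral_lt_top.ne]
  have hmeas : Measurable fun y : E => ENNReal.ofReal (g ‖y‖) := by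
    simp only [hg]
    fun_prop
  have h1 := lintegral_map (μ := μ) hmeas (measurable_const_smul r)
  rw [Measure.map_addHaar_smul μ hr.ne', lintegral_smul_measure, ← hd,
    abs_of_pos (by positivity)] at h1
  have h2 : ∀ y : E, rho a c (r * ‖y‖) * ENNReal.ofReal (‖y‖ ^ (-(d : ℝ))) =
      ENNReal.ofReal (r ^ d) * ENNReal.ofReal (g ‖r • y‖) := fun y => by
    rw [rho, ← ENNReal.ofReal_mul, ← ENNReal.ofReal_mul (by positivity)]
    · congr 1
      simp only [hg, norm_smul, Real.norm_of_nonneg hr.le]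
      rw [Real.mul_rpow hr.le (norm_nonneg y) (z := -(d : ℝ)), Real.rpow_neg hr.le,
        Real.rpow_natCast]
      field_simp
    · have : 0 ≤ min 1 (r * ‖y‖) := le_min zero_le_one (by positivity)
      positivity
  simp only [h2]
  rw [lintegral_const_mul' _ _ ENNReal.ofReal_ne_top, ← h1, smul_eq_mul, ← mul_assoc,
    ← ENNReal.ofReal_mul (by positivity), mul_inv_cancel₀ (by positivity), ENNReal.ofReal_one,
    one_mul]

lemma lintegral_kap_le {r : ℝ} (hr : 0 < r) :
    ∫⁻ t : ℝ, ENNReal.ofReal r * kap (t * r) ≤ ENNReal.ofReal π := by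
  have h0 : ∫⁻ t : ℝ, kap t = ENNReal.ofReal π := by
    rw [← integral_univ_inv_one_add_sq, ofReal_integral_eq_lintegral_ofReal
      integrable_inv_one_add_sq (.of_forall fun x => by positivity)]
    rfl
  have h1 := lintegral_map (μ := (volume : Measure ℝ)) measurable_kap (measurable_mul_const r)
  rw [Real.map_volume_mul_right hr.ne', lintegral_smul_measure, h0, abs_of_pos (by positivity)]
    at h1
  rw [lintegral_const_mul' _ _ ENNReal.ofReal_ne_top, ← h1, smul_eq_mul,
    ← mul_assoc, ← ENNReal.ofReal_mul hr.le, mul_inv_cancel₀ hr.ne', ENNReal.ofReal_one, one_mul]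

/-- Schur's test. -/
lemma lintegral_rpow_le_of_schur {Ω : Type*} [MeasurableSpace Ω] (ν : Measure Ω) (hp : 1 ≤ p)
    {A : ℕ → ℝ≥0∞} {κ ρ : ℕ → Ω → ℝ≥0∞} (hκ : ∀ j, Measurable (κ j)) (hρ : ∀ j, Measurable (ρ j))
    {C₁ C₂ : ℝ≥0∞} (h₁ : ∀ᵐ z ∂ν, ∑' j, ρ j z ≤ C₁) (h₂ : ∀ j, ∫⁻ z, κ j z ^ p * ρ j z ∂ν ≤ C₂)
    {F : Ω → ℝ≥0∞} (hF : ∀ᵐ z ∂ν, F z ≤ ∑' j, A j * κ j z * ρ j z) :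
    ∫⁻ z, F z ^ p ∂ν ≤ C₁ ^ (p - 1) * C₂ * ∑' j, A j ^ p := by
  have hp0 : 0 ≤ p := by linarith
  calc ∫⁻ z, F z ^ p ∂ν
      ≤ ∫⁻ z, C₁ ^ (p - 1) * ∑' j, A j ^ p * (κ j z ^ p * ρ j z) ∂ν := by
        refine lintegral_mono_ae ?_
        filter_upwards [h₁, hF] with z h1 h2
        refine (ENNReal.rpow_le_rpow h2 hp0).trans ?_
        have := rpow_lintegral_mul_le (Measure.count : Measure ℕ) hp (w := fun j => ρ j z)
          (a := fun j => A j * κ j z) (by fun_prop) (by fun_prop)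
        simp only [lintegral_count] at this
        calc (∑' j, A j * κ j z * ρ j z) ^ p = (∑' j, ρ j z * (A j * κ j z)) ^ p := by
              simp only [mul_comm (ρ _ z)]
          _ ≤ _ := this
          _ ≤ _ := by
            refine mul_le_mul' (ENNReal.rpow_le_rpow h1 (by linarith))
              (ENNReal.tsum_le_tsum fun j => le_of_eq ?_)
            rw [ENNReal.mul_rpow_of_nonneg _ _ hp0]
            ring
    _ = C₁ ^ (p - 1) * ∑' j, A j ^ p * ∫⁻ z, κ j z ^ p * ρ j z ∂ν := by
        have hm : ∀ j, Measurable fun z => κ j z ^ p * ρ j z := fun j =>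
          ((hκ j).pow_const p).mul (hρ j)
        rw [lintegral_const_mul _ (Measurable.tsum fun j => (hm j).const_mul _),
          lintegral_tsum fun j => ((hm j).const_mul _).aemeasurable]
        simp only [lintegral_const_mul _ (hm _)]
    _ ≤ C₁ ^ (p - 1) * ∑' j, A j ^ p * C₂ := by
        gcongr with j
        exact h₂ j
    _ = _ := by rw [ENNReal.tsum_mul_right]; ring

end SchurTest

section Seminorms

variable {n : ℕ} {p : ℝ}

lemma tSet_ofReal (T : ℝ) : tSet (ENNReal.ofReal T) = Set.Ioo 0 T := by
  ext t
  simp only [tSet, Set.mem_ofPred_eq, Set.mem_Ioo]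
  refine and_congr_right fun ht => ?_
  rcases le_or_gt T 0 with hT | hT
  · simp only [ENNReal.ofReal_of_nonpos hT, not_lt_zero, false_iff, not_lt]
    linarith
  · exact ENNReal.ofReal_lt_ofReal_iff hT

lemma stripMeasure_ofReal (T : ℝ) : stripMeasure n (ENNReal.ofReal T) =
    (volume : Measure (Rn n)).prod (volume.restrict (Set.Ioo 0 T)) := by
  have h : {x : Rn1 n | x.2 ∈ Set.Ioo 0 T} = Set.univ ×ˢ Set.Ioo 0 T := by ext; simp
  rw [stripMeasure, tSet_ofReal, h, Measure.volume_eq_prod, ← Measure.prod_restrict,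
    Measure.restrict_univ]

lemma stripMeasure_congr {T : ℝ} {u v : Rn1 n → ℂ} (h : Set.EqOn u v {x | 0 < x.2}) :
    u =ᵐ[stripMeasure n (ENNReal.ofReal T)] v := by
  rw [stripMeasure, tSet_ofReal]
  filter_upwards [ae_restrict_mem (measurableSet_Ioo.preimage measurable_snd)] with x hx
  exact h hx.1

/-- Slicing of the `Lᵖ` norm on the strip. -/
lemma eLpNorm_stripMeasure_rpow (hp : 1 ≤ p) (T : ℝ) {g : Rn1 n → ℂ} (hg : Continuous g) :
    eLpNorm g (ENNReal.ofReal p) (stripMeasure n (ENNReal.ofReal T)) ^ p =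
      ∫⁻ t in Set.Ioo 0 T, eLpNorm (fun X => g (X, t)) (ENNReal.ofReal p) volume ^ p := by
  rw [eLpNorm_ofReal_rpow hp, stripMeasure_ofReal, lintegral_prod_symm _
    (hg.measurable.enorm.pow_const p).aemeasurable]
  simp only [eLpNorm_ofReal_rpow hp]

lemma ofReal_rpow_div_rpow (hp : 1 ≤ p) {x u q : ℝ} (hx : 0 ≤ x) (hu : 0 ≤ u) :
    ENNReal.ofReal (x ^ p / u ^ q) =
      ENNReal.ofReal (u ^ (-(q / p))) ^ p * ENNReal.ofReal x ^ p := by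
  have hp0 : 0 < p := by linarith
  rw [ENNReal.ofReal_rpow_of_nonneg (by positivity) hp0.le,
    ENNReal.ofReal_rpow_of_nonneg hx hp0.le, ← ENNReal.ofReal_mul (by positivity)]
  congr 1
  rw [← Real.rpow_mul hu, neg_mul, div_mul_cancel₀ _ hp0.ne', Real.rpow_neg hu, div_eq_inv_mul]

/-- The product measure on pairs of times. -/
def timePairs (T : ℝ) : Measure (ℝ × ℝ) :=
  (volume.restrict (Set.Ioo 0 T)).prod (volume.restrict (Set.Ioo 0 T))

lemma semT_congr {b T : ℝ} {u v : Rn1 n → ℂ} (h : Set.EqOn u v {x | 0 < x.2}) :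
    semT b p (ENNReal.ofReal T) u = semT b p (ENNReal.ofReal T) v := by
  simp only [semT, tSet_ofReal]
  congr 1
  refine lintegral_congr fun X => setLIntegral_congr_fun measurableSet_Ioo fun t ht =>
    setLIntegral_congr_fun measurableSet_Ioo fun s hs => ?_
  simp only [h (show (X, t) ∈ {x : Rn1 n | 0 < x.2} from ht.1),
    h (show (X, s) ∈ {x : Rn1 n | 0 < x.2} from hs.1)]

lemma semX_congr {b T : ℝ} {u v : Rn1 n → ℂ} (h : Set.EqOn u v {x | 0 < x.2}) :
    semX b p (ENNReal.ofReal T) u = semX b p (ENNReal.ofReal T) v := by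
  simp only [semX, tSet_ofReal]
  congr 1
  refine setLIntegral_congr_fun measurableSet_Ioo fun t ht => lintegral_congr fun X =>
    lintegral_congr fun Y => ?_
  simp only [h (show (X, t) ∈ {x : Rn1 n | 0 < x.2} from ht.1),
    h (show (X + Y, t) ∈ {x : Rn1 n | 0 < x.2} from ht.1),
    h (show (X - Y, t) ∈ {x : Rn1 n | 0 < x.2} from ht.1)]

lemma semT_eq (hp : 1 ≤ p) {b : ℝ} (hb : 0 < b) (T : ℝ) {g : Rn1 n → ℂ} (hg : Continuous g) :
    semT b p (ENNReal.ofReal T) g = (∫⁻ z, (ENNReal.ofReal (|z.1 - z.2| ^ (-(1 / p + b / 2))) *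
      eLpNorm (fun X => g (X, z.1) - g (X, z.2)) (ENNReal.ofReal p) volume) ^ p
        ∂timePairs T) ^ (1 / p) := by
  have hp0 : 0 < p := by linarith
  have hgm := hg.measurable
  rw [semT, tSet_ofReal]
  congr 1
  calc _ = ∫⁻ X : Rn n, ∫⁻ z : ℝ × ℝ, ENNReal.ofReal (‖g (X, z.1) - g (X, z.2)‖ ^ p /
        |z.1 - z.2| ^ (1 + p * b / 2)) ∂timePairs T := by
        refine lintegral_congr fun X => ?_
        rw [timePairs, lintegral_prod _ (by fun_prop)]
    _ = ∫⁻ z : ℝ × ℝ, (∫⁻ X : Rn n, ENNReal.ofReal (‖g (X, z.1) - g (X, z.2)‖ ^ p /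
        |z.1 - z.2| ^ (1 + p * b / 2))) ∂timePairs T := by
        unfold timePairs
        refine lintegral_lintegral_swap (Measurable.aemeasurable ?_)
        simp only [Function.uncurry_def]
        fun_prop
    _ = _ := by
        refine lintegral_congr fun z => ?_
        rw [ENNReal.mul_rpow_of_nonneg _ _ hp0.le, eLpNorm_ofReal_rpow hp,
          ← lintegral_const_mul' _ _ (by finiteness)]
        refine lintegral_congr fun X => ?_
        rw [ofReal_rpow_div_rpow hp (norm_nonneg _) (abs_nonneg _), ofReal_norm]
        congr 4
        field_simp

lemma semX_eq (hp : 1 ≤ p) {b : ℝ} (hb : 0 < b) (T : ℝ) {g : Rn1 n → ℂ} (hg : Continuous g) :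
    semX b p (ENNReal.ofReal T) g = (∫⁻ z, (ENNReal.ofReal (‖z.2‖ ^ (-(n / p + b))) *
      eLpNorm (fun X => g (X + z.2, z.1) - 2 * g (X, z.1) + g (X - z.2, z.1)) (ENNReal.ofReal p)
        volume) ^ p ∂(volume.restrict (Set.Ioo 0 T)).prod (volume : Measure (Rn n))) ^ (1 / p) := by
  have hp0 : 0 < p := by linarith
  have hgm := hg.measurable
  rw [semX, tSet_ofReal]
  congr 1
  have hm : Measurable fun z : (ℝ × Rn n) × Rn n =>
      ENNReal.ofReal (‖g (z.2 + z.1.2, z.1.1) - 2 * g (z.2, z.1.1) + g (z.2 - z.1.2, z.1.1)‖ ^ p /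
        ‖z.1.2‖ ^ ((n : ℝ) + p * b)) := by fun_prop
  calc _ = ∫⁻ t in Set.Ioo 0 T, ∫⁻ Y : Rn n, ∫⁻ X : Rn n,
        ENNReal.ofReal (‖g (X + Y, t) - 2 * g (X, t) + g (X - Y, t)‖ ^ p /
          ‖Y‖ ^ ((n : ℝ) + p * b)) := by
        refine lintegral_congr fun t => lintegral_lintegral_swap (Measurable.aemeasurable ?_)
        exact hm.comp (g := fun z : (ℝ × Rn n) × Rn n => _)
          (f := fun x : Rn n × Rn n => ((t, x.2), x.1)) (by fun_prop)
    _ = ∫⁻ z, (∫⁻ X : Rn n,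
        ENNReal.ofReal (‖g (X + z.2, z.1) - 2 * g (X, z.1) + g (X - z.2, z.1)‖ ^ p /
          ‖z.2‖ ^ ((n : ℝ) + p * b))) ∂(volume.restrict (Set.Ioo 0 T)).prod volume := by
        rw [lintegral_prod _ hm.lintegral_prod_right'.aemeasurable]
    _ = _ := by
        refine lintegral_congr fun z => ?_
        rw [ENNReal.mul_rpow_of_nonneg _ _ hp0.le, eLpNorm_ofReal_rpow hp,
          ← lintegral_const_mul' _ _ (by finiteness)]
        refine lintegral_congr fun X => ?_
        rw [ofReal_rpow_div_rpow hp (norm_nonneg _) (norm_nonneg _), ofReal_norm]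
        congr 4
        field_simp

end Seminorms

section UpperBound

variable {n : ℕ} {p : ℝ}

/-- Real powers of two in `ℝ≥0∞`. -/
def pw (x : ℝ) : ℝ≥0∞ := ENNReal.ofReal ((2 : ℝ) ^ x)

lemma pw_add (x y : ℝ) : pw (x + y) = pw x * pw y := by
  rw [pw, Real.rpow_add two_pos, ENNReal.ofReal_mul (by positivity), pw, pw]

lemma pw_rpow (hp : 0 ≤ p) (x : ℝ) : pw x ^ p = pw (x * p) := by
  rw [pw, ENNReal.ofReal_rpow_of_nonneg (by positivity) hp, ← Real.rpow_mul two_pos.le, pw]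

lemma pw_natCast (k : ℕ) : pw k = 2 ^ k := by
  rw [pw, Real.rpow_natCast, ENNReal.ofReal_pow two_pos.le, ENNReal.ofReal_ofNat]

lemma pw_two_mul (j : ℕ) : pw (2 * j) = ENNReal.ofReal (4 ^ j) := by
  rw [pw, Real.rpow_mul two_pos.le, Real.rpow_natCast]
  norm_num

lemma two_pow_mul_eq (α : ℝ) (j k : ℕ) : (2 : ℝ≥0∞) ^ (j * k) =
    pw ((α - 2 / p) * j) * pw (2 * j / p) * pw (-((α - k) * j)) := by
  rw [← pw_natCast, ← pw_add, ← pw_add]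
  congr 1
  push_cast
  ring

lemma tsum_le_besovN (hp : 1 ≤ p) (P : LPFamily n) (s : ℝ) (f : SchwartzMap (Rn n) ℂ) :
    ∑' j : ℕ, (pw (s * j) * lpNorm P p f j) ^ p ≤ besovN P s p f ^ p := by
  have hp0 : 0 < p := by linarith
  rw [besovN_eq, tsum_eq_zero_add' ENNReal.summable]
  refine le_trans (le_of_eq ?_) (ENNReal.add_rpow_le_rpow_add _ _ hp)
  rw [← ENNReal.rpow_mul, one_div_mul_cancel hp0.ne', ENNReal.rpow_one]
  simp [pw]

lemma rpow_one_div_le_of_le_mul (hp : 1 ≤ p) {C : ℝ≥0} {x B : ℝ≥0∞} (h : x ≤ C * B ^ p) :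
    x ^ (1 / p) ≤ (C ^ (1 / p) : ℝ≥0) * B := by
  have hp0 : 0 < p := by linarith
  refine (ENNReal.rpow_le_rpow h (by positivity)).trans (le_of_eq ?_)
  rw [ENNReal.mul_rpow_of_nonneg _ _ (by positivity), ← ENNReal.rpow_mul,
    mul_one_div_cancel hp0.ne', ENNReal.rpow_one, ENNReal.coe_rpow_of_nonneg _ (by positivity)]

/-- Schur's test against the Besov sequence of a Schwartz function. -/
lemma exists_lintegral_rpow_one_div_le {Ω : Type*} [MeasurableSpace Ω] (ν : Measure Ω)
    (hp : 1 ≤ p) (P : LPFamily n) (s : ℝ) (C : ℝ≥0) {κ ρ : ℕ → Ω → ℝ≥0∞}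
    (hκ : ∀ j, Measurable (κ j)) (hρ : ∀ j, Measurable (ρ j)) {C₁ C₂ : ℝ≥0}
    (h₁ : ∀ z, ∑' j, ρ j z ≤ C₁) (h₂ : ∀ j, ∫⁻ z, κ j z ^ p * ρ j z ∂ν ≤ C₂) :
    ∃ C' : ℝ≥0, ∀ (f : SchwartzMap (Rn n) ℂ) (F : Ω → ℝ≥0∞),
      (∀ᵐ z ∂ν, F z ≤ ∑' j : ℕ, C * (pw (s * j) * lpNorm P p f j) * κ j z * ρ j z) →
      (∫⁻ z, F z ^ p ∂ν) ^ (1 / p) ≤ C' * besovN P s p f := by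
  have hp0 : 0 ≤ p := by linarith
  refine ⟨(C₁ ^ (p - 1) * C₂ * C ^ p) ^ (1 / p), fun f F hF => rpow_one_div_le_of_le_mul hp ?_⟩
  refine (lintegral_rpow_le_of_schur ν hp hκ hρ (.of_forall h₁) h₂ hF).trans ?_
  simp only [ENNReal.mul_rpow_of_nonneg (C : ℝ≥0∞) _ hp0]
  rw [ENNReal.tsum_mul_left, ENNReal.coe_mul, ENNReal.coe_mul,
    ENNReal.coe_rpow_of_nonneg _ hp0, ENNReal.coe_rpow_of_nonneg _ (by linarith), mul_assoc _ _ (besovN P s p f ^ p)]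
  gcongr
  exact tsum_le_besovN hp P s f

/-- The time weight of the `j`-th Littlewood–Paley piece, normalised in `Lᵖ`. -/
def wt (p : ℝ) (j : ℕ) (t : ℝ) : ℝ≥0∞ := pw (2 * j / p) * kap (t * 4 ^ j)

lemma measurable_wt (p : ℝ) (j : ℕ) : Measurable (wt p j) :=
  (measurable_kap.comp (measurable_mul_const _)).const_mul _

lemma lintegral_wt_le (hp : 1 ≤ p) (j : ℕ) : ∫⁻ t, wt p j t ^ p ≤ ENNReal.ofReal π := by
  have hp0 : 0 < p := by linarith
  refine le_trans (lintegral_mono fun t => ?_) (lintegral_kap_le (r := 4 ^ j) (by positivity))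
  rw [wt, ENNReal.mul_rpow_of_nonneg _ _ hp0.le, pw_rpow hp0.le, div_mul_cancel₀ _ hp0.ne',
    pw_two_mul]
  gcongr
  exact (ENNReal.rpow_le_rpow_of_exponent_ge (kap_le_one _) hp).trans_eq (ENNReal.rpow_one _)

/-- The `Lᵖ` bound on the strip. -/
lemma exists_eLpNorm_heatExt_le (hp : 1 ≤ p) (P : LPFamily n) (β : Fin n → ℕ) (l : ℕ) (T : ℝ)
    {α : ℝ} (hα : (((∑ k, β k) + 2 * l : ℕ) : ℝ) < α) :
    ∃ C : ℝ≥0, ∀ f : SchwartzMap (Rn n) ℂ,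
      eLpNorm (dXmulti β (dT^[l] (heatExt f))) (ENNReal.ofReal p)
        (stripMeasure n (ENNReal.ofReal T)) ≤ C * besovN P (α - 2 / p) p f := by
  have hp0 : 0 < p := by linarith
  set k := (∑ k, β k) + 2 * l with hk
  obtain ⟨C, hC⟩ := exists_eLpNorm_W_le P hp β l T
  obtain ⟨C₁, hC₁⟩ := exists_tsum_rho_le (a := α - k + 1) (c := α - k) (R := 2) (by linarith)
    (by linarith) (by norm_num)
  have hρ : ∀ j : ℕ, rho (α - k + 1) (α - k) (1 * 2 ^ j) = pw (-((α - k) * j)) := fun j => by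
    rw [rho, one_mul, min_eq_left (one_le_pow₀ (by norm_num)), Real.one_rpow, one_mul, pw,
      ← Real.rpow_natCast, ← Real.rpow_mul two_pos.le]
    congr 2
    ring
  simp only [← hk] at hC
  obtain ⟨C', hC'⟩ := exists_lintegral_rpow_one_div_le (volume.restrict (Set.Ioo 0 T)) hp P
    (α - 2 / p) C (κ := wt p) (ρ := fun j _ => pw (-((α - k) * j))) (measurable_wt p)
    (fun j => measurable_const) (C₁ := C₁) (C₂ := Real.toNNReal π)
    (fun z => by simpa only [hρ] using hC₁ 1 zero_le_one) (fun j => by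
      refine le_trans ?_ (lintegral_wt_le hp j)
      refine (lintegral_mono fun t => mul_le_of_le_one_right' ?_).trans
        (setLIntegral_le_lintegral _ _)
      rw [pw, ENNReal.ofReal_le_one]
      refine Real.rpow_le_one_of_one_le_of_nonpos (by norm_num) ?_
      have : 0 ≤ (α - k) * j := mul_nonneg (by linarith) (by positivity)
      linarith)
  refine ⟨C', fun f => ?_⟩
  have hc := continuous_W (rapid_Ms β l f).integrable
  rw [eLpNorm_congr_ae (stripMeasure_congr (deriv_heatExt β l f)),
    ← ENNReal.rpow_rpow_inv hp0.ne' (eLpNorm _ _ _), eLpNorm_stripMeasure_rpow hp T hc, ← one_div]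
  refine hC' f _ ?_
  filter_upwards [ae_restrict_mem measurableSet_Ioo] with t ht
  refine (hC f t ⟨ht.1.le, ht.2.le⟩).trans (ENNReal.tsum_le_tsum fun j => le_of_eq ?_)
  rw [two_pow_mul_eq (p := p) α, wt]
  ring

/-- The weights of the difference seminorms are integrable uniformly in the scale. -/
lemma exists_lintegral_wt_mul_le {E : Type*} [NormedAddCommGroup E] [NormedSpace ℝ E]
    [Nontrivial E] [FiniteDimensional ℝ E] [MeasurableSpace E] [BorelSpace E] (μ : Measure E)
    [μ.IsAddHaarMeasure] (hp : 1 ≤ p) {a c : ℝ} (hc : 0 < c) (hca : c < a) :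
    ∃ C : ℝ≥0, ∀ (j : ℕ) (r : ℝ), 0 < r → ∀ y₀ : ℝ → E,
      ∫⁻ t, ∫⁻ y, wt p j t ^ p * (ENNReal.ofReal (‖y - y₀ t‖ ^ (-(Module.finrank ℝ E : ℝ))) *
        rho a c (r * ‖y - y₀ t‖)) ∂μ ≤ C := by
  obtain ⟨C, hC⟩ := exists_lintegral_rho_le μ hc hca
  refine ⟨Real.toNNReal π * C, fun j r hr y₀ => ?_⟩
  have h : ∀ t, ∫⁻ y, wt p j t ^ p * (ENNReal.ofReal (‖y - y₀ t‖ ^ (-(Module.finrank ℝ E : ℝ))) *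
        rho a c (r * ‖y - y₀ t‖)) ∂μ ≤ wt p j t ^ p * C := fun t => by
    have hm := measurable_rho a c
    rw [lintegral_const_mul _ (by fun_prop), lintegral_sub_right_eq_self
      (fun y => ENNReal.ofReal (‖y‖ ^ (-(Module.finrank ℝ E : ℝ))) * rho a c (r * ‖y‖))]
    gcongr
    simpa only [mul_comm] using hC r hr
  calc _ ≤ ∫⁻ t, wt p j t ^ p * C := lintegral_mono h
    _ = (∫⁻ t, wt p j t ^ p) * C := lintegral_mul_const' _ _ ENNReal.coe_ne_top
    _ ≤ _ := by
      rw [ENNReal.coe_mul]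
      gcongr
      exact lintegral_wt_le hp j

lemma timePairs_le (T : ℝ) : timePairs T ≤ volume := by
  rw [timePairs, Measure.prod_restrict, ← Measure.volume_eq_prod]
  exact Measure.restrict_le_self

/-- The time seminorm of a derivative of top order. -/
lemma exists_semT_heatExt_le (hp : 1 ≤ p) (P : LPFamily n) (β : Fin n → ℕ) (l : ℕ) {T : ℝ}
    (hT : 0 ≤ T) {α : ℝ} {k : ℕ} (hk : (∑ k, β k) + 2 * l = k) (hα : (k : ℝ) < α)
    (hα2 : α < k + 2) :
    ∃ C : ℝ≥0, ∀ f : SchwartzMap (Rn n) ℂ,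
      semT (α - k) p (ENNReal.ofReal T) (dXmulti β (dT^[l] (heatExt f))) ≤
        C * besovN P (α - 2 / p) p f := by
  have hp0 : 0 < p := by linarith
  obtain ⟨C, hC⟩ := exists_eLpNorm_W_sub_le P hp β l hT
  simp only [hk] at hC
  set b := α - k with hb
  have hb0 : 0 < b := by linarith
  obtain ⟨C₁, hC₁⟩ := exists_tsum_rho_le (a := 1) (c := b / 2) (R := 4) (by linarith)
    (by linarith) (by norm_num)
  obtain ⟨C₂, hC₂⟩ := exists_lintegral_wt_mul_le (volume : Measure ℝ) hp (a := 1) (c := b / 2)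
    (by linarith) (by linarith)
  simp only [Module.finrank_self, Nat.cast_one, Real.norm_eq_abs] at hC₂
  have hm := measurable_wt p
  have hmr := measurable_rho 1 (b / 2)
  obtain ⟨C', hC'⟩ := exists_lintegral_rpow_one_div_le (timePairs T) hp P
    (α - 2 / p) C
    (κ := fun j z => (wt p j z.1 + wt p j z.2) * ENNReal.ofReal (|z.1 - z.2| ^ (-(1 / p))))
    (ρ := fun j z => rho 1 (b / 2) (|z.1 - z.2| * 4 ^ j)) (fun j => by fun_prop)
    (fun j => by fun_prop) (C₁ := C₁) (C₂ := 2 ^ (p - 1) * (C₂ + C₂))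
    (fun z => hC₁ _ (abs_nonneg _)) (fun j => by
      have h4 : (0 : ℝ) < 4 ^ j := by positivity
      set w : ℝ → ℝ≥0∞ := fun d => ENNReal.ofReal (|d| ^ (-1 : ℝ)) * rho 1 (b / 2) (4 ^ j * |d|)
        with hw
      have hwm : Measurable w := by fun_prop
      have hle : ∀ z : ℝ × ℝ, ((wt p j z.1 + wt p j z.2) *
          ENNReal.ofReal (|z.1 - z.2| ^ (-(1 / p)))) ^ p * rho 1 (b / 2) (|z.1 - z.2| * 4 ^ j) ≤
          2 ^ (p - 1) * (wt p j z.1 ^ p * w (z.2 - z.1) + wt p j z.2 ^ p * w (z.1 - z.2)) := by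
        intro z
        have e1 : ENNReal.ofReal (|z.1 - z.2| ^ (-(1 / p))) ^ p *
            rho 1 (b / 2) (|z.1 - z.2| * 4 ^ j) = w (z.1 - z.2) := by
          rw [hw, ENNReal.ofReal_rpow_of_nonneg (by positivity) hp0.le, ← Real.rpow_mul
            (abs_nonneg _), neg_mul, one_div_mul_cancel hp0.ne', mul_comm |z.1 - z.2|]
        have e2 : w (z.2 - z.1) = w (z.1 - z.2) := by simp only [hw, abs_sub_comm z.2 z.1]
        rw [ENNReal.mul_rpow_of_nonneg _ _ hp0.le, mul_assoc, e1, e2, ← add_mul, ← mul_assoc (2 ^ (p - 1))]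
        exact mul_le_mul_left (ENNReal.rpow_add_le_mul_rpow_add_rpow _ _ hp) _
      refine (lintegral_mono hle).trans ((lintegral_mono' (timePairs_le T) le_rfl).trans ?_)
      rw [lintegral_const_mul _ (by fun_prop), lintegral_add_left (by fun_prop),
        ENNReal.coe_mul, ENNReal.coe_rpow_of_nonneg _ (by linarith), ENNReal.coe_add,
        Measure.volume_eq_prod, lintegral_prod _ (by fun_prop),
        lintegral_prod_symm _ (by fun_prop)]
      gcongr
      · simp
      · exact hC₂ j _ h4 (fun t => t)
      · exact hC₂ j _ h4 (fun t => t))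
  refine ⟨C', fun f => ?_⟩
  have hc := continuous_W (rapid_Ms β l f).integrable
  rw [semT_congr (deriv_heatExt β l f), semT_eq hp hb0 T hc]
  refine hC' f _ ?_
  have hmem : ∀ᵐ z ∂timePairs T, z ∈ Set.Ioo 0 T ×ˢ Set.Ioo 0 T := by
    rw [timePairs, Measure.prod_restrict]
    exact ae_restrict_mem (measurableSet_Ioo.prod measurableSet_Ioo)
  filter_upwards [hmem] with z hz
  rcases eq_or_ne z.1 z.2 with h0 | h0
  · simp [h0, eLpNorm_zero']
  have hd : 0 < |z.1 - z.2| := abs_pos.2 (sub_ne_zero.2 h0)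
  refine (mul_le_mul_right (hC f z.2 ⟨hz.2.1.le, hz.2.2.le⟩ z.1 ⟨hz.1.1.le, hz.1.2.le⟩) _).trans ?_
  rw [← ENNReal.tsum_mul_left]
  refine ENNReal.tsum_le_tsum fun j => le_of_eq ?_
  have h4 : (0 : ℝ) < 4 ^ j := by positivity
  have e : ENNReal.ofReal (|z.1 - z.2| ^ (-(1 / p + b / 2))) * mn (|z.1 - z.2| * 4 ^ j) *
      pw (-(b * j)) = ENNReal.ofReal (|z.1 - z.2| ^ (-(1 / p))) *
        rho 1 (b / 2) (|z.1 - z.2| * 4 ^ j) := by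
    have e4 : (4 : ℝ) ^ j = 2 ^ (2 * (j : ℝ)) := by
      rw [Real.rpow_mul two_pos.le, Real.rpow_natCast]
      norm_num
    rw [mn, rho, pw, Real.rpow_one, Real.mul_rpow hd.le h4.le, neg_add, Real.rpow_add hd,
      ← ENNReal.ofReal_mul (by positivity), ← ENNReal.ofReal_mul (by positivity),
      ← ENNReal.ofReal_mul (by positivity), show -(b * j) = 2 * (j : ℝ) * (-(b / 2)) by ring,
      Real.rpow_mul two_pos.le, ← e4]
    congr 1
    ring
  calc _ = C * (pw ((α - 2 / p) * j) * lpNorm P p f j) *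
        (pw (2 * j / p) * (kap (z.1 * 4 ^ j) + kap (z.2 * 4 ^ j))) *
        (ENNReal.ofReal (|z.1 - z.2| ^ (-(1 / p + b / 2))) * mn (|z.1 - z.2| * 4 ^ j) *
          pw (-(b * j))) := by
        rw [two_pow_mul_eq (p := p) α]
        ring
    _ = _ := by
        rw [e, wt, wt]
        ring

/-- The space seminorm of a derivative of top order. -/
lemma exists_semX_heatExt_le (hn : 1 ≤ n) (hp : 1 ≤ p) (P : LPFamily n) (β : Fin n → ℕ) (l : ℕ)
    (T : ℝ) {α : ℝ} {k : ℕ} (hk : (∑ k, β k) + 2 * l = k) (hα : (k : ℝ) < α)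
    (hα2 : α < k + 2) :
    ∃ C : ℝ≥0, ∀ f : SchwartzMap (Rn n) ℂ,
      semX (α - k) p (ENNReal.ofReal T) (dXmulti β (dT^[l] (heatExt f))) ≤
        C * besovN P (α - 2 / p) p f := by
  have hp0 : 0 < p := by linarith
  have : Nonempty (Fin n) := ⟨⟨0, hn⟩⟩
  obtain ⟨C, hC⟩ := exists_eLpNorm_W_second_diff_le P hp β l T
  simp only [hk] at hC
  set b := α - k with hb
  have hb0 : 0 < b := by linarith
  obtain ⟨C₁, hC₁⟩ := exists_tsum_rho_le (a := 2) (c := b) (R := 2) (by linarith)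
    (by linarith) (by norm_num)
  obtain ⟨C₂, hC₂⟩ := exists_lintegral_wt_mul_le (volume : Measure (Rn n)) hp (a := 2) (c := b)
    (by linarith) (by linarith)
  simp only [finrank_euclideanSpace, Fintype.card_fin] at hC₂
  have hm := measurable_wt p
  have hmr := measurable_rho 2 b
  obtain ⟨C', hC'⟩ := exists_lintegral_rpow_one_div_le
    ((volume.restrict (Set.Ioo 0 T)).prod (volume : Measure (Rn n))) hp P (α - 2 / p) C
    (κ := fun j z => wt p j z.1 * ENNReal.ofReal (‖z.2‖ ^ (-(n / p))))
    (ρ := fun j z => rho 2 b (‖z.2‖ * 2 ^ j)) (fun j => by fun_prop)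
    (fun j => by fun_prop) (C₁ := C₁) (C₂ := C₂)
    (fun z => hC₁ _ (norm_nonneg _)) (fun j => by
      rw [lintegral_prod _ (by fun_prop)]
      refine (setLIntegral_le_lintegral _ _).trans (le_trans (le_of_eq ?_)
        (hC₂ j (2 ^ j) (by positivity) (fun _ => 0)))
      refine lintegral_congr fun t => lintegral_congr fun Y => ?_
      rw [ENNReal.mul_rpow_of_nonneg _ _ hp0.le, ENNReal.ofReal_rpow_of_nonneg (by positivity)
        hp0.le, ← Real.rpow_mul (norm_nonneg _), neg_mul, div_mul_cancel₀ _ hp0.ne', sub_zero,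
        mul_assoc, mul_comm (2 ^ j : ℝ)])
  refine ⟨C', fun f => ?_⟩
  have hc := continuous_W (rapid_Ms β l f).integrable
  rw [semX_congr (deriv_heatExt β l f), semX_eq hp hb0 T hc]
  refine hC' f _ ?_
  have hmem : ∀ᵐ z ∂(volume.restrict (Set.Ioo 0 T)).prod (volume : Measure (Rn n)),
      z.1 ∈ Set.Ioo 0 T :=
    Measure.quasiMeasurePreserving_fst.ae (ae_restrict_mem measurableSet_Ioo)
  filter_upwards [hmem] with z hz
  rcases eq_or_ne z.2 0 with h0 | h0
  · rw [h0, norm_zero, Real.zero_rpow (by have : 0 < n / p + b := by positivity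
                                          linarith)]
    simp
  have hd : 0 < ‖z.2‖ := norm_pos_iff.2 h0
  refine (mul_le_mul_right (hC f z.1 ⟨hz.1.le, hz.2.le⟩ z.2) _).trans ?_
  rw [← ENNReal.tsum_mul_left]
  refine ENNReal.tsum_le_tsum fun j => le_of_eq ?_
  have h2 : (0 : ℝ) < 2 ^ j := by positivity
  have e : ENNReal.ofReal (‖z.2‖ ^ (-(n / p + b))) * mn (2 ^ j * ‖z.2‖) ^ 2 *
      pw (-(b * j)) = ENNReal.ofReal (‖z.2‖ ^ (-(n / p))) * rho 2 b (‖z.2‖ * 2 ^ j) := by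
    rw [mn, rho, pw, Real.rpow_two, Real.mul_rpow hd.le h2.le, neg_add, Real.rpow_add hd,
      ← ENNReal.ofReal_pow (by positivity),
      ← ENNReal.ofReal_mul (by positivity), ← ENNReal.ofReal_mul (by positivity),
      ← ENNReal.ofReal_mul (by positivity), show -(b * j) = (j : ℝ) * (-b) by ring,
      Real.rpow_mul two_pos.le, Real.rpow_natCast, mul_comm (2 ^ j : ℝ)]
    congr 1
    ring
  calc _ = C * (pw ((α - 2 / p) * j) * lpNorm P p f j) *
        (pw (2 * j / p) * kap (z.1 * 4 ^ j)) *
        (ENNReal.ofReal (‖z.2‖ ^ (-(n / p + b))) * mn (2 ^ j * ‖z.2‖) ^ 2 *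
          pw (-(b * j))) := by
        rw [two_pow_mul_eq (p := p) α]
        ring
    _ = _ := by
        rw [e, wt]
        ring

end UpperBound

section LowerBound

variable {n : ℕ} {p : ℝ}

/-- The low frequencies are controlled by the `Lᵖ` norm on the strip. -/
lemma exists_lpNorm_zero_le (hp : 1 ≤ p) {T : ℝ} (hT : 0 < T) (P : LPFamily n) :
    ∃ C : ℝ≥0, ∀ f : 𝓢(Rn n, ℂ), lpNorm P p f 0 ≤
      C * eLpNorm (dXmulti 0 (dT^[0] (heatExt f))) (ENNReal.ofReal p)
        (stripMeasure n (ENNReal.ofReal T)) := by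
  have hp0 : 0 < p := by linarith
  obtain ⟨C, hC⟩ := MulBound.exists_of_compact hp (isCompact_Icc (a := 0) (b := T))
    (fun z : ℝ × Rn n => lpSym P 0 z.2 * hs (-z.1) z.2) (fun t _ ξ => by
      have h1 : ContDiff ℝ ∞ (fun z : ℝ × Rn n => lpSym P 0 z.2) :=
        (contDiff_fourier_schwartz P.ψ).comp contDiff_snd
      have h2 : ContDiff ℝ ∞ (fun z : ℝ × Rn n => hs (-z.1) z.2) :=
        contDiff_hs_uncurry.comp (contDiff_fst.neg.prodMk contDiff_snd)
      exact (h1.mul h2).contDiffAt) 2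
    fun t _ ξ hξ => by simp only [lpSym_zero_eq_zero P hξ.le, zero_mul]
  refine ⟨(C ^ p * (T⁻¹).toNNReal) ^ (1 / p), fun f => ?_⟩
  set g : Rn n → ℂ := fun ξ => Ms 0 0 ξ * 𝓕 (f : Rn n → ℂ) ξ with hg
  have hgi : Integrable g := (rapid_Ms 0 0 f).integrable
  rw [eLpNorm_congr_ae (stripMeasure_congr (deriv_heatExt 0 0 f))]
  set N := eLpNorm (W g) (ENNReal.ofReal p) (stripMeasure n (ENNReal.ofReal T)) with hN
  set a := lpNorm P p f 0 with ha
  have key : ∀ t ∈ Set.Ioo 0 T, a ≤ C * eLpNorm (fun X => W g (X, t)) (ENNReal.ofReal p) volume := by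
    intro t ht
    simp only [W_of_nonneg g _ ht.1.le]
    refine le_of_eq_of_le ?_ (hC t ⟨ht.1.le, ht.2.le⟩ _ (integrable_hs_mul ht.1.le hgi)).2
    rw [ha, lpNorm]
    congr 2
    ext ξ
    have h1 : hs (-t) ξ * hs t ξ = 1 := by rw [← hs_add]; simp [hs]
    simp only [hg, Ms_zero, pow_zero, one_mul]
    linear_combination (-(lpSym P 0 ξ * 𝓕 (f : Rn n → ℂ) ξ)) * h1
  have hint : a ^ p * ENNReal.ofReal T ≤ C ^ p * N ^ p := by
    rw [hN, eLpNorm_stripMeasure_rpow hp T (continuous_W hgi), ← lintegral_const_mul' _ _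
      (ENNReal.rpow_ne_top_of_nonneg hp0.le ENNReal.coe_ne_top)]
    calc a ^ p * ENNReal.ofReal T = ∫⁻ _ in Set.Ioo 0 T, a ^ p := by
          rw [setLIntegral_const, Real.volume_Ioo, sub_zero]
      _ ≤ _ := setLIntegral_mono' measurableSet_Ioo fun t ht => by
          rw [← ENNReal.mul_rpow_of_nonneg _ _ hp0.le]
          exact ENNReal.rpow_le_rpow (key t ht) hp0.le
  have h := rpow_one_div_le_of_le_mul hp (x := a ^ p) (B := N)
    (C := C ^ p * (T⁻¹).toNNReal) (by
      calc a ^ p = a ^ p * ENNReal.ofReal T * ENNReal.ofReal T⁻¹ := by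
            rw [mul_assoc, ← ENNReal.ofReal_mul hT.le, mul_inv_cancel₀ hT.ne', ENNReal.ofReal_one,
              mul_one]
        _ ≤ C ^ p * N ^ p * ENNReal.ofReal T⁻¹ := mul_le_mul_left hint _
        _ = _ := by
            rw [ENNReal.coe_mul, ENNReal.coe_rpow_of_nonneg _ hp0.le, ENNReal.ofReal]
            ring)
  rwa [← ENNReal.rpow_mul, mul_one_div_cancel hp0.ne', ENNReal.rpow_one] at h

/-- A high frequency piece is controlled by time differences at the matching scale. -/
lemma exists_lpNorm_succ_le (hp : 1 ≤ p) {T : ℝ} (hT : 0 < T) (i : ℕ) (P : LPFamily n) :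
    ∃ C : ℝ≥0, ∀ (f : 𝓢(Rn n, ℂ)) (j : ℕ), ∀ t ∈ Set.Icc (T / 4 ^ (j + 1)) (2 * T / 4 ^ (j + 1)),
      ∀ s ∈ Set.Icc (3 * T / 4 ^ (j + 1)) (4 * T / 4 ^ (j + 1)),
      lpNorm P p f (j + 1) ≤ C * pw (-(2 * i * (j + 1))) *
        eLpNorm (fun X => W (fun ξ => Ms 0 i ξ * 𝓕 (f : Rn n → ℂ) ξ) (X, t) -
          W (fun ξ => Ms 0 i ξ * 𝓕 (f : Rn n → ℂ) ξ) (X, s)) (ENNReal.ofReal p) volume := by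
  have hne : ∀ θ ∈ Set.Icc T (2 * T) ×ˢ Set.Icc (3 * T) (4 * T), ∀ ξ : Rn n, ξ ≠ 0 →
      (-(qs ξ : ℂ)) ^ i * (hs θ.1 ξ - hs θ.2 ξ) ≠ 0 := fun θ hθ ξ hξ => by
    have hq := qs_pos hξ
    refine mul_ne_zero (pow_ne_zero _ (neg_ne_zero.2 (by exact_mod_cast hq.ne'))) ?_
    rw [sub_ne_zero, hs, hs]
    refine fun h => ?_
    have := Real.exp_injective (Complex.ofReal_injective h)
    have h1 := hθ.1.2
    have h2 := hθ.2.1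
    nlinarith
  obtain ⟨C, hC⟩ := MulBound.exists_of_annulus hp
    ((isCompact_Icc (a := T) (b := 2 * T)).prod (isCompact_Icc (a := 3 * T) (b := 4 * T)))
    (contDiff_fourier_schwartz P.φ) (r := 1 / 2) (R := 2) (by norm_num)
    (fun ξ hξ => phi_eq_zero P fun h => by linarith [h.1])
    (fun ξ hξ => phi_eq_zero P fun h => by linarith [h.2])
    (fun z : (ℝ × ℝ) × Rn n => ((-(qs z.2 : ℂ)) ^ i * (hs z.1.1 z.2 - hs z.1.2 z.2))⁻¹)
    (fun θ hθ ξ hξ => by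
      refine ContDiffAt.inv ?_ (hne θ hθ ξ hξ)
      have h1 : ContDiff ℝ ∞ (fun z : (ℝ × ℝ) × Rn n => hs z.1.1 z.2) :=
        contDiff_hs_uncurry.comp (contDiff_fst.fst.prodMk contDiff_snd)
      have h2 : ContDiff ℝ ∞ (fun z : (ℝ × ℝ) × Rn n => hs z.1.2 z.2) :=
        contDiff_hs_uncurry.comp (contDiff_fst.snd.prodMk contDiff_snd)
      have h3 : ContDiff ℝ ∞ (fun z : (ℝ × ℝ) × Rn n => (qs z.2 : ℂ)) :=
        Complex.ofRealCLM.contDiff.comp (contDiff_qs.comp contDiff_snd)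
      exact ((h3.neg.pow i).mul (h1.sub h2)).contDiffAt)
  refine ⟨C, fun f j t ht s hs' => ?_⟩
  have h4 : (0 : ℝ) < 4 ^ (j + 1) := by positivity
  have ht' : t * 4 ^ (j + 1) ∈ Set.Icc T (2 * T) :=
    ⟨(div_le_iff₀ h4).1 ht.1, (le_div_iff₀ h4).1 ht.2⟩
  have hs'' : s * 4 ^ (j + 1) ∈ Set.Icc (3 * T) (4 * T) :=
    ⟨(div_le_iff₀ h4).1 hs'.1, (le_div_iff₀ h4).1 hs'.2⟩
  have ht0 : 0 ≤ t := le_trans (by positivity) ht.1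
  have hs0 : 0 ≤ s := le_trans (by positivity) hs'.1
  have hθ : (t * 4 ^ (j + 1), s * 4 ^ (j + 1)) ∈ Set.Icc T (2 * T) ×ˢ Set.Icc (3 * T) (4 * T) :=
    ⟨ht', hs''⟩
  set g : Rn n → ℂ := fun ξ => Ms 0 i ξ * 𝓕 (f : Rn n → ℂ) ξ with hg
  have hgi : Integrable g := (rapid_Ms 0 i f).integrable
  set c : ℂ := (((2 : ℝ) ^ (-(2 * i * (j + 1) : ℝ)) : ℝ) : ℂ) with hc
  have hcn : ‖c‖ₑ = pw (-(2 * i * (j + 1))) := by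
    rw [hc, ← ofReal_norm, Complex.norm_real, Real.norm_of_nonneg (by positivity), pw]
  have hB := (((hC _ hθ).comp_smul (r := ((2 : ℝ) ^ (j + 1))⁻¹) (by positivity)).const_mul c _
    ((integrable_hs_mul ht0 hgi).sub (integrable_hs_mul hs0 hgi))).2
  rw [hcn, mul_comm (pw _)] at hB
  refine le_of_eq_of_le ?_ (hB.trans (le_of_eq ?_))
  · rw [lpNorm]
    congr 2
    ext ξ
    simp only [hs_inv_smul, lpSym, Pi.sub_apply]
    rcases eq_or_ne ξ 0 with rfl | hξ
    · rw [smul_zero, phi_eq_zero P (by norm_num)]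
      ring
    have hη : ((2 : ℝ) ^ (j + 1))⁻¹ • ξ ≠ 0 := smul_ne_zero (by positivity) hξ
    have h5 := hne _ hθ _ hη
    simp only [hs_inv_smul] at h5
    have h6 : (-(qs (((2 : ℝ) ^ (j + 1))⁻¹ • ξ) : ℂ)) ^ i = c * Ms 0 i ξ := by
      rw [Ms_zero, qs_smul, hc, neg_pow, neg_pow (qs ξ : ℂ), Complex.ofReal_mul, mul_pow,
        show -(2 * (i : ℝ) * (j + 1)) = -((2 * (j + 1) * i : ℕ) : ℝ) by push_cast; ring,
        Real.rpow_neg two_pos.le, Real.rpow_natCast]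
      push_cast
      rw [pow_mul, inv_pow, ← pow_mul (2 : ℂ), mul_comm (j + 1) 2, inv_pow]
      ring
    rw [h6] at h5 ⊢
    simp only [hg]
    linear_combination (-(𝓕 (P.φ : Rn n → ℂ) (((2 : ℝ) ^ (j + 1))⁻¹ • ξ) *
      𝓕 (f : Rn n → ℂ) ξ)) * mul_inv_cancel₀ h5
  · congr 2
    ext X
    rw [W_of_nonneg _ _ ht0, W_of_nonneg _ _ hs0]
    exact congrFun (fourierInv_sub (integrable_hs_mul ht0 hgi) (integrable_hs_mul hs0 hgi)) X

/-- The high frequencies are controlled by the time seminorm. -/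
lemma exists_tsum_lpNorm_succ_le (hp : 1 ≤ p) {T : ℝ} (hT : 0 < T) (i : ℕ) {α : ℝ}
    (hα : 2 * (i : ℝ) < α) (P : LPFamily n) :
    ∃ C : ℝ≥0, ∀ f : 𝓢(Rn n, ℂ),
      (∑' j : ℕ, (ENNReal.ofReal ((2 : ℝ) ^ ((α - 2 / p) * ((j : ℝ) + 1))) *
        lpNorm P p f (j + 1)) ^ p) ^ (1 / p) ≤
      C * semT (α - 2 * i) p (ENNReal.ofReal T) (dXmulti 0 (dT^[i] (heatExt f))) := by
  have hp0 : 0 < p := by linarith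
  obtain ⟨C, hC⟩ := exists_lpNorm_succ_le hp hT i P
  set b := α - 2 * i with hb
  have hb0 : 0 < b := by linarith
  set δ := 1 / p + b / 2 with hδ
  have hδ0 : 0 < δ := by positivity
  set K : ℝ≥0 := C * ((4 * T) ^ δ).toNNReal with hK
  set K' : ℝ≥0 := K ^ p * ((T ^ 2)⁻¹).toNNReal with hK'
  refine ⟨K' ^ (1 / p), fun f => rpow_one_div_le_of_le_mul hp ?_⟩
  set g : Rn n → ℂ := fun ξ => Ms 0 i ξ * 𝓕 (f : Rn n → ℂ) ξ with hg
  have hgi : Integrable g := (rapid_Ms 0 i f).integrable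
  rw [semT_congr (deriv_heatExt 0 i f), semT_eq hp hb0 T (continuous_W hgi), ← ENNReal.rpow_mul,
    one_div_mul_cancel hp0.ne', ENNReal.rpow_one]
  set F : ℝ × ℝ → ℝ≥0∞ := fun z => ENNReal.ofReal (|z.1 - z.2| ^ (-δ)) *
    eLpNorm (fun X => W g (X, z.1) - W g (X, z.2)) (ENNReal.ofReal p) volume with hF
  set box : ℕ → Set (ℝ × ℝ) := fun j => Set.Ioo (T / 4 ^ (j + 1)) (2 * T / 4 ^ (j + 1)) ×ˢ
    Set.Ioo (3 * T / 4 ^ (j + 1)) (4 * T / 4 ^ (j + 1)) with hbox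
  have hmeas : ∀ j, MeasurableSet (box j) := fun j => measurableSet_Ioo.prod measurableSet_Ioo
  have hvol : ∀ j, timePairs T (box j) = ENNReal.ofReal (T ^ 2) * pw (-(4 * (j + 1))) := by
    intro j
    have h1 : (1 : ℝ) ≤ 4 ^ j := one_le_pow₀ (by norm_num)
    have h4 : (0 : ℝ) < 4 ^ (j + 1) := by positivity
    have h5 : 4 * T / 4 ^ (j + 1) ≤ T := by
      rw [div_le_iff₀ h4, pow_succ]
      nlinarith
    have h6 : 2 * T / 4 ^ (j + 1) ≤ 4 * T / 4 ^ (j + 1) := by gcongr; norm_num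
    rw [timePairs, hbox, Measure.prod_prod, Measure.restrict_apply measurableSet_Ioo,
      Measure.restrict_apply measurableSet_Ioo,
      Set.inter_eq_left.2 (Set.Ioo_subset_Ioo (by positivity) (h6.trans h5)),
      Set.inter_eq_left.2 (Set.Ioo_subset_Ioo (by positivity) h5), Real.volume_Ioo,
      Real.volume_Ioo, ← ENNReal.ofReal_mul (by rw [← sub_div]; apply div_nonneg <;> linarith), pw,
      ← ENNReal.ofReal_mul (by positivity)]
    congr 1
    rw [Real.rpow_neg two_pos.le, show (4 : ℝ) * (j + 1) = ((2 * (j + 1) * 2 : ℕ) : ℝ) by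
      push_cast; ring, Real.rpow_natCast, pow_mul, pow_mul]
    norm_num
    field_simp
    ring
  have hdisj : Pairwise (Function.onFun Disjoint box) := by
    have h : ∀ j k, j < k → Disjoint (box j) (box k) := fun j k hjk => by
      refine Set.disjoint_left.2 fun z hz hz' => ?_
      have h1 := hz.1.1
      have h2 := hz'.1.2
      have h3 : 2 * T / 4 ^ (k + 1) ≤ T / 4 ^ (j + 1) := by
        have h5 : (4 : ℝ) ^ (j + 1 + 1) ≤ 4 ^ (k + 1) := pow_le_pow_right₀ (by norm_num) (by omega)
        have h4 : (0 : ℝ) < 4 ^ (j + 1) := by positivity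
        rw [div_le_div_iff₀ (by positivity) h4]
        rw [pow_succ] at h5
        nlinarith
      linarith
    intro j k hjk
    rcases lt_or_gt_of_ne hjk with h' | h'
    exacts [h j k h', (h k j h').symm]
  have hterm : ∀ j : ℕ, (ENNReal.ofReal ((2 : ℝ) ^ ((α - 2 / p) * ((j : ℝ) + 1))) *
      lpNorm P p f (j + 1)) ^ p ≤ K' * ∫⁻ z in box j, F z ^ p ∂timePairs T := by
    intro j
    set A := ENNReal.ofReal ((2 : ℝ) ^ ((α - 2 / p) * ((j : ℝ) + 1))) * lpNorm P p f (j + 1) with hA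
    have h4 : (0 : ℝ) < 4 ^ (j + 1) := by positivity
    have hpt : ∀ z ∈ box j, A ≤ K * pw (-(4 * (j + 1) / p)) * F z := fun z hz => by
      have hd : 0 < |z.1 - z.2| := by
        have h1 := hz.1.2
        have h2 := hz.2.1
        have h3 : 2 * T / 4 ^ (j + 1) ≤ 3 * T / 4 ^ (j + 1) := by gcongr; norm_num
        exact abs_pos.2 (by linarith)
      have hd' : |z.1 - z.2| * 4 ^ (j + 1) ≤ 4 * T := by
        rw [← le_div_iff₀ h4, abs_le]
        have h1 := hz.1.2
        have h2 := hz.2.1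
        have h0 := hz.1.1
        have h6 := hz.2.2
        have h3 : 2 * T / 4 ^ (j + 1) ≤ 3 * T / 4 ^ (j + 1) := by gcongr; norm_num
        have h5 : 0 < T / 4 ^ (j + 1) := by positivity
        constructor <;> linarith
      have e : pw (2 * (j + 1) * δ) ≤ ENNReal.ofReal ((4 * T) ^ δ) *
          ENNReal.ofReal (|z.1 - z.2| ^ (-δ)) := by
        rw [pw, ← ENNReal.ofReal_mul (by positivity)]
        refine ENNReal.ofReal_le_ofReal ?_
        rw [Real.rpow_neg hd.le, ← div_eq_mul_inv, le_div_iff₀ (by positivity),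
          show (2 : ℝ) * (j + 1) = ((2 * (j + 1) : ℕ) : ℝ) by push_cast; ring,
          Real.rpow_mul two_pos.le, Real.rpow_natCast, pow_mul, ← Real.mul_rpow (by positivity)
          hd.le]
        refine Real.rpow_le_rpow (by positivity) ?_ hδ0.le
        rw [mul_comm]
        norm_num
        exact hd'
      calc A ≤ pw ((α - 2 / p) * (j + 1)) * (C * pw (-(2 * i * (j + 1))) *
            eLpNorm (fun X => W g (X, z.1) - W g (X, z.2)) (ENNReal.ofReal p) volume) :=
            mul_le_mul_right (hC f j z.1 (Set.Ioo_subset_Icc_self hz.1) z.2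
              (Set.Ioo_subset_Icc_self hz.2)) _
        _ = C * pw (-(4 * (j + 1) / p)) * (pw (2 * (j + 1) * δ) *
            eLpNorm (fun X => W g (X, z.1) - W g (X, z.2)) (ENNReal.ofReal p) volume) := by
            have : pw ((α - 2 / p) * (j + 1)) * pw (-(2 * i * (j + 1))) =
                pw (-(4 * (j + 1) / p)) * pw (2 * (j + 1) * δ) := by
              rw [← pw_add, ← pw_add, hδ, hb]
              congr 1
              field_simp
              ring
            rw [← mul_assoc, mul_left_comm, this, ← mul_assoc, ← mul_assoc]
        _ ≤ C * pw (-(4 * (j + 1) / p)) * (ENNReal.ofReal ((4 * T) ^ δ) *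
            ENNReal.ofReal (|z.1 - z.2| ^ (-δ)) *
            eLpNorm (fun X => W g (X, z.1) - W g (X, z.2)) (ENNReal.ofReal p) volume) := by
            gcongr
        _ = _ := by
            rw [hK, hF, ENNReal.coe_mul]
            change _ = C * ENNReal.ofReal ((4 * T) ^ δ) * _ * _
            ring
    have hcst : pw (-(4 * (j + 1))) ≠ ⊤ := ENNReal.ofReal_ne_top
    have hcst0 : pw (-(4 * (j + 1))) ≠ 0 := by
      rw [pw, ENNReal.ofReal_ne_zero_iff]
      positivity
    have hle : A ^ p * (ENNReal.ofReal (T ^ 2) * pw (-(4 * (j + 1)))) ≤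
        K ^ p * pw (-(4 * (j + 1))) * ∫⁻ z in box j, F z ^ p ∂timePairs T := by
      rw [← hvol, ← setLIntegral_const, ← lintegral_const_mul' _ _ (ENNReal.mul_ne_top
        (ENNReal.rpow_ne_top_of_nonneg hp0.le ENNReal.coe_ne_top) hcst)]
      refine setLIntegral_mono' (hmeas j) fun z hz => ?_
      refine (ENNReal.rpow_le_rpow (hpt z hz) hp0.le).trans (le_of_eq ?_)
      rw [ENNReal.mul_rpow_of_nonneg _ _ hp0.le, ENNReal.mul_rpow_of_nonneg _ _ hp0.le,
        pw_rpow hp0.le, neg_mul, div_mul_cancel₀ _ hp0.ne']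
    have hle' : A ^ p * ENNReal.ofReal (T ^ 2) ≤
        K ^ p * ∫⁻ z in box j, F z ^ p ∂timePairs T := by
      rw [← ENNReal.mul_le_mul_iff_left hcst0 hcst]
      refine (le_of_eq ?_).trans (hle.trans (le_of_eq ?_)) <;> ring
    calc A ^ p = A ^ p * ENNReal.ofReal (T ^ 2) * ENNReal.ofReal (T ^ 2)⁻¹ := by
          rw [mul_assoc, ← ENNReal.ofReal_mul (by positivity), mul_inv_cancel₀ (by positivity),
            ENNReal.ofReal_one, mul_one]
      _ ≤ K ^ p * (∫⁻ z in box j, F z ^ p ∂timePairs T) * ENNReal.ofReal (T ^ 2)⁻¹ :=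
          mul_le_mul_left hle' _
      _ = _ := by
          rw [hK', ENNReal.coe_mul (K ^ p), ENNReal.coe_rpow_of_nonneg _ hp0.le, ENNReal.ofReal]
          ring
  calc _ ≤ ∑' j, K' * ∫⁻ z in box j, F z ^ p ∂timePairs T := ENNReal.tsum_le_tsum hterm
    _ = K' * ∫⁻ z in ⋃ j, box j, F z ^ p ∂timePairs T := by
        rw [ENNReal.tsum_mul_left, lintegral_iUnion hmeas hdisj]
    _ ≤ _ := by
        gcongr
        exact Measure.restrict_le_self

end LowerBound

section Equivalence

variable {n : ℕ} {p : ℝ}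

lemma exists_sum_le_mul {ι S : Type*} (s : Finset ι) {F : ι → S → ℝ≥0∞} {B : S → ℝ≥0∞}
    (h : ∀ a ∈ s, ∃ C : ℝ≥0, ∀ f, F a f ≤ C * B f) :
    ∃ C : ℝ≥0, ∀ f, ∑ a ∈ s, F a f ≤ C * B f := by
  choose! C hC using h
  refine ⟨∑ a ∈ s, C a, fun f => ?_⟩
  rw [ENNReal.ofNNReal_finsetSum, Finset.sum_mul]
  exact Finset.sum_le_sum fun a ha => hC a ha f

lemma exists_add_le_mul {S : Type*} {F G B : S → ℝ≥0∞} (hF : ∃ C : ℝ≥0, ∀ f, F f ≤ C * B f)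
    (hG : ∃ C : ℝ≥0, ∀ f, G f ≤ C * B f) : ∃ C : ℝ≥0, ∀ f, F f + G f ≤ C * B f := by
  obtain ⟨C, hC⟩ := hF
  obtain ⟨D, hD⟩ := hG
  refine ⟨C + D, fun f => ?_⟩
  rw [ENNReal.coe_add, add_mul]
  exact add_le_add (hC f) (hD f)

lemma exists_pbNorm_le (hn : 1 ≤ n) (hp : 1 ≤ p) {T : ℝ} (hT : 0 < T) (i : ℕ) {α : ℝ}
    (hα1 : 2 * (i : ℝ) < α) (hα2 : α < 2 * (i : ℝ) + 2) (P : LPFamily n) :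
    ∃ C : ℝ≥0, ∀ f : 𝓢(Rn n, ℂ), pbNorm i α p (ENNReal.ofReal T) (heatExt f) ≤
      C * besovN P (α - 2 / p) p f := by
  have hi : ((2 * i : ℕ) : ℝ) = 2 * i := by push_cast; ring
  refine exists_add_le_mul (exists_sum_le_mul _ fun l _ => exists_sum_le_mul _ fun β hβ => ?_)
    (exists_sum_le_mul _ fun l _ => exists_sum_le_mul _ fun β hβ => ?_)
  · refine exists_eLpNorm_heatExt_le hp P β l T (lt_of_le_of_lt ?_ hα1)
    rw [← hi]
    exact_mod_cast (Finset.mem_filter.1 hβ).2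
  · have hk := (Finset.mem_filter.1 hβ).2
    rw [← hi] at hα1 hα2 ⊢
    exact exists_add_le_mul (exists_semT_heatExt_le hp P β l hT.le hk hα1 hα2)
      (exists_semX_heatExt_le hn hp P β l T hk hα1 hα2)

lemma exists_besovN_le (hp : 1 ≤ p) {T : ℝ} (hT : 0 < T) (i : ℕ) {α : ℝ}
    (hα : 2 * (i : ℝ) < α) (P : LPFamily n) :
    ∃ C : ℝ≥0, ∀ f : 𝓢(Rn n, ℂ), besovN P (α - 2 / p) p f ≤
      C * pbNorm i α p (ENNReal.ofReal T) (heatExt f) := by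
  simp only [besovN_eq]
  refine exists_add_le_mul ?_ ?_
  · obtain ⟨C, hC⟩ := exists_lpNorm_zero_le hp hT P
    refine ⟨C, fun f => (hC f).trans (mul_le_mul_right (le_add_right ?_) _)⟩
    refine le_trans ?_ (Finset.single_le_sum (fun _ _ => zero_le)
      (Finset.mem_range.2 (Nat.succ_pos i)))
    exact Finset.single_le_sum (f := fun β : Fin n → ℕ => eLpNorm (dXmulti β (dT^[0] (heatExt f)))
      (ENNReal.ofReal p) (stripMeasure n (ENNReal.ofReal T))) (fun _ _ => zero_le)
      (by simp [Fintype.mem_piFinset])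
  · obtain ⟨C, hC⟩ := exists_tsum_lpNorm_succ_le hp hT i hα P
    refine ⟨C, fun f => (hC f).trans (mul_le_mul_right (le_add_left ?_) _)⟩
    refine le_trans ?_ (Finset.single_le_sum (fun _ _ => zero_le)
      (Finset.mem_range.2 (Nat.lt_succ_self i)))
    refine le_trans (le_add_right le_rfl) (Finset.single_le_sum (f := fun β : Fin n → ℕ =>
      semT (α - 2 * i) p (ENNReal.ofReal T) (dXmulti β (dT^[i] (heatExt f))) +
        semX (α - 2 * i) p (ENNReal.ofReal T) (dXmulti β (dT^[i] (heatExt f))))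
      (fun _ _ => zero_le) (by simp [Fintype.mem_piFinset]))

end Equivalence

end HeatBesov

/-- **Main theorem.** For `2i < α < 2i+2` and `0 < T < ∞`, the heat extension
`u` of `f` satisfies `‖u‖_{B^{α,α/2}_p(ℝⁿ_T)} ≈ B_{α−2/p,p}(f)`. -/
theorem stmt18 (n : ℕ) (hn : 1 ≤ n) (p : ℝ) (hp : 1 ≤ p) (T : ℝ) (hT : 0 < T) (i : ℕ)
    (α : ℝ) (hα1 : 2 * (i : ℝ) < α) (hα2 : α < 2 * (i : ℝ) + 2) (P : LPFamily n) :
    ∃ c C : ℝ, 0 < c ∧ 0 < C ∧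
      ∀ f : SchwartzMap (Rn n) ℂ,
        ENNReal.ofReal c * besovN P (α - 2 / p) p ⇑f
            ≤ pbNorm i α p (ENNReal.ofReal T) (heatExt ⇑f)
          ∧
          pbNorm i α p (ENNReal.ofReal T) (heatExt ⇑f)
            ≤ ENNReal.ofReal C * besovN P (α - 2 / p) p ⇑f := by
  obtain ⟨C, hC⟩ := HeatBesov.exists_pbNorm_le hn hp hT i hα1 hα2 P
  obtain ⟨D, hD⟩ := HeatBesov.exists_besovN_le hp hT i hα1 P
  have hD0 : (0 : ℝ) < D + 1 := by positivity
  refine ⟨((D : ℝ) + 1)⁻¹, C + 1, by positivity, by positivity, fun f => ⟨?_, ?_⟩⟩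
  · rw [ENNReal.ofReal_inv_of_pos hD0, mul_comm, ← div_eq_mul_inv]
    refine ENNReal.div_le_of_le_mul' ((hD f).trans (mul_le_mul_left ?_ _))
    rw [← ENNReal.ofReal_coe_nnreal]
    exact ENNReal.ofReal_le_ofReal (by linarith)
  · refine (hC f).trans (mul_le_mul_left ?_ _)
    rw [← ENNReal.ofReal_coe_nnreal]
    exact ENNReal.ofReal_le_ofReal (by linarith)
end
end

section
/- Let n ≥ 1, 1 ≤ p ≤ ∞, and let h be a Schwartz function on ℝⁿ whose Fourier transform is supported in the annulus {ξ : 1/2 ≤ |ξ| ≤ 2}. There exists C > 0 (depending only on n, p, h) such that for every integer i ≥ 1 and every Schwartz function f on ℝⁿ: ‖h_i * f‖_{Lᵖ(ℝⁿ)} ≤ C·‖Γ(·, 2^{−2i}) * f‖_{Lᵖ(ℝⁿ)}, where h_i(x) := 2^{in} h(2^i x). -/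
noncomputable section

open MeasureTheory Real Complex
open scoped ENNReal NNReal Real BigOperators

/-- The `L¹`-normalised dilate of `u` by the factor `c`. -/
def dilate {n : ℕ} (c : ℝ) (u : Rn n → ℂ) : Rn n → ℂ :=
  fun x => ((c ^ n : ℝ) : ℂ) * u (c • x)

lemma convn_eq_convolution {n : ℕ} (u v : Rn n → ℂ) :
    convn u v = convolution u v (ContinuousLinearMap.mul ℂ ℂ) volume := by
  ext x
  exact (convolution_mul_swap (𝕜 := ℂ) (μ := (volume : Measure (Rn n))) (f := u) (g := v)).symm

lemma FTn_eq_fourier {n : ℕ} (f : Rn n → ℂ) (ξ : Rn n) :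
    FTn f ξ = FourierTransform.fourier f ξ := by
  rw [Real.fourier_eq', FTn]
  congr 1
  ext x
  rw [smul_eq_mul]
  congr 2
  simp only [PiLp.inner_apply, RCLike.inner_apply, conj_trivial]
  push_cast
  simp only [mul_comm (ξ.ofLp _ : ℂ)]
  ring

/-- Hölder's inequality for an average against the weight `w`. -/
lemma lintegral_mul_rpow_le {α : Type*} [MeasurableSpace α] {μ : Measure α} {w g : α → ℝ≥0∞}
    (hw : AEMeasurable w μ) (hg : AEMeasurable g μ) {p : ℝ} (hp : 1 ≤ p) :
    (∫⁻ y, w y * g y ∂μ) ^ p ≤ (∫⁻ y, w y ∂μ) ^ (p - 1) * ∫⁻ y, w y * g y ^ p ∂μ := by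
  have hp0 : 0 < p := by linarith
  have hac := withDensity_absolutelyContinuous μ w
  have key := eLpNorm'_le_eLpNorm'_mul_rpow_measure_univ (μ := μ.withDensity w) (f := g)
    one_pos hp (hg.mono_ac hac).aestronglyMeasurable
  simp only [eLpNorm'_eq_lintegral_enorm, enorm_eq_self, ENNReal.rpow_one, div_one,
    withDensity_apply _ MeasurableSet.univ, Measure.restrict_univ] at key
  rw [lintegral_withDensity_eq_lintegral_mul₀ hw hg,
    lintegral_withDensity_eq_lintegral_mul₀ hw (hg.pow_const p)] at key
  refine (ENNReal.rpow_le_rpow key hp0.le).trans_eq ?_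
  rw [ENNReal.mul_rpow_of_nonneg _ _ hp0.le, ← ENNReal.rpow_mul, ← ENNReal.rpow_mul, mul_comm]
  congr 2
  · field_simp
  · rw [one_div_mul_cancel hp0.ne', ENNReal.rpow_one]
    rfl

/-- Young's convolution inequality `L¹ * Lᵖ ⊆ Lᵖ`. -/
lemma eLpNorm_convn_le {n : ℕ} {p : ℝ≥0∞} (hp : 1 ≤ p) {u v : Rn n → ℂ}
    (hu : Continuous u) (hv : Continuous v) :
    eLpNorm (convn u v) p volume ≤ eLpNorm u 1 volume * eLpNorm v p volume := by
  have hpt : ∀ x, ‖convn u v x‖ₑ ≤ ∫⁻ y, ‖u y‖ₑ * ‖v (x - y)‖ₑ := fun x => by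
    rw [convn_eq_convolution, convolution_def]
    refine (enorm_integral_le_lintegral_enorm _).trans_eq ?_
    simp [enorm_mul]
  rw [eLpNorm_one_eq_lintegral_enorm]
  rcases eq_or_ne p ⊤ with rfl | hpt'
  · rw [eLpNorm_exponent_top, eLpNorm_exponent_top]
    refine eLpNormEssSup_le_of_ae_enorm_bound (.of_forall fun x => (hpt x).trans ?_)
    rw [← lintegral_mul_const _ (by fun_prop)]
    refine lintegral_mono_ae ?_
    have := (quasiMeasurePreserving_sub_left_of_right_invariant
      (volume : Measure (Rn n)) x).ae (enorm_ae_le_eLpNormEssSup v volume)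
    filter_upwards [this] with y hy
    gcongr
  · have hp1 : 1 ≤ p.toReal := by simpa using ENNReal.toReal_mono hpt' hp
    have hp0 : 0 < p.toReal := by linarith
    have hpz : p ≠ 0 := (zero_lt_one.trans_le hp).ne'
    rw [← ENNReal.rpow_le_rpow_iff hp0, ENNReal.mul_rpow_of_nonneg _ _ hp0.le,
      eLpNorm_eq_lintegral_rpow_enorm_toReal hpz hpt',
      eLpNorm_eq_lintegral_rpow_enorm_toReal hpz hpt', ← ENNReal.rpow_mul, ← ENNReal.rpow_mul,
      one_div_mul_cancel hp0.ne', ENNReal.rpow_one, ENNReal.rpow_one]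
    set q := p.toReal
    calc ∫⁻ x, ‖convn u v x‖ₑ ^ q
        ≤ ∫⁻ x, (∫⁻ y, ‖u y‖ₑ) ^ (q - 1) * ∫⁻ y, ‖u y‖ₑ * ‖v (x - y)‖ₑ ^ q := by
          refine lintegral_mono fun x => (ENNReal.rpow_le_rpow (hpt x) hp0.le).trans ?_
          exact lintegral_mul_rpow_le (by fun_prop) (by fun_prop) hp1
      _ = (∫⁻ y, ‖u y‖ₑ) ^ (q - 1) * ∫⁻ y, ∫⁻ x, ‖u y‖ₑ * ‖v (x - y)‖ₑ ^ q := by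
          have hm : Measurable fun z : Rn n × Rn n => ‖u z.2‖ₑ * ‖v (z.1 - z.2)‖ₑ ^ q := by
            fun_prop
          rw [lintegral_const_mul _ hm.lintegral_prod_right', lintegral_lintegral_swap
            (f := fun x y => ‖u y‖ₑ * ‖v (x - y)‖ₑ ^ q) hm.aemeasurable]
      _ = (∫⁻ y, ‖u y‖ₑ) ^ (q - 1) * ((∫⁻ y, ‖u y‖ₑ) * ∫⁻ x, ‖v x‖ₑ ^ q) := by
          congr 1
          rw [← lintegral_mul_const _ (by fun_prop)]
          refine lintegral_congr fun y => ?_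
          have hvm : Measurable v := hv.measurable
          rw [lintegral_const_mul _ (by fun_prop),
            lintegral_sub_right_eq_self (fun x => ‖v x‖ₑ ^ q) y]
      _ = (∫⁻ y, ‖u y‖ₑ) ^ q * ∫⁻ x, ‖v x‖ₑ ^ q := by
          rw [← mul_assoc]
          congr 1
          conv_lhs => rw [← ENNReal.rpow_one (∫⁻ y, ‖u y‖ₑ), ← ENNReal.rpow_mul, one_mul]
          rw [← ENNReal.rpow_add_of_nonneg _ _ (by linarith) zero_le_one, sub_add_cancel]

lemma convolutionExists_norm_of_bddAbove {n : ℕ} {u v : Rn n → ℝ} (hu : Integrable u)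
    (hv : Continuous v) (hb : BddAbove (Set.range fun x => ‖v x‖)) :
    ConvolutionExists u v (ContinuousLinearMap.mul ℝ ℝ) volume := fun _ =>
  BddAbove.convolutionExistsAt (s := Set.univ) _ (hb.mono (Set.image_subset_range _ _))
    MeasurableSet.univ (Set.subset_univ _) hu.integrableOn hv.aestronglyMeasurable

lemma bddAbove_norm_convolution {n : ℕ} {u v : Rn n → ℝ} (hu : Integrable u)
    (hb : BddAbove (Set.range fun x => ‖v x‖)) :
    BddAbove (Set.range fun x =>
      ‖convolution u v (ContinuousLinearMap.mul ℝ ℝ) volume x‖) := by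
  obtain ⟨M, hM⟩ := hb
  refine ⟨∫ y, ‖u y‖ * M, ?_⟩
  rintro _ ⟨x, rfl⟩
  refine norm_integral_le_of_norm_le (hu.norm.mul_const M) (.of_forall fun y => ?_)
  rw [ContinuousLinearMap.mul_apply', norm_mul]
  exact mul_le_mul_of_nonneg_left (hM ⟨_, rfl⟩) (norm_nonneg _)

lemma convn_assoc {n : ℕ} {u v w : Rn n → ℂ} (hu : Integrable u) (hv : Integrable v)
    (hw : Continuous w) (hb : BddAbove (Set.range fun x => ‖w x‖)) :
    convn (convn u v) w = convn u (convn v w) := by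
  simp only [convn_eq_convolution]
  ext x
  have hb' : BddAbove (Set.range fun x => ‖‖w x‖‖) := by simpa only [norm_norm] using hb
  exact convolution_assoc _ _ _ _ (fun a b c => mul_assoc a b c) hu.1 hv.1
    hw.aestronglyMeasurable (hu.ae_convolution_exists _ hv)
    (.of_forall (convolutionExists_norm_of_bddAbove hv.norm hw.norm hb'))
    (convolutionExists_norm_of_bddAbove hu.norm
      (hb'.continuous_convolution_right_of_integrable _ hv.norm hw.norm)
      (bddAbove_norm_convolution hv.norm hb') x)

lemma continuous_convn {n : ℕ} {u v : Rn n → ℂ} (hu : Integrable u) (hv : Continuous v)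
    (hb : BddAbove (Set.range fun x => ‖v x‖)) : Continuous (convn u v) := by
  rw [convn_eq_convolution]
  exact hb.continuous_convolution_right_of_integrable _ hu hv

lemma bddAbove_range_norm {n : ℕ} (f : SchwartzMap (Rn n) ℂ) :
    BddAbove (Set.range fun x => ‖f x‖) :=
  ⟨_, by rintro _ ⟨x, rfl⟩; exact f.norm_le_seminorm ℝ x⟩

lemma integrable_dilate {n : ℕ} {c : ℝ} (hc : c ≠ 0) {u : Rn n → ℂ} (hu : Integrable u) :
    Integrable (dilate c u) :=
  (hu.comp_smul hc).const_mul _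

lemma dilate_convn {n : ℕ} {c : ℝ} (hc : 0 < c) (u v : Rn n → ℂ) :
    dilate c (convn u v) = convn (dilate c u) (dilate c v) := by
  ext x
  simp only [dilate, convn]
  have h := Measure.integral_comp_smul (volume : Measure (Rn n))
    (fun y => u (c • x - y) * v y) c
  rw [finrank_euclideanSpace_fin, abs_of_pos (by positivity)] at h
  calc _ = ((c ^ n : ℝ) : ℂ) * ((c ^ n : ℝ) * ∫ y, u (c • x - c • y) * v (c • y)) := by
        rw [h, Complex.real_smul, ← mul_assoc ((c ^ n : ℝ) : ℂ) (((c ^ n)⁻¹ : ℝ) : ℂ),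
          ← Complex.ofReal_mul, mul_inv_cancel₀ (by positivity), Complex.ofReal_one, one_mul]
    _ = _ := by
        rw [← integral_const_mul, ← integral_const_mul]
        refine integral_congr_ae (.of_forall fun y => ?_)
        simp only [smul_sub]
        ring

lemma eLpNorm_one_dilate {n : ℕ} {c : ℝ} (hc : 0 < c) {u : Rn n → ℂ} (hu : Integrable u) :
    eLpNorm (dilate c u) 1 volume = eLpNorm u 1 volume := by
  rw [eLpNorm_one_eq_lintegral_enorm, eLpNorm_one_eq_lintegral_enorm,
    ← ofReal_integral_norm_eq_lintegral_enorm hu,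
    ← ofReal_integral_norm_eq_lintegral_enorm (integrable_dilate hc.ne' hu)]
  have h := Measure.integral_comp_smul (volume : Measure (Rn n)) (fun y => ‖u y‖) c
  rw [finrank_euclideanSpace_fin, abs_of_pos (by positivity), smul_eq_mul] at h
  simp only [dilate, norm_mul, Complex.norm_real, norm_pow, Real.norm_of_nonneg hc.le]
  rw [integral_const_mul, h, ← mul_assoc, mul_inv_cancel₀ (by positivity), one_mul]

lemma dilate_heatKer {n : ℕ} {c : ℝ} (hc : 0 < c) :
    dilate c (fun X : Rn n => (heatKer n X 1 : ℂ)) =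
      fun X => (heatKer n X (c ^ 2)⁻¹ : ℂ) := by
  ext X
  have hc2 : 0 < (c ^ 2)⁻¹ := by positivity
  simp only [dilate, heatKer, hc2, zero_lt_one, if_true, mul_one]
  rw [← Complex.ofReal_mul, ← mul_assoc]
  congr 2
  · rw [Real.mul_rpow (by positivity) hc2.le, mul_comm]
    congr 1
    rw [← Real.rpow_natCast c 2, ← Real.rpow_neg hc.le, ← Real.rpow_mul hc.le, ← Real.rpow_natCast]
    congr 1
    push_cast
    ring
  · rw [norm_smul, Real.norm_of_nonneg hc.le]
    congr 1
    field_simp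

lemma heatKer_one_eq {n : ℕ} (X : Rn n) :
    (heatKer n X 1 : ℂ) = (((4 * π) ^ (-(n : ℝ) / 2) : ℝ) : ℂ) *
      Complex.exp (-(1 / 4 : ℂ) * (‖X‖ : ℂ) ^ 2) := by
  simp only [heatKer, zero_lt_one, if_true, mul_one]
  push_cast
  congr 2
  ring

lemma continuous_heatKer_one (n : ℕ) : Continuous fun X : Rn n => (heatKer n X 1 : ℂ) := by
  simp only [heatKer_one_eq]
  fun_prop

lemma integrable_heatKer_one (n : ℕ) : Integrable fun X : Rn n => (heatKer n X 1 : ℂ) := by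
  simp only [heatKer_one_eq]
  refine Integrable.const_mul ?_ _
  simpa using GaussianFourier.integrable_cexp_neg_mul_sq_norm_add (V := Rn n) (b := 1 / 4)
    (by norm_num) 0 0

lemma fourier_heatKer_one {n : ℕ} (ξ : Rn n) :
    FourierTransform.fourier (fun X : Rn n => (heatKer n X 1 : ℂ)) ξ =
      ((Real.exp (-(4 * π ^ 2 * ‖ξ‖ ^ 2)) : ℝ) : ℂ) := by
  have h := fourier_gaussian_innerProductSpace (V := Rn n) (b := 1 / 4) (by norm_num) ξ
  simp only [heatKer_one_eq]
  rw [Real.fourier_eq] at h ⊢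
  simp only [Circle.smul_def, smul_eq_mul, mul_left_comm _ (((4 * π) ^ (-(n : ℝ) / 2) : ℝ) : ℂ)] at h ⊢
  rw [integral_const_mul, h, ← mul_assoc, finrank_euclideanSpace_fin]
  have h4 : (π / (1 / 4 : ℂ)) ^ ((n : ℂ) / 2) = (((4 * π) ^ ((n : ℝ) / 2) : ℝ) : ℂ) := by
    rw [Complex.ofReal_cpow (by positivity)]
    push_cast
    congr 1
    ring
  rw [h4, ← Complex.ofReal_mul, ← Real.rpow_add (by positivity), neg_div, neg_add_cancel,
    Real.rpow_zero, Complex.ofReal_one, one_mul]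
  push_cast
  congr 1
  ring

/-- A Schwartz function with compactly supported Fourier transform is the heat kernel at time `1`
convolved with a Schwartz function. -/
lemma exists_convn_heatKer_one {n : ℕ} (h : SchwartzMap (Rn n) ℂ)
    (hh : HasCompactSupport (FTn (⇑h))) :
    ∃ K : SchwartzMap (Rn n) ℂ, ⇑h = convn (⇑K) fun X => (heatKer n X 1 : ℂ) := by
  have hF : FTn (⇑h) = ⇑(FourierTransform.fourier h) := by
    ext ξ
    rw [FTn_eq_fourier, SchwartzMap.fourier_coe]
  have hexp : ContDiff ℝ ⊤ fun ξ : Rn n => ((Real.exp (4 * π ^ 2 * ‖ξ‖ ^ 2) : ℝ) : ℂ) :=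
    Complex.ofRealCLM.contDiff.comp
      (Real.contDiff_exp.comp (contDiff_const.mul (contDiff_norm_sq ℝ)))
  let m : SchwartzMap (Rn n) ℂ := HasCompactSupport.toSchwartzMap
    (f := fun ξ => FTn (⇑h) ξ * ((Real.exp (4 * π ^ 2 * ‖ξ‖ ^ 2) : ℝ) : ℂ))
    hh.mul_right (by
      rw [hF]
      exact (SchwartzMap.smooth _ _).mul (hexp.of_le (by simp)))
  refine ⟨FourierTransformInv.fourierInv m, ?_⟩
  set K := FourierTransformInv.fourierInv m with hK
  have hKm : FourierTransform.fourier (⇑K) = ⇑m := by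
    rw [← SchwartzMap.fourier_coe, hK]
    simp
  have hG := integrable_heatKer_one n
  have hfour : FourierTransform.fourier (convn (⇑K) fun X => (heatKer n X 1 : ℂ)) =
      FourierTransform.fourier (⇑h) := by
    ext ξ
    rw [convn_eq_convolution, Real.fourier_mul_convolution_eq K.integrable hG,
      fourier_heatKer_one, hKm, ← FTn_eq_fourier]
    change FTn (⇑h) ξ * _ * _ = _
    rw [mul_assoc, ← Complex.ofReal_mul, ← Real.exp_add, add_neg_cancel, Real.exp_zero,
      Complex.ofReal_one, mul_one]
  have hcont : Continuous (convn (⇑K) fun X => (heatKer n X 1 : ℂ)) := by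
    rw [convn_eq_convolution]
    exact (bddAbove_range_norm K).continuous_convolution_left_of_integrable _ K.continuous hG
  have hint : Integrable (convn (⇑K) fun X => (heatKer n X 1 : ℂ)) := by
    rw [convn_eq_convolution]
    exact K.integrable.integrable_convolution _ hG
  have hFi : Integrable (FourierTransform.fourier (⇑h)) := by
    rw [← SchwartzMap.fourier_coe]
    exact SchwartzMap.integrable _
  rw [← Continuous.fourierInv_fourier_eq hcont hint (hfour ▸ hFi), hfour,
    Continuous.fourierInv_fourier_eq h.continuous h.integrable hFi]

/-- For a Schwartz `h` with `𝓕h` supported in the annulus `1/2 ≤ |ξ| ≤ 2`,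
`‖h_i * f‖_p ≤ C ‖Γ(·,2^{−2i}) * f‖_p` uniformly in `i ≥ 1`. -/
theorem stmt19 (n : ℕ) (hn : 1 ≤ n) (p : ℝ≥0∞) (hp : 1 ≤ p) (h : SchwartzMap (Rn n) ℂ)
    (hh : ∀ ξ : Rn n, FTn (⇑h) ξ ≠ 0 → 1 / 2 ≤ ‖ξ‖ ∧ ‖ξ‖ ≤ 2) :
    ∃ C : ℝ, 0 < C ∧
      ∀ i : ℕ, 1 ≤ i →
        ∀ f : SchwartzMap (Rn n) ℂ,
          eLpNorm (convn (fun x => (((2 : ℝ) ^ (i * n) : ℝ) : ℂ) * h (((2 : ℝ) ^ i) • x)) ⇑f)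
              p volume
            ≤ ENNReal.ofReal C *
              eLpNorm (convn (fun X => ((heatKer n X ((2 : ℝ) ^ (-(2 * (i : ℤ)))) : ℝ) : ℂ))
                ⇑f) p volume := by
  have hsupp : HasCompactSupport (FTn (⇑h)) := by
    refine HasCompactSupport.intro (isCompact_closedBall (0 : Rn n) 2) fun ξ hξ => ?_
    by_contra hne
    exact hξ (by simpa using (hh ξ hne).2)
  obtain ⟨K, hK⟩ := exists_convn_heatKer_one h hsupp
  have hK1 : eLpNorm (⇑K) 1 volume ≠ ⊤ := (memLp_one_iff_integrable.2 K.integrable).2.ne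
  refine ⟨(eLpNorm (⇑K) 1 volume).toReal + 1, by positivity, fun i _ f => ?_⟩
  have hc : (0 : ℝ) < 2 ^ i := by positivity
  have hl : (fun x => (((2 : ℝ) ^ (i * n) : ℝ) : ℂ) * h (((2 : ℝ) ^ i) • x)) =
      dilate (2 ^ i) (⇑h) := by
    ext x
    rw [pow_mul, dilate]
  have hr : (2 : ℝ) ^ (-(2 * (i : ℤ))) = (((2 : ℝ) ^ i) ^ 2)⁻¹ := by
    rw [zpow_neg, mul_comm, zpow_mul, zpow_natCast]
    rfl
  have hG := integrable_dilate hc.ne' (integrable_heatKer_one n)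
  rw [hl, hr, ← dilate_heatKer hc, hK, dilate_convn hc,
    convn_assoc (integrable_dilate hc.ne' K.integrable) hG f.continuous (bddAbove_range_norm f)]
  refine (eLpNorm_convn_le (u := dilate (2 ^ i) (⇑K)) hp
    (continuous_const.mul (K.continuous.comp (continuous_const_smul _)))
    (continuous_convn hG f.continuous (bddAbove_range_norm f))).trans ?_
  rw [eLpNorm_one_dilate hc K.integrable]
  gcongr
  exact (ENNReal.ofReal_toReal hK1).symm.le.trans (ENNReal.ofReal_le_ofReal (by linarith))
end
end
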